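/- Let n ≥ 2 be an integer, α ∈ ℝ, 0 < r ≤ 1, B = B_r(0) ⊂ ℝⁿ, and γ ∈ ℝ. Let u ∈ C¹(B̄ \ {0}) satisfy ∫_B |x|^{nα} e^{u} dx < ∞, |∇u| ∈ L^q(B) for every 1 ≤ q < n, and, for every C¹ function φ with compact support in B, ∫_B |∇u|^{n−2}⟨∇u, ∇φ⟩ dx = ∫_B |x|^{nα} e^{u} φ dx − γ φ(0). Let h ∈ C¹(B̄ \ {0}) satisfy |∇h| ∈ L^q(B) for every 1 ≤ q < n, h = u on ∂B, sup_{x ∈ B \ {0}} |h(x) − c_γ log|x|| < ∞, and, for every C¹ function φ with compact support in B, ∫_B |∇h|^{n−2}⟨∇h, ∇φ⟩ dx = −γ φ(0). Set u₀ = u − h and let d = inf_{X ≠ Y} ⟨|X|^{n−2}X − |Y|^{n−2}Y, X − Y⟩/|X − Y|ⁿ. Then u₀ ≥ 0 on B \ {0}, and for all k, a > 0, ∫_{{x ∈ B : k < u₀(x) < k + a}} |∇u₀|ⁿ dx ≤ (a/d) ∫_B |x|^{nα} e^{u} dx. -/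

import Mathlib

open MeasureTheory Metric Filter Topology Real Set
open scoped InnerProductSpace

/-- The Lebesgue volume of the unit ball in `ℝⁿ`. -/
noncomputable def omegaN (n : ℕ) : ℝ :=
  (volume (ball (0 : EuclideanSpace ℝ (Fin n)) 1)).toReal

/-- `c_γ = sign γ * (|γ| / (n ωₙ))^{1/(n-1)}`. -/
noncomputable def cgamma (n : ℕ) (γ : ℝ) : ℝ :=
  Real.sign γ * (|γ| / ((n : ℝ) * omegaN n)) ^ ((1 : ℝ) / ((n : ℝ) - 1))

/-- `u` is a weak solution of `-Δₙ u = f` on `U`. -/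
def IsWeakNSol (n : ℕ) (U : Set (EuclideanSpace ℝ (Fin n)))
    (u f : EuclideanSpace ℝ (Fin n) → ℝ) : Prop :=
  ∀ φ : EuclideanSpace ℝ (Fin n) → ℝ, ContDiff ℝ 1 φ → HasCompactSupport φ →
    tsupport φ ⊆ U →
    ∫ x in U, ‖gradient u x‖ ^ (n - 2) * ⟪gradient u x, gradient φ x⟫_ℝ
      = ∫ x in U, f x * φ x

/-- The constant `d = inf_{X ≠ Y} ⟨|X|^{n-2}X - |Y|^{n-2}Y, X - Y⟩ / |X - Y|ⁿ`. -/
noncomputable def dconst (n : ℕ) : ℝ :=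
  sInf {c : ℝ | ∃ X Y : EuclideanSpace ℝ (Fin n), X ≠ Y ∧
    c = ⟪‖X‖ ^ (n - 2) • X - ‖Y‖ ^ (n - 2) • Y, X - Y⟫_ℝ / ‖X - Y‖ ^ n}

open scoped ENNReal

/-- The squared positive part is continuously differentiable. -/
theorem hasDerivAt_posPart_sq (x : ℝ) :
    HasDerivAt (fun t : ℝ => (max t 0) ^ 2) (2 * max x 0) x := by
  rcases lt_trichotomy x 0 with hx | hx | hx
  · have h1 : (fun t : ℝ => (max t 0) ^ 2) =ᶠ[𝓝 x] fun _ => 0 := by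
      filter_upwards [eventually_lt_nhds hx] with t ht
      simp [max_eq_right ht.le]
    rw [max_eq_right hx.le, mul_zero]
    exact (hasDerivAt_const x (0 : ℝ)).congr_of_eventuallyEq h1
  · subst hx
    rw [max_self, mul_zero, hasDerivAt_iff_isLittleO]
    have h2 : (fun t : ℝ => t ^ 2) =o[𝓝 0] fun t : ℝ => t := by
      have := (hasDerivAt_pow 2 (0 : ℝ)).isLittleO
      simpa using this
    simp only [sub_zero, max_self, ne_eq, OfNat.ofNat_ne_zero, not_false_eq_true, zero_pow,
      smul_zero]
    refine Asymptotics.IsBigO.trans_isLittleO ?_ h2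
    refine Asymptotics.IsBigO.of_bound 1 (Eventually.of_forall fun t => ?_)
    rw [one_mul, norm_of_nonneg (sq_nonneg _), norm_of_nonneg (sq_nonneg _)]
    rcases le_total t 0 with ht | ht
    · rw [max_eq_right ht]
      simpa using sq_nonneg t
    · rw [max_eq_left ht]
  · have h1 : (fun t : ℝ => (max t 0) ^ 2) =ᶠ[𝓝 x] fun t => t ^ 2 := by
      filter_upwards [eventually_gt_nhds hx] with t ht
      simp [max_eq_left ht.le]
    rw [max_eq_left hx.le]
    simpa using (hasDerivAt_pow 2 x).congr_of_eventuallyEq h1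

/-- A `C¹` regularisation of the positive part, supported in `(-ε, ∞)` and of slope one on
`[0, ∞)`. -/
noncomputable def softPos (ε s : ℝ) : ℝ := ((max (s + ε) 0) ^ 2 - (max s 0) ^ 2) / (2 * ε)

/-- The derivative of `softPos`. -/
noncomputable def softStep (ε s : ℝ) : ℝ := (max (s + ε) 0 - max s 0) / ε

theorem hasDerivAt_softPos (ε s : ℝ) : HasDerivAt (softPos ε) (softStep ε s) s := by
  have h1 := (hasDerivAt_posPart_sq (s + ε)).comp_add_const s ε
  have h2 := ((h1.sub (hasDerivAt_posPart_sq s)).div_const (2 * ε))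
  refine h2.congr_deriv ?_
  unfold softStep
  rw [← mul_sub, mul_div_mul_left _ _ two_ne_zero]

theorem continuous_softStep (ε : ℝ) : Continuous (softStep ε) := by
  unfold softStep; fun_prop

theorem contDiff_softPos (ε : ℝ) : ContDiff ℝ 1 (softPos ε) := by
  rw [contDiff_one_iff_deriv]
  refine ⟨fun s => (hasDerivAt_softPos ε s).differentiableAt, ?_⟩
  have : deriv (softPos ε) = softStep ε := funext fun s => (hasDerivAt_softPos ε s).deriv
  rw [this]; exact continuous_softStep ε

theorem softPos_of_le {ε s : ℝ} (hε : 0 < ε) (h : s ≤ -ε) : softPos ε s = 0 := by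
  unfold softPos
  rw [max_eq_right (by linarith), max_eq_right (by linarith)]; simp

theorem softPos_of_nonneg {ε s : ℝ} (hε : 0 < ε) (h : 0 ≤ s) : softPos ε s = s + ε / 2 := by
  unfold softPos
  rw [max_eq_left (by linarith), max_eq_left (by linarith)]; field_simp; ring

theorem softStep_nonneg {ε s : ℝ} (hε : 0 < ε) : 0 ≤ softStep ε s := by
  unfold softStep
  exact div_nonneg (sub_nonneg.2 (max_le_max_right 0 (by linarith))) hε.le

theorem softStep_le_one {ε s : ℝ} (hε : 0 < ε) : softStep ε s ≤ 1 := by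
  unfold softStep
  rw [div_le_one hε]
  rcases le_total s 0 with h | h
  · rw [max_eq_right h]
    simp only [sub_zero, max_le_iff]; constructor <;> linarith
  · rw [max_eq_left h, max_eq_left (by linarith)]; linarith

theorem softStep_of_nonneg {ε s : ℝ} (hε : 0 < ε) (h : 0 ≤ s) : softStep ε s = 1 := by
  unfold softStep
  rw [max_eq_left (by linarith), max_eq_left (by linarith)]; field_simp; ring

theorem softStep_of_le {ε s : ℝ} (hε : 0 < ε) (h : s ≤ -ε) : softStep ε s = 0 := by
  unfold softStep
  rw [max_eq_right (by linarith), max_eq_right (by linarith)]; simp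

theorem softPos_monotone {ε : ℝ} (hε : 0 < ε) : Monotone (softPos ε) :=
  monotone_of_deriv_nonneg ((contDiff_softPos ε).differentiable (by norm_num)) fun s => by
    rw [(hasDerivAt_softPos ε s).deriv]; exact softStep_nonneg hε

theorem softPos_nonneg {ε s : ℝ} (hε : 0 < ε) : 0 ≤ softPos ε s := by
  unfold softPos
  refine div_nonneg (sub_nonneg.2 ?_) (by linarith)
  exact pow_le_pow_left₀ (le_max_right _ _) (max_le_max_right 0 (by linarith)) 2

theorem softPos_pos {ε s : ℝ} (hε : 0 < ε) (h : -ε < s) : 0 < softPos ε s := by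
  rcases le_total s 0 with h' | h'
  · unfold softPos
    rw [max_eq_left (by linarith), max_eq_right h']
    have : 0 < (s + ε) ^ 2 := pow_pos (by linarith) 2
    simp only [ne_eq, OfNat.ofNat_ne_zero, not_false_eq_true, zero_pow, sub_zero]
    positivity
  · rw [softPos_of_nonneg hε h']; linarith

theorem le_softPos {ε s : ℝ} (hε : 0 < ε) : s ≤ softPos ε s := by
  rcases le_total s 0 with h' | h'
  · exact h'.trans (softPos_nonneg hε)
  · rw [softPos_of_nonneg hε h']; linarith

section
variable {F : Type*} [NormedAddCommGroup F] [InnerProductSpace ℝ F]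

theorem inner_pLaplace_sub_lower (m : ℕ) (X Y : F) :
    (2 : ℝ)⁻¹ ^ (m + 1) * ‖X - Y‖ ^ (m + 2)
      ≤ ⟪‖X‖ ^ m • X - ‖Y‖ ^ m • Y, X - Y⟫_ℝ := by
  have e1 : ⟪‖X‖ ^ m • X - ‖Y‖ ^ m • Y, X - Y⟫_ℝ
      = 2⁻¹ * (‖X‖ ^ m + ‖Y‖ ^ m) * ‖X - Y‖ ^ 2
        + 2⁻¹ * ((‖X‖ ^ m - ‖Y‖ ^ m) * (‖X‖ ^ 2 - ‖Y‖ ^ 2)) := by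
    rw [norm_sub_sq_real]
    simp only [inner_sub_left, inner_sub_right, real_inner_smul_left,
      real_inner_self_eq_norm_sq, real_inner_comm X Y]
    ring
  have e2 : 0 ≤ (‖X‖ ^ m - ‖Y‖ ^ m) * (‖X‖ ^ 2 - ‖Y‖ ^ 2) := by
    rcases le_total ‖X‖ ‖Y‖ with h | h
    · exact mul_nonneg_of_nonpos_of_nonpos
        (sub_nonpos.2 (pow_le_pow_left₀ (norm_nonneg _) h _))
        (sub_nonpos.2 (pow_le_pow_left₀ (norm_nonneg _) h _))
    · exact mul_nonneg
        (sub_nonneg.2 (pow_le_pow_left₀ (norm_nonneg _) h _))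
        (sub_nonneg.2 (pow_le_pow_left₀ (norm_nonneg _) h _))
  have e3 : (2 : ℝ)⁻¹ ^ m * ‖X - Y‖ ^ m ≤ ‖X‖ ^ m + ‖Y‖ ^ m := by
    have hb : ‖X - Y‖ ≤ 2 * max ‖X‖ ‖Y‖ := by
      have := norm_sub_le X Y
      have := le_max_left ‖X‖ ‖Y‖
      have := le_max_right ‖X‖ ‖Y‖
      linarith
    calc (2 : ℝ)⁻¹ ^ m * ‖X - Y‖ ^ m ≤ (2 : ℝ)⁻¹ ^ m * (2 * max ‖X‖ ‖Y‖) ^ m := by gcongr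
      _ = (max ‖X‖ ‖Y‖) ^ m := by rw [← mul_pow]; congr 1; ring
      _ ≤ ‖X‖ ^ m + ‖Y‖ ^ m := by
        rcases max_cases ‖X‖ ‖Y‖ with ⟨h, _⟩ | ⟨h, _⟩ <;> rw [h]
        · linarith [pow_nonneg (norm_nonneg Y) m]
        · linarith [pow_nonneg (norm_nonneg X) m]
  rw [e1]
  calc (2 : ℝ)⁻¹ ^ (m + 1) * ‖X - Y‖ ^ (m + 2)
      = 2⁻¹ * ((2 : ℝ)⁻¹ ^ m * ‖X - Y‖ ^ m) * ‖X - Y‖ ^ 2 := by ring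
    _ ≤ 2⁻¹ * (‖X‖ ^ m + ‖Y‖ ^ m) * ‖X - Y‖ ^ 2 := by gcongr
    _ ≤ _ := by linarith

theorem abs_pow_sub_pow_mul_le (m : ℕ) {a b M : ℝ} (ha : 0 ≤ a) (hb : 0 ≤ b) (haM : a ≤ M)
    (hbM : b ≤ M) : |a ^ m - b ^ m| * b ≤ m * M ^ m * |a - b| := by
  have h := abs_pow_sub_pow_le a b m
  have hM : 0 ≤ M := ha.trans haM
  rcases m with _ | m
  · simp
  · have h2 : max |a| |b| ≤ M := by rw [abs_of_nonneg ha, abs_of_nonneg hb]; exact max_le haM hbM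
    calc |a ^ (m + 1) - b ^ (m + 1)| * b
        ≤ (|a - b| * (m + 1 : ℕ) * max |a| |b| ^ (m + 1 - 1)) * M := by gcongr
      _ ≤ (|a - b| * (m + 1 : ℕ) * M ^ m) * M := by
        rw [Nat.add_sub_cancel]; gcongr
      _ = _ := by ring

theorem norm_pLaplace_sub_le (m : ℕ) (X Y : F) :
    ‖‖X‖ ^ m • X - ‖Y‖ ^ m • Y‖
      ≤ (m + 1) * (‖Y‖ + ‖X - Y‖) ^ m * ‖X - Y‖ := by
  have hX : ‖X‖ ≤ ‖Y‖ + ‖X - Y‖ := by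
    have := norm_add_le Y (X - Y); simpa using this
  have hY : ‖Y‖ ≤ ‖Y‖ + ‖X - Y‖ := by linarith [norm_nonneg (X - Y)]
  have e : ‖X‖ ^ m • X - ‖Y‖ ^ m • Y = ‖X‖ ^ m • (X - Y) + (‖X‖ ^ m - ‖Y‖ ^ m) • Y := by
    simp only [smul_sub, sub_smul]; abel
  have h1 := abs_pow_sub_pow_mul_le m (norm_nonneg X) (norm_nonneg Y) hX hY
  have h2 : |‖X‖ - ‖Y‖| ≤ ‖X - Y‖ := abs_norm_sub_norm_le X Y
  calc ‖‖X‖ ^ m • X - ‖Y‖ ^ m • Y‖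
      ≤ ‖X‖ ^ m * ‖X - Y‖ + |‖X‖ ^ m - ‖Y‖ ^ m| * ‖Y‖ := by
        rw [e]; refine (norm_add_le _ _).trans ?_
        rw [norm_smul, norm_smul]; simp
    _ ≤ (‖Y‖ + ‖X - Y‖) ^ m * ‖X - Y‖ + m * (‖Y‖ + ‖X - Y‖) ^ m * ‖X - Y‖ := by
        refine add_le_add (by gcongr) (h1.trans ?_)
        gcongr
    _ = _ := by ring

end

/-- Young's inequality in the form adapted to `b * |V|`. -/
theorem young_flux (m : ℕ) {x y b l : ℝ} (hx : 0 ≤ x) (hy : 0 ≤ y) (hb : 0 ≤ b) (hl : 0 < l) :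
    b * ((y + x) ^ m * x)
      ≤ 2 ^ m * ((l⁻¹ ^ (m + 1) + l⁻¹) * x ^ (m + 2)
        + (l + l ^ (m + 1)) * (y ^ (m + 2) + b ^ (m + 2))) := by
  have h0 : b * (max y b ^ m * x) ≤ l⁻¹ ^ (m + 1) * x ^ (m + 2)
      + l * (y ^ (m + 2) + b ^ (m + 2)) := by
    set Z := max y b with hZ
    have hZ0 : 0 ≤ Z := hy.trans (le_max_left _ _)
    have hbZ : b ≤ Z := le_max_right _ _
    have hZn : Z ^ (m + 2) ≤ y ^ (m + 2) + b ^ (m + 2) := by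
      rcases max_cases y b with ⟨h, _⟩ | ⟨h, _⟩ <;> rw [hZ, h]
      · linarith [pow_nonneg hb (m + 2)]
      · linarith [pow_nonneg hy (m + 2)]
    have h1 : b * (Z ^ m * x) ≤ Z ^ (m + 1) * x := by
      rw [pow_succ' Z m, mul_assoc]; gcongr
    rcases le_total x (l * Z) with h | h
    · calc b * (Z ^ m * x) ≤ Z ^ (m + 1) * x := h1
        _ ≤ Z ^ (m + 1) * (l * Z) := by gcongr
        _ = l * Z ^ (m + 2) := by ring
        _ ≤ l * (y ^ (m + 2) + b ^ (m + 2)) := by gcongr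
        _ ≤ _ := by linarith [show 0 ≤ l⁻¹ ^ (m + 1) * x ^ (m + 2) by positivity]
    · have h2 : Z ≤ l⁻¹ * x := by
        rw [inv_mul_eq_div, le_div_iff₀ hl]; linarith
      calc b * (Z ^ m * x) ≤ Z ^ (m + 1) * x := h1
        _ ≤ (l⁻¹ * x) ^ (m + 1) * x := by gcongr
        _ = l⁻¹ ^ (m + 1) * x ^ (m + 2) := by rw [mul_pow]; ring
        _ ≤ _ := by
          linarith [show 0 ≤ l * (y ^ (m + 2) + b ^ (m + 2)) by positivity]
  have h1 : b * (x ^ m * x) ≤ l⁻¹ * x ^ (m + 2) + l ^ (m + 1) * b ^ (m + 2) := by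
    rcases le_total x (l * b) with h | h
    · calc b * (x ^ m * x) = b * x ^ (m + 1) := by ring
        _ ≤ b * (l * b) ^ (m + 1) := by gcongr
        _ = l ^ (m + 1) * b ^ (m + 2) := by rw [mul_pow]; ring
        _ ≤ _ := by linarith [show 0 ≤ l⁻¹ * x ^ (m + 2) by positivity]
    · have h2 : b ≤ l⁻¹ * x := by
        rw [inv_mul_eq_div, le_div_iff₀ hl]; linarith
      calc b * (x ^ m * x) ≤ (l⁻¹ * x) * (x ^ m * x) := by gcongr
        _ = l⁻¹ * x ^ (m + 2) := by ring
        _ ≤ _ := by linarith [show 0 ≤ l ^ (m + 1) * b ^ (m + 2) by positivity]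
  have h2 : (y + x) ^ m ≤ 2 ^ m * (max y b ^ m + x ^ m) := by
    have hb1 : y + x ≤ 2 * max (max y b) x := by
      have := le_max_left y b
      have := le_max_left (max y b) x
      have := le_max_right (max y b) x
      linarith
    calc (y + x) ^ m ≤ (2 * max (max y b) x) ^ m := by gcongr
      _ = 2 ^ m * max (max y b) x ^ m := mul_pow _ _ _
      _ ≤ _ := by
        gcongr
        have : 0 ≤ max y b := hy.trans (le_max_left _ _)
        rcases max_cases (max y b) x with ⟨h, _⟩ | ⟨h, _⟩ <;> rw [h]
        · linarith [pow_nonneg hx m]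
        · linarith [pow_nonneg this m]
  calc b * ((y + x) ^ m * x) ≤ b * ((2 ^ m * (max y b ^ m + x ^ m)) * x) := by gcongr
    _ = 2 ^ m * (b * (max y b ^ m * x) + b * (x ^ m * x)) := by ring
    _ ≤ 2 ^ m * ((l⁻¹ ^ (m + 1) * x ^ (m + 2) + l * (y ^ (m + 2) + b ^ (m + 2)))
        + (l⁻¹ * x ^ (m + 2) + l ^ (m + 1) * b ^ (m + 2))) := by gcongr
    _ ≤ _ := by
        have : 0 ≤ l ^ (m + 1) * y ^ (m + 2) := by positivity
        refine mul_le_mul_of_nonneg_left ?_ (by positivity)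
        linarith

theorem softStep_monotone {ε : ℝ} (hε : 0 < ε) : Monotone (softStep ε) := by
  intro s t hst
  unfold softStep
  refine div_le_div_of_nonneg_right ?_ hε.le
  rcases max_cases (s + ε) 0 with ⟨h1, _⟩ | ⟨h1, _⟩ <;>
  rcases max_cases s 0 with ⟨h2, _⟩ | ⟨h2, _⟩ <;>
  rcases max_cases (t + ε) 0 with ⟨h3, _⟩ | ⟨h3, _⟩ <;>
  rcases max_cases t 0 with ⟨h4, _⟩ | ⟨h4, _⟩ <;> rw [h1, h2, h3, h4] <;> linarith

theorem softPos_sub_le {ε s t : ℝ} (hε : 0 < ε) (hst : s ≤ t) :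
    softPos ε t - softPos ε s ≤ t - s := by
  have hm : Monotone fun x => x - softPos ε x := by
    refine monotone_of_deriv_nonneg (differentiable_id.sub
      ((contDiff_softPos ε).differentiable (by norm_num))) fun x => ?_
    rw [((hasDerivAt_id' x).fun_sub (hasDerivAt_softPos ε x)).deriv]
    linarith [softStep_le_one (s := x) hε]
  have := hm hst
  simp only at this
  linarith

/-- A `C¹` regularisation of the truncation `t ↦ min (max (t - k) 0) L`. -/
noncomputable def softTrunc (ε k L t : ℝ) : ℝ := softPos ε (t - k) - softPos ε (t - k - L)

/-- The derivative of `softTrunc`. -/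
noncomputable def softTruncDeriv (ε k L t : ℝ) : ℝ :=
  softStep ε (t - k) - softStep ε (t - k - L)

theorem hasDerivAt_softTrunc (ε k L t : ℝ) :
    HasDerivAt (softTrunc ε k L) (softTruncDeriv ε k L t) t := by
  have h1 := (hasDerivAt_softPos ε (t - k)).comp_sub_const t k
  have h2 := (hasDerivAt_softPos ε (t - (k + L))).comp_sub_const t (k + L)
  have e : softTrunc ε k L = fun x => softPos ε (x - k) - softPos ε (x - (k + L)) := by
    funext x; unfold softTrunc; rw [sub_sub x k L]
  rw [e]
  refine (h1.sub h2).congr_deriv ?_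
  unfold softTruncDeriv; rw [sub_sub t k L]

theorem continuous_softTruncDeriv (ε k L : ℝ) : Continuous (softTruncDeriv ε k L) := by
  have := continuous_softStep ε
  unfold softTruncDeriv; fun_prop

theorem contDiff_softTrunc (ε k L : ℝ) : ContDiff ℝ 1 (softTrunc ε k L) := by
  rw [contDiff_one_iff_deriv]
  refine ⟨fun s => (hasDerivAt_softTrunc ε k L s).differentiableAt, ?_⟩
  have : deriv (softTrunc ε k L) = softTruncDeriv ε k L :=
    funext fun s => (hasDerivAt_softTrunc ε k L s).deriv
  rw [this]; exact continuous_softTruncDeriv ε k L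

section
variable {ε k L t : ℝ}

theorem softTrunc_nonneg (hε : 0 < ε) (hL : 0 ≤ L) : 0 ≤ softTrunc ε k L t :=
  sub_nonneg.2 (softPos_monotone hε (by linarith))

theorem softTrunc_le (hε : 0 < ε) (hL : 0 ≤ L) : softTrunc ε k L t ≤ L := by
  have := softPos_sub_le hε (show t - k - L ≤ t - k by linarith)
  unfold softTrunc; linarith

theorem softTrunc_of_le (hε : 0 < ε) (hL : 0 ≤ L) (h : t ≤ k - ε) : softTrunc ε k L t = 0 := by
  unfold softTrunc
  rw [softPos_of_le hε (by linarith), softPos_of_le hε (by linarith), sub_zero]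

theorem softTrunc_of_ge (hε : 0 < ε) (hL : 0 ≤ L) (h : k + L ≤ t) : softTrunc ε k L t = L := by
  unfold softTrunc
  rw [softPos_of_nonneg hε (by linarith), softPos_of_nonneg hε (by linarith)]; ring

theorem softTruncDeriv_nonneg (hε : 0 < ε) (hL : 0 ≤ L) : 0 ≤ softTruncDeriv ε k L t :=
  sub_nonneg.2 (softStep_monotone hε (by linarith))

theorem softTruncDeriv_le_one (hε : 0 < ε) : softTruncDeriv ε k L t ≤ 1 := by
  have h1 := softStep_le_one (s := t - k) hε
  have h2 := softStep_nonneg (s := t - k - L) hε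
  unfold softTruncDeriv; linarith

theorem softTruncDeriv_of_le (hε : 0 < ε) (hL : 0 ≤ L) (h : t ≤ k - ε) :
    softTruncDeriv ε k L t = 0 := by
  unfold softTruncDeriv
  rw [softStep_of_le hε (by linarith), softStep_of_le hε (by linarith), sub_zero]

theorem softTruncDeriv_of_ge (hε : 0 < ε) (hL : 0 ≤ L) (h : k + L ≤ t) :
    softTruncDeriv ε k L t = 0 := by
  unfold softTruncDeriv
  rw [softStep_of_nonneg hε (by linarith), softStep_of_nonneg hε (by linarith), sub_self]

theorem softTruncDeriv_of_mem (hε : 0 < ε) (h : k ≤ t) (h' : t ≤ k + L - ε) :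
    softTruncDeriv ε k L t = 1 := by
  unfold softTruncDeriv
  rw [softStep_of_nonneg hε (by linarith), softStep_of_le hε (by linarith), sub_zero]

end

theorem ContDiff.continuous_gradient {F : Type*} [NormedAddCommGroup F] [InnerProductSpace ℝ F]
    [CompleteSpace F] {f : F → ℝ} (hf : ContDiff ℝ 1 f) : Continuous (gradient f) :=
  (InnerProductSpace.toDual ℝ F).symm.continuous.comp (hf.continuous_fderiv (by norm_num))

theorem HasDerivAt.comp_hasGradientAt {F : Type*} [NormedAddCommGroup F] [InnerProductSpace ℝ F]
    [CompleteSpace F] {g : ℝ → ℝ} {g' : ℝ} {f : F → ℝ} {f' : F} {x : F}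
    (hg : HasDerivAt g g' (f x)) (hf : HasGradientAt f f' x) :
    HasGradientAt (fun y => g (f y)) (g' • f') x := by
  rw [hasGradientAt_iff_hasFDerivAt] at hf ⊢
  have := hg.comp_hasFDerivAt x hf
  rw [map_smul]
  exact this

theorem HasGradientAt.fun_mul {F : Type*} [NormedAddCommGroup F] [InnerProductSpace ℝ F]
    [CompleteSpace F] {f g : F → ℝ} {f' g' x : F}
    (hf : HasGradientAt f f' x) (hg : HasGradientAt g g' x) :
    HasGradientAt (fun y => f y * g y) (f x • g' + g x • f') x := by
  rw [hasGradientAt_iff_hasFDerivAt] at hf hg ⊢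
  have := hf.mul hg
  rw [map_add, map_smul, map_smul]
  exact this

section Cutoff
variable {F : Type*} [NormedAddCommGroup F]

/-- A radial `C¹` cutoff, zero on the ball of radius `ρ` and one outside that of radius `2 ρ`. -/
noncomputable def cutoff (ρ : ℝ) (x : F) : ℝ := softTrunc 1 2 1 (‖x‖ ^ 2 / ρ ^ 2)

variable {ρ : ℝ} {x : F}

theorem cutoff_nonneg : 0 ≤ cutoff ρ x := softTrunc_nonneg one_pos zero_le_one

theorem cutoff_le_one : cutoff ρ x ≤ 1 := softTrunc_le one_pos zero_le_one

theorem cutoff_of_le (hρ : 0 < ρ) (h : ‖x‖ ≤ ρ) : cutoff ρ x = 0 := by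
  refine softTrunc_of_le one_pos zero_le_one ?_
  rw [div_le_iff₀ (by positivity)]
  have := pow_le_pow_left₀ (norm_nonneg x) h 2
  linarith

theorem cutoff_of_ge (hρ : 0 < ρ) (h : 2 * ρ ≤ ‖x‖) : cutoff ρ x = 1 := by
  refine softTrunc_of_ge one_pos zero_le_one ?_
  rw [le_div_iff₀ (by positivity)]
  have := pow_le_pow_left₀ (by positivity) h 2
  nlinarith

variable [InnerProductSpace ℝ F]

theorem contDiff_cutoff (ρ : ℝ) : ContDiff ℝ 1 (cutoff ρ : F → ℝ) :=
  (contDiff_softTrunc 1 2 1).comp ((contDiff_norm_sq ℝ).div_const _)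

variable [CompleteSpace F]

theorem hasGradientAt_cutoff (ρ : ℝ) (x : F) :
    HasGradientAt (cutoff ρ) ((softTruncDeriv 1 2 1 (‖x‖ ^ 2 / ρ ^ 2) * (2 / ρ ^ 2)) • x) x := by
  have h1 : HasGradientAt (fun y : F => ‖y‖ ^ 2 / ρ ^ 2) ((2 / ρ ^ 2) • x) x := by
    rw [hasGradientAt_iff_hasFDerivAt]
    have := ((hasStrictFDerivAt_norm_sq x).hasFDerivAt).mul_const (1 / ρ ^ 2)
    simp only [mul_one_div] at this
    refine this.congr_fderiv ?_
    ext y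
    simp
    ring
  have := HasDerivAt.comp_hasGradientAt (f := fun y : F => ‖y‖ ^ 2 / ρ ^ 2)
    (hasDerivAt_softTrunc 1 2 1 (‖x‖ ^ 2 / ρ ^ 2)) h1
  rw [smul_smul] at this
  exact this

theorem gradient_cutoff_of_le (hρ : 0 < ρ) (h : ‖x‖ ≤ ρ) : gradient (cutoff ρ) x = 0 := by
  rw [(hasGradientAt_cutoff ρ x).gradient, softTruncDeriv_of_le one_pos zero_le_one]
  · simp
  · rw [div_le_iff₀ (by positivity)]
    have := pow_le_pow_left₀ (norm_nonneg x) h 2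
    linarith

theorem gradient_cutoff_of_ge (hρ : 0 < ρ) (h : 2 * ρ ≤ ‖x‖) : gradient (cutoff ρ) x = 0 := by
  rw [(hasGradientAt_cutoff ρ x).gradient, softTruncDeriv_of_ge one_pos zero_le_one]
  · simp
  · rw [le_div_iff₀ (by positivity)]
    have := pow_le_pow_left₀ (by positivity) h 2
    nlinarith

theorem norm_gradient_cutoff_le (hρ : 0 < ρ) : ‖gradient (cutoff ρ) x‖ ≤ 4 / ρ := by
  rcases le_total (2 * ρ) ‖x‖ with h | h
  · rw [gradient_cutoff_of_ge hρ h, norm_zero]; positivity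
  · rw [(hasGradientAt_cutoff ρ x).gradient, norm_smul, norm_of_nonneg
      (mul_nonneg (softTruncDeriv_nonneg one_pos zero_le_one) (by positivity))]
    calc _ ≤ 1 * (2 / ρ ^ 2) * (2 * ρ) := by
          gcongr; exact softTruncDeriv_le_one one_pos
      _ = 4 / ρ := by field_simp; norm_num

end Cutoff

theorem ENNReal.le_rpow_mul_add {q c : ℝ} (hq : 1 ≤ q) (hc : 0 < c) (g : ℝ≥0∞) :
    g ≤ ENNReal.ofReal (c ^ (1 - q)) * g ^ q + ENNReal.ofReal c := by
  rcases le_total g (ENNReal.ofReal c) with h | h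
  · exact h.trans le_add_self
  · refine le_trans ?_ le_self_add
    rcases eq_or_ne g ⊤ with rfl | hg
    · rw [ENNReal.top_rpow_of_pos (by linarith), ENNReal.mul_top]
      rw [ne_eq, ENNReal.ofReal_eq_zero, not_le]; positivity
    lift g to NNReal using hg
    have hg' : c ≤ (g : ℝ) := by
      rw [← ENNReal.ofReal_coe_nnreal] at h
      exact (ENNReal.ofReal_le_ofReal_iff g.2).1 h
    rw [← ENNReal.ofReal_coe_nnreal, ENNReal.ofReal_rpow_of_nonneg (NNReal.coe_nonneg g)
      (by linarith : 0 ≤ q),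
      ← ENNReal.ofReal_mul (by positivity)]
    refine ENNReal.ofReal_le_ofReal ?_
    have hgp : 0 < (g : ℝ) := hc.trans_le hg'
    calc (g : ℝ) = (g : ℝ) ^ (1 - q) * (g : ℝ) ^ q := by
          rw [← Real.rpow_add hgp]; simp
      _ ≤ c ^ (1 - q) * (g : ℝ) ^ q := by
          exact mul_le_mul_of_nonneg_right
            (Real.rpow_le_rpow_of_nonpos hc hg' (by linarith)) (by positivity)

section
variable {m : ℕ}

theorem lintegral_closedBall_homothety_le {s t : ℝ} (ht : t ∈ Ioo (0 : ℝ) 1)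
    {z : Fin m → ℝ} (hz : z ∈ closedBall (0 : Fin m → ℝ) s) {G : (Fin m → ℝ) → ℝ≥0∞}
    (hG : Measurable G) :
    ∫⁻ y in closedBall 0 s, G (z + t • (y - z))
      ≤ ENNReal.ofReal (t ^ (-(m : ℝ))) * ∫⁻ y in closedBall 0 s, G y := by
  have hemb : MeasurableEmbedding fun y : Fin m → ℝ => t • y :=
    (Homeomorph.smulOfNeZero t ht.1.ne').measurableEmbedding
  set H : (Fin m → ℝ) → ℝ≥0∞ := (closedBall 0 s).indicator G with hH
  have hHm : Measurable H := hG.indicator measurableSet_closedBall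
  have h1 : ∫⁻ y in closedBall 0 s, G (z + t • (y - z))
      ≤ ∫⁻ y, H ((1 - t) • z + t • y) := by
    rw [← lintegral_indicator measurableSet_closedBall]
    refine lintegral_mono fun y => ?_
    by_cases hy : y ∈ closedBall (0 : Fin m → ℝ) s
    · rw [indicator_of_mem hy]
      have hmem : (1 - t) • z + t • y ∈ closedBall (0 : Fin m → ℝ) s :=
        convex_closedBall 0 s hz hy (by linarith [ht.2]) ht.1.le (by ring)
      rw [hH, indicator_of_mem hmem]
      refine le_of_eq (congrArg G ?_)
      simp only [smul_sub, sub_smul, one_smul]; abel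
    · rw [indicator_of_notMem hy]; exact zero_le
  refine h1.trans (le_of_eq ?_)
  rw [← lintegral_indicator measurableSet_closedBall, ← hH]
  have h2 : ∫⁻ y, H ((1 - t) • z + t • y) =
    ∫⁻ y, H ((1 - t) • z + y) ∂(Measure.map (fun y => t • y) volume) := by
    rw [hemb.lintegral_map]
  rw [h2, Measure.map_addHaar_smul volume ht.1.ne', lintegral_smul_measure,
    lintegral_add_left_eq_self (μ := volume) H ((1 - t) • z)]
  congr 2
  rw [abs_of_pos (by have := ht.1; positivity), Real.rpow_neg ht.1.le]
  simp

theorem lintegral_rpow_Ioo_lt_top {p : ℝ} (hp : -1 < p) :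
    ∫⁻ t in Ioo (0 : ℝ) 1, ENNReal.ofReal (t ^ p) < ⊤ := by
  have h : IntegrableOn (fun t : ℝ => t ^ p) (Ioo 0 1) :=
    (intervalIntegral.integrableOn_Ioo_rpow_iff one_pos).2 hp
  have h2 := h.2
  rw [hasFiniteIntegral_iff_enorm] at h2
  refine lt_of_le_of_lt (setLIntegral_mono' measurableSet_Ioo fun t ht => ?_) h2
  rw [Real.enorm_of_nonneg (by have := ht.1; positivity)]

theorem measurable_lintegral_segment {G : (Fin m → ℝ) → ℝ≥0∞} (hG : Measurable G)
    (z : Fin m → ℝ) :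
    Measurable fun y : Fin m → ℝ => ∫⁻ t in Ioo (0 : ℝ) 1, G (z + t • (y - z)) := by
  have : Measurable (Function.uncurry fun (y : Fin m → ℝ) (t : ℝ) => G (z + t • (y - z))) := by
    refine hG.comp (Continuous.measurable ?_)
    fun_prop
  exact this.lintegral_prod_right

/-- Averaged Morrey estimate on a cube. -/
theorem exists_lintegral_segment_le (hm : 1 ≤ m) {q : ℝ} (hq : (m : ℝ) < q) :
    ∃ C : ℝ, 0 < C ∧ ∀ (s a : ℝ), 0 < a → ∀ z ∈ closedBall (0 : Fin m → ℝ) s,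
      ∀ G : (Fin m → ℝ) → ℝ≥0∞, Measurable G →
      ∫⁻ y in closedBall 0 s, ∫⁻ t in Ioo (0 : ℝ) 1, G (z + t • (y - z))
        ≤ ENNReal.ofReal C * (ENNReal.ofReal (a ^ (1 - q)) * ∫⁻ y in closedBall 0 s, G y ^ q)
          + ENNReal.ofReal C * (ENNReal.ofReal a * volume (closedBall (0 : Fin m → ℝ) s)) := by
  have hm' : (1 : ℝ) ≤ m := by exact_mod_cast hm
  have hq1 : 1 < q := hm'.trans_lt hq
  set β : ℝ := ((m - 1) / (q - 1) + 1) / 2 with hβ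
  have hβq : β * (q - 1) = (m - 1 + (q - 1)) / 2 := by
    rw [hβ]; field_simp [show q - 1 ≠ 0 by linarith]
  have hβ1 : -1 < -β := by
    have : (m - 1) / (q - 1) < (1 : ℝ) := by rw [div_lt_one (by linarith)]; linarith
    rw [hβ]; linarith
  set p : ℝ := β * (q - 1) - m with hp
  have hp1 : -1 < p := by rw [hp, hβq]; linarith
  set C1 := ∫⁻ t in Ioo (0 : ℝ) 1, ENNReal.ofReal (t ^ p)
  set C2 := ∫⁻ t in Ioo (0 : ℝ) 1, ENNReal.ofReal (t ^ (-β))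
  have hC1 : C1 < ⊤ := lintegral_rpow_Ioo_lt_top hp1
  have hC2 : C2 < ⊤ := lintegral_rpow_Ioo_lt_top hβ1
  refine ⟨C1.toReal + C2.toReal + 1, by positivity, fun s a ha z hz G hG => ?_⟩
  have hC1' : C1 ≤ ENNReal.ofReal (C1.toReal + C2.toReal + 1) := by
    rw [← ENNReal.ofReal_toReal hC1.ne]
    refine ENNReal.ofReal_le_ofReal ?_
    rw [ENNReal.toReal_ofReal ENNReal.toReal_nonneg]
    have : 0 ≤ C2.toReal := ENNReal.toReal_nonneg
    linarith
  have hC2' : C2 ≤ ENNReal.ofReal (C1.toReal + C2.toReal + 1) := by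
    rw [← ENNReal.ofReal_toReal hC2.ne]
    refine ENNReal.ofReal_le_ofReal ?_
    rw [ENNReal.toReal_ofReal ENNReal.toReal_nonneg]
    have : 0 ≤ C1.toReal := ENNReal.toReal_nonneg
    linarith
  set J := ∫⁻ y in closedBall 0 s, G y ^ q
  set Q := volume (closedBall (0 : Fin m → ℝ) s)
  rw [lintegral_lintegral_swap]
  swap
  · refine Measurable.aemeasurable (hG.comp (Continuous.measurable ?_))
    fun_prop
  have key : ∀ t ∈ Ioo (0 : ℝ) 1, ∫⁻ y in closedBall 0 s, G (z + t • (y - z))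
      ≤ ENNReal.ofReal (t ^ p) * (ENNReal.ofReal (a ^ (1 - q)) * J)
        + ENNReal.ofReal (t ^ (-β)) * (ENNReal.ofReal a * Q) := by
    intro t ht
    have ht0 := ht.1
    have hc : 0 < a * t ^ (-β) := by positivity
    have hmeas : Measurable fun y => G (z + t • (y - z)) := by
      refine hG.comp (Continuous.measurable ?_); fun_prop
    calc ∫⁻ y in closedBall 0 s, G (z + t • (y - z))
        ≤ ∫⁻ y in closedBall 0 s, (ENNReal.ofReal ((a * t ^ (-β)) ^ (1 - q))
            * G (z + t • (y - z)) ^ q + ENNReal.ofReal (a * t ^ (-β))) :=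
          lintegral_mono fun y => ENNReal.le_rpow_mul_add hq1.le hc _
      _ = ENNReal.ofReal ((a * t ^ (-β)) ^ (1 - q))
            * (∫⁻ y in closedBall 0 s, (fun y => G y ^ q) (z + t • (y - z)))
            + ENNReal.ofReal (a * t ^ (-β)) * Q := by
          rw [lintegral_add_right _ measurable_const, lintegral_const_mul _ (hmeas.pow_const q),
            setLIntegral_const]
      _ ≤ ENNReal.ofReal ((a * t ^ (-β)) ^ (1 - q))
            * (ENNReal.ofReal (t ^ (-(m : ℝ))) * J)
            + ENNReal.ofReal (a * t ^ (-β)) * Q := by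
          refine add_le_add (mul_le_mul' le_rfl ?_) le_rfl
          exact lintegral_closedBall_homothety_le ht hz (hG.pow_const q)
      _ = _ := by
          have e1 : (a * t ^ (-β)) ^ (1 - q) * t ^ (-(m : ℝ)) = t ^ p * a ^ (1 - q) := by
            rw [Real.mul_rpow ha.le (by positivity), ← Real.rpow_mul ht0.le, mul_assoc,
              ← Real.rpow_add ht0, mul_comm, hp]
            ring_nf
          rw [← mul_assoc, ← ENNReal.ofReal_mul (by positivity), e1,
            ENNReal.ofReal_mul (by positivity), mul_assoc, mul_comm a,
            ENNReal.ofReal_mul (by positivity), mul_assoc (ENNReal.ofReal (t ^ (-β)))]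
  refine (setLIntegral_mono' measurableSet_Ioo key).trans ?_
  have hmp : ∀ e : ℝ, Measurable fun t : ℝ => ENNReal.ofReal (t ^ e) := fun e =>
    ENNReal.measurable_ofReal.comp (measurable_id.pow_const e)
  rw [lintegral_add_left ((hmp p).mul_const _), lintegral_mul_const _ (hmp p),
    lintegral_mul_const _ (hmp (-β))]
  gcongr

/-- Oscillation form of Morrey's estimate on a cube. -/
theorem exists_osc_cube_le (hm : 1 ≤ m) {q : ℝ} (hq : (m : ℝ) < q) :
    ∃ C : ℝ, 0 < C ∧ ∀ (s a K : ℝ), 0 < a → 0 < s → 0 ≤ K →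
      ∀ G : (Fin m → ℝ) → ℝ≥0∞, Measurable G → ∀ W : (Fin m → ℝ) → ℝ,
      (∀ y ∈ closedBall (0 : Fin m → ℝ) s, ∀ z ∈ closedBall (0 : Fin m → ℝ) s,
        ENNReal.ofReal |W y - W z| ≤
          ENNReal.ofReal K * ∫⁻ t in Ioo (0 : ℝ) 1, G (z + t • (y - z))) →
      ∀ y ∈ closedBall (0 : Fin m → ℝ) s, ∀ z ∈ closedBall (0 : Fin m → ℝ) s,
        ENNReal.ofReal (|W y - W z| * (2 * s) ^ m) ≤
          ENNReal.ofReal (C * K * a ^ (1 - q)) * (∫⁻ x in closedBall 0 s, G x ^ q)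
          + ENNReal.ofReal (C * K * a * (2 * s) ^ m) := by
  obtain ⟨C, hC, h⟩ := exists_lintegral_segment_le hm hq
  refine ⟨2 * C, by positivity, fun s a K ha hs hK G hG W hW y hy z hz => ?_⟩
  have hvol : volume (closedBall (0 : Fin m → ℝ) s) = ENNReal.ofReal ((2 * s) ^ m) := by
    rw [Real.volume_pi_closedBall _ hs.le, Fintype.card_fin]
  set Q := closedBall (0 : Fin m → ℝ) s with hQ
  have h1 : ∀ x ∈ Q, ENNReal.ofReal |W y - W z| ≤
      ENNReal.ofReal K * (∫⁻ t in Ioo (0 : ℝ) 1, G (y + t • (x - y)))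
      + ENNReal.ofReal K * (∫⁻ t in Ioo (0 : ℝ) 1, G (z + t • (x - z))) := by
    intro x hx
    refine le_trans ?_ (add_le_add (hW x hx y hy) (hW x hx z hz))
    rw [← ENNReal.ofReal_add (abs_nonneg _) (abs_nonneg _)]
    refine ENNReal.ofReal_le_ofReal ?_
    rw [abs_sub_comm (W x) (W y)]
    exact abs_sub_le _ _ _
  have h2 := setLIntegral_mono' (μ := volume) measurableSet_closedBall h1
  rw [setLIntegral_const, lintegral_add_left ((measurable_lintegral_segment hG y).const_mul _),
    lintegral_const_mul _ (measurable_lintegral_segment hG y),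
    lintegral_const_mul _ (measurable_lintegral_segment hG z), hvol,
    ← ENNReal.ofReal_mul (abs_nonneg _)] at h2
  have h3 := h s a ha y hy G hG
  have h4 := h s a ha z hz G hG
  rw [hvol] at h3 h4
  set J := ∫⁻ x in Q, G x ^ q
  refine h2.trans ?_
  calc _ ≤ ENNReal.ofReal K * (ENNReal.ofReal C * (ENNReal.ofReal (a ^ (1 - q)) * J)
          + ENNReal.ofReal C * (ENNReal.ofReal a * ENNReal.ofReal ((2 * s) ^ m)))
        + ENNReal.ofReal K * (ENNReal.ofReal C * (ENNReal.ofReal (a ^ (1 - q)) * J)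
          + ENNReal.ofReal C * (ENNReal.ofReal a * ENNReal.ofReal ((2 * s) ^ m))) := by
        gcongr
    _ = _ := by
        rw [ENNReal.ofReal_mul (p := 2 * C * K) (by positivity),
          ENNReal.ofReal_mul (p := 2 * C * K * a) (by positivity),
          ENNReal.ofReal_mul (p := 2 * C * K) (by positivity),
          ENNReal.ofReal_mul (p := 2 * C) (by positivity),
          ENNReal.ofReal_mul (p := 2) (by positivity)]
        rw [show ENNReal.ofReal 2 = 2 by simp]
        ring
end

section
variable {m : ℕ}

theorem norm_insertNth (i : Fin (m + 1)) (a : ℝ) (y : Fin m → ℝ) :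
    ‖(i.insertNth a y : Fin (m + 1) → ℝ)‖ = max |a| ‖y‖ := by
  refine le_antisymm ((pi_norm_le_iff_of_nonneg (by positivity)).2 fun j => ?_) (max_le ?_ ?_)
  · rcases Fin.eq_self_or_eq_succAbove i j with rfl | ⟨k, rfl⟩
    · simp
    · simpa using Or.inr (norm_le_pi_norm y k)
  · simpa using norm_le_pi_norm (i.insertNth a y : Fin (m + 1) → ℝ) i
  · refine (pi_norm_le_iff_of_nonneg (norm_nonneg _)).2 fun k => ?_
    simpa using norm_le_pi_norm (i.insertNth a y : Fin (m + 1) → ℝ) (i.succAbove k)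

theorem lintegral_insertNth (i : Fin (m + 1)) {g : (Fin (m + 1) → ℝ) → ℝ≥0∞}
    (hg : Measurable g) :
    ∫⁻ s : ℝ, ∫⁻ y : Fin m → ℝ, g (i.insertNth s y) = ∫⁻ x, g x := by
  have h := (volume_preserving_piFinSuccAbove (fun _ : Fin (m + 1) => ℝ) i).symm
  have hi : Measurable fun z : ℝ × (Fin m → ℝ) => (i.insertNth z.1 z.2 : Fin (m + 1) → ℝ) :=
    h.measurable
  rw [← h.lintegral_comp hg]
  exact (lintegral_prod _ (hg.comp hi).aemeasurable).symm

theorem lintegral_face_le (i : Fin (m + 1)) {ρ σ : ℝ} (hρ : 0 < ρ) (hσ : σ = 1 ∨ σ = -1)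
    {g : (Fin (m + 1) → ℝ) → ℝ≥0∞} (hg : Measurable g) :
    ∫⁻ s in Ioo ρ (2 * ρ), ∫⁻ y in closedBall (0 : Fin m → ℝ) s, g (i.insertNth (σ * s) y)
      ≤ ∫⁻ x in {x : Fin (m + 1) → ℝ | ρ ≤ ‖x‖ ∧ ‖x‖ ≤ 2 * ρ}, g x := by
  set R : Set (Fin (m + 1) → ℝ) := {x | ρ ≤ ‖x‖ ∧ ‖x‖ ≤ 2 * ρ} with hR
  have hRm : MeasurableSet R :=
    (measurableSet_le measurable_const measurable_norm).inter
      (measurableSet_le measurable_norm measurable_const)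
  have hH : Measurable (R.indicator g) := hg.indicator hRm
  have h1 : ∫⁻ s in Ioo ρ (2 * ρ), ∫⁻ y in closedBall (0 : Fin m → ℝ) s, g (i.insertNth (σ * s) y)
      ≤ ∫⁻ s : ℝ, ∫⁻ y : Fin m → ℝ, R.indicator g (i.insertNth (σ * s) y) := by
    refine (setLIntegral_mono' measurableSet_Ioo fun s hs => ?_).trans
      (setLIntegral_le_lintegral _ _)
    refine (setLIntegral_mono' measurableSet_closedBall fun y hy => ?_).trans
      (setLIntegral_le_lintegral _ _)
    have hs0 : 0 < s := hρ.trans hs.1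
    have hσs : |σ * s| = s := by
      rcases hσ with rfl | rfl <;> simp [abs_of_pos hs0]
    rw [indicator_of_mem]
    rw [hR, mem_ofPred_eq, norm_insertNth, hσs, max_eq_left (by simpa using hy)]
    exact ⟨hs.1.le, hs.2.le⟩
  refine h1.trans (le_of_eq ?_)
  rw [← lintegral_indicator hRm, ← lintegral_insertNth i hH]
  rcases hσ with rfl | rfl
  · simp
  · simp only [neg_mul, one_mul]
    exact lintegral_neg_eq_self (μ := volume) fun s =>
      ∫⁻ y : Fin m → ℝ, R.indicator g (i.insertNth s y)

theorem measurable_lintegral_face (i : Fin (m + 1)) (σ : ℝ)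
    {g : (Fin (m + 1) → ℝ) → ℝ≥0∞} (hg : Measurable g) :
    Measurable fun s : ℝ => ∫⁻ y in closedBall (0 : Fin m → ℝ) s, g (i.insertNth (σ * s) y) := by
  have hins : Measurable fun z : ℝ × (Fin m → ℝ) =>
      (i.insertNth (σ * z.1) z.2 : Fin (m + 1) → ℝ) := by
    refine (Continuous.measurable ?_)
    exact Continuous.finInsertNth i (by fun_prop) (by fun_prop)
  have hset : MeasurableSet {z : ℝ × (Fin m → ℝ) | ‖z.2‖ ≤ z.1} :=
    measurableSet_le (by fun_prop) (by fun_prop)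
  have := ((hg.comp hins).indicator hset).lintegral_prod_right'
    (ν := (volume : Measure (Fin m → ℝ)))
  convert this using 2 with s
  rw [← lintegral_indicator measurableSet_closedBall]
  refine lintegral_congr fun y => ?_
  simp [indicator]

/-- A radius on which all face integrals are controlled by the shell integral. -/
theorem exists_radius_face_le {ρ : ℝ} (hρ : 0 < ρ)
    {g : (Fin (m + 1) → ℝ) → ℝ≥0∞} (hg : Measurable g) :
    ∃ s ∈ Ioo ρ (2 * ρ), ∀ i : Fin (m + 1), ∀ σ : ℝ, σ = 1 ∨ σ = -1 →
      ENNReal.ofReal ρ * ∫⁻ y in closedBall (0 : Fin m → ℝ) s, g (i.insertNth (σ * s) y)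
        ≤ ENNReal.ofReal (2 * (m + 1)) *
          ∫⁻ x in {x : Fin (m + 1) → ℝ | ρ ≤ ‖x‖ ∧ ‖x‖ ≤ 2 * ρ}, g x := by
  set I := ∫⁻ x in {x : Fin (m + 1) → ℝ | ρ ≤ ‖x‖ ∧ ‖x‖ ≤ 2 * ρ}, g x
  set J : Fin (m + 1) → ℝ → ℝ → ℝ≥0∞ := fun i σ s =>
    ∫⁻ y in closedBall (0 : Fin m → ℝ) s, g (i.insertNth (σ * s) y)
  have hJm : ∀ i σ, Measurable (J i σ) := fun i σ => measurable_lintegral_face i σ hg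
  set S : ℝ → ℝ≥0∞ := fun s => ∑ i, (J i 1 s + J i (-1) s)
  have hSm : Measurable S := by
    refine Finset.measurable_fun_sum _ fun i _ => (hJm i 1).add (hJm i (-1))
  have hS : ∫⁻ s in Ioo ρ (2 * ρ), S s ≤ ENNReal.ofReal (2 * (m + 1)) * I := by
    calc ∫⁻ s in Ioo ρ (2 * ρ), S s
        = ∑ i, ((∫⁻ s in Ioo ρ (2 * ρ), J i 1 s) + ∫⁻ s in Ioo ρ (2 * ρ), J i (-1) s) := by
          refine (lintegral_finsetSum _ fun i _ => (hJm i 1).add (hJm i (-1))).trans ?_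
          exact Finset.sum_congr rfl fun i _ => lintegral_add_left (hJm i 1) _
      _ ≤ ∑ _i : Fin (m + 1), (I + I) := by
          refine Finset.sum_le_sum fun i _ => add_le_add ?_ ?_
          · exact lintegral_face_le i hρ (Or.inl rfl) hg
          · exact lintegral_face_le i hρ (Or.inr rfl) hg
      _ = _ := by
          rw [Finset.sum_const, Finset.card_univ, Fintype.card_fin, nsmul_eq_mul, ← two_mul,
            ← mul_assoc, ENNReal.ofReal_mul (by norm_num), mul_comm (ENNReal.ofReal 2)]
          congr 2
          · rw [ENNReal.ofReal_add (by positivity) zero_le_one]; simp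
          · simp
  have hvol : volume (Ioo ρ (2 * ρ)) = ENNReal.ofReal ρ := by
    rw [Real.volume_Ioo]; congr 1; ring
  obtain ⟨s, hs, hle⟩ := exists_le_setLAverage (μ := volume) (s := Ioo ρ (2 * ρ)) (f := S)
    (by rw [hvol]; simpa using hρ) (by rw [hvol]; exact ENNReal.ofReal_ne_top) hSm.aemeasurable
  refine ⟨s, hs, fun i σ hσ => ?_⟩
  rw [setLAverage_eq, hvol] at hle
  have h1 : J i σ s ≤ S s := by
    refine le_trans ?_ (Finset.single_le_sum (f := fun i => J i 1 s + J i (-1) s)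
      (fun _ _ => zero_le) (Finset.mem_univ i))
    rcases hσ with rfl | rfl
    · exact le_self_add
    · exact le_add_self
  calc ENNReal.ofReal ρ * J i σ s ≤
      ENNReal.ofReal ρ * ((∫⁻ s in Ioo ρ (2 * ρ), S s) / ENNReal.ofReal ρ) :=
        mul_le_mul' le_rfl (h1.trans hle)
    _ = ∫⁻ s in Ioo ρ (2 * ρ), S s :=
        ENNReal.mul_div_cancel (by simpa using hρ) ENNReal.ofReal_ne_top
    _ ≤ _ := hS

theorem abs_sub_le_of_faces (hm : 1 ≤ m) {s B : ℝ} (hs : 0 < s) {W : (Fin (m + 1) → ℝ) → ℝ}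
    (hW : ∀ i : Fin (m + 1), ∀ σ : ℝ, σ = 1 ∨ σ = -1 → ∀ p p' : Fin (m + 1) → ℝ,
      ‖p‖ = s → ‖p'‖ = s → p i = σ * s → p' i = σ * s → |W p - W p'| ≤ B)
    {p p' : Fin (m + 1) → ℝ} (hp : ‖p‖ = s) (hp' : ‖p'‖ = s) : |W p - W p'| ≤ 3 * B := by
  have hface : ∀ p : Fin (m + 1) → ℝ, ‖p‖ = s → ∃ i : Fin (m + 1), ∃ σ : ℝ,
      (σ = 1 ∨ σ = -1) ∧ p i = σ * s := by
    intro p hp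
    obtain ⟨i, hi⟩ := Finite.exists_max fun i => ‖p i‖
    have : ‖p i‖ = s := by
      refine le_antisymm (hp ▸ norm_le_pi_norm p i) ?_
      rw [← hp]; exact (pi_norm_le_iff_of_nonneg (norm_nonneg _)).2 hi
    rcases abs_choice (p i) with h | h
    · exact ⟨i, 1, Or.inl rfl, by rw [← this, Real.norm_eq_abs, h]; ring⟩
    · exact ⟨i, -1, Or.inr rfl, by rw [← this, Real.norm_eq_abs, h]; ring⟩
  have hcorner : ∀ i j : Fin (m + 1), i ≠ j → ∀ σ τ : ℝ, (σ = 1 ∨ σ = -1) → (τ = 1 ∨ τ = -1) →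
      ∃ z : Fin (m + 1) → ℝ, ‖z‖ = s ∧ z i = σ * s ∧ z j = τ * s := by
    intro i j hij σ τ hσ hτ
    have hσ' : |σ * s| = s := by rcases hσ with rfl | rfl <;> simp [abs_of_pos hs]
    have hτ' : |τ * s| = s := by rcases hτ with rfl | rfl <;> simp [abs_of_pos hs]
    refine ⟨fun k => if k = i then σ * s else if k = j then τ * s else 0, ?_, by simp,
      by simp [hij.symm]⟩
    refine le_antisymm ((pi_norm_le_iff_of_nonneg hs.le).2 fun k => ?_) ?_
    · split_ifs
      · exact hσ'.le
      · exact hτ'.le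
      · simpa using hs.le
    · conv_lhs => rw [← hσ']
      have := norm_le_pi_norm (fun k => if k = i then σ * s else if k = j then τ * s else 0) i
      simpa using this
  obtain ⟨i, σ, hσ, hi⟩ := hface p hp
  obtain ⟨j, τ, hτ, hj⟩ := hface p' hp'
  have hB : 0 ≤ B := (abs_nonneg _).trans (hW i σ hσ p p hp hp hi hi)
  rcases eq_or_ne i j with rfl | hij
  · have : Nontrivial (Fin (m + 1)) := Fin.nontrivial_iff_two_le.2 (by omega)
    obtain ⟨k, hk⟩ := exists_ne i
    obtain ⟨z, hz, hzi, hzk⟩ := hcorner i k hk.symm σ 1 hσ (Or.inl rfl)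
    obtain ⟨z', hz', hzi', hzk'⟩ := hcorner i k hk.symm τ 1 hτ (Or.inl rfl)
    have h1 := hW i σ hσ p z hp hz hi hzi
    have h2 := hW k 1 (Or.inl rfl) z z' hz hz' hzk hzk'
    have h3 := hW i τ hτ z' p' hz' hp' hzi' hj
    have := abs_sub_le (W p) (W z) (W p')
    have := abs_sub_le (W z) (W z') (W p')
    linarith
  · obtain ⟨z, hz, hzi, hzj⟩ := hcorner i j hij σ τ hσ hτ
    have h1 := hW i σ hσ p z hp hz hi hzi
    have h2 := hW j τ hτ z p' hz hp' hzj hj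
    have := abs_sub_le (W p) (W z) (W p')
    linarith

/-- Morrey's estimate on a well chosen sup-norm sphere. -/
theorem exists_sphere_osc_le (hm : 1 ≤ m) {q κ : ℝ} (hq : (m : ℝ) < q) (hκ : 0 < κ) :
    ∃ C : ℝ, 0 < C ∧ ∀ ρ l : ℝ, 0 < ρ → 0 < l → ∀ g : (Fin (m + 1) → ℝ) → ℝ≥0∞, Measurable g →
      ∃ s ∈ Ioo ρ (2 * ρ), ∀ W : (Fin (m + 1) → ℝ) → ℝ,
      (∀ i : Fin (m + 1), ∀ σ : ℝ, σ = 1 ∨ σ = -1 → ∀ p p' : Fin (m + 1) → ℝ,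
        ‖p‖ = s → ‖p'‖ = s → p i = σ * s → p' i = σ * s →
        ENNReal.ofReal |W p - W p'| ≤ ENNReal.ofReal (κ * ρ) *
          ∫⁻ t in Ioo (0 : ℝ) 1, g (p' + t • (p - p'))) →
      ∀ p p' : Fin (m + 1) → ℝ, ‖p‖ = s → ‖p'‖ = s → ENNReal.ofReal |W p - W p'| ≤
        ENNReal.ofReal C * (ENNReal.ofReal (l ^ (1 - q) * ρ ^ (q - (m + 1))) *
          (∫⁻ x in {x : Fin (m + 1) → ℝ | ρ ≤ ‖x‖ ∧ ‖x‖ ≤ 2 * ρ}, g x ^ q) + ENNReal.ofReal l) := by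
  obtain ⟨C, hC, h⟩ := exists_osc_cube_le hm hq
  set c : ℝ := C * κ * (2 * (m + 1)) with hc
  have hc0 : 0 < c := by positivity
  refine ⟨3 * c, by positivity, fun ρ l hρ hl g hg => ?_⟩
  obtain ⟨s, hs, hJ⟩ := exists_radius_face_le hρ (hg.pow_const q)
  refine ⟨s, hs, fun W hW p p' hp hp' => ?_⟩
  set I := ∫⁻ x in {x : Fin (m + 1) → ℝ | ρ ≤ ‖x‖ ∧ ‖x‖ ≤ 2 * ρ}, g x ^ q with hI
  have hs0 : 0 < s := hρ.trans hs.1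
  rcases eq_or_ne I ⊤ with hItop | hIne
  · rw [hItop, ENNReal.mul_top, top_add, ENNReal.mul_top]
    · exact le_top
    · simpa using hc0
    · rw [ne_eq, ENNReal.ofReal_eq_zero, not_le]; positivity
  set A : ℝ := l ^ (1 - q) * ρ ^ (q - (m + 1)) with hA
  have hA0 : 0 < A := by positivity
  have hIr : I = ENNReal.ofReal I.toReal := (ENNReal.ofReal_toReal hIne).symm
  have hI0 : 0 ≤ I.toReal := ENNReal.toReal_nonneg
  rw [hIr, ← ENNReal.ofReal_mul hA0.le, ← ENNReal.ofReal_add (by positivity) hl.le,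
    ← ENNReal.ofReal_mul (by positivity)]
  refine ENNReal.ofReal_le_ofReal ?_
  rw [mul_assoc]
  refine abs_sub_le_of_faces hm hs0 (fun i σ hσ p p' hp hp' hi hi' => ?_) hp hp'
  have hσs : |σ * s| = s := by rcases hσ with rfl | rfl <;> simp [abs_of_pos hs0]
  have hins : ∀ p : Fin (m + 1) → ℝ, p i = σ * s →
      p = i.insertNth (σ * s) (i.removeNth p) := by
    intro p hp; rw [← hp, Fin.insertNth_self_removeNth]
  have hball : ∀ p : Fin (m + 1) → ℝ, ‖p‖ = s → i.removeNth p ∈ closedBall (0 : Fin m → ℝ) s := by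
    intro p hp
    rw [mem_closedBall_zero_iff, pi_norm_le_iff_of_nonneg hs0.le, ← hp]
    exact fun k => norm_le_pi_norm p _
  have hmG : Measurable fun y : Fin m → ℝ => g (i.insertNth (σ * s) y) := by
    refine hg.comp (Continuous.measurable ?_)
    exact Continuous.finInsertNth i (by fun_prop) (by fun_prop)
  have hnorm : ∀ y ∈ closedBall (0 : Fin m → ℝ) s,
      ‖(i.insertNth (σ * s) y : Fin (m + 1) → ℝ)‖ = s := by
    intro y hy
    rw [norm_insertNth, hσs, max_eq_left (by simpa using hy)]
  have key := h s (l / ρ) (κ * ρ) (by positivity) hs0 (by positivity) _ hmG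
    (fun y => W (i.insertNth (σ * s) y)) (fun y hy z hz => by
      refine (hW i σ hσ _ _ (hnorm y hy) (hnorm z hz) (by simp) (by simp)).trans (le_of_eq ?_)
      congr 1
      refine lintegral_congr fun t => congrArg g ?_
      funext k
      rcases Fin.eq_self_or_eq_succAbove i k with rfl | ⟨k, rfl⟩ <;> simp)
    (i.removeNth p) (hball p hp) (i.removeNth p') (hball p' hp')
  rw [← hins p hi, ← hins p' hi'] at key
  have hJi := hJ i σ hσ
  set J := ∫⁻ y in closedBall (0 : Fin m → ℝ) s, g (i.insertNth (σ * s) y) ^ q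
  have hJne : J ≠ ⊤ := by
    intro hJ'
    rw [hJ', ENNReal.mul_top (by simpa using hρ)] at hJi
    exact (ENNReal.mul_ne_top ENNReal.ofReal_ne_top hIne) (top_le_iff.1 hJi)
  rw [← ENNReal.ofReal_toReal hJne] at key hJi
  rw [hIr, ← ENNReal.ofReal_mul hρ.le, ← ENNReal.ofReal_mul (by positivity),
    ENNReal.ofReal_le_ofReal_iff (by positivity)] at hJi
  have hJ0 : 0 ≤ J.toReal := ENNReal.toReal_nonneg
  rw [← ENNReal.ofReal_mul (by positivity), ← ENNReal.ofReal_add (by positivity) (by positivity),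
    ENNReal.ofReal_le_ofReal_iff (by positivity)] at key
  have hpow : ρ ^ m ≤ (2 * s) ^ m := pow_le_pow_left₀ hρ.le (by linarith [hs.1]) m
  have e1 : C * (κ * ρ) * (l / ρ) ^ (1 - q) * J.toReal ≤ c * A * I.toReal * (2 * s) ^ m := by
    have e2 : (l / ρ) ^ (1 - q) = A * ρ ^ m := by
      rw [hA, Real.div_rpow hl.le hρ.le, ← Real.rpow_natCast ρ m, mul_assoc, ← Real.rpow_add hρ,
        div_eq_mul_inv, ← Real.rpow_neg hρ.le]
      ring_nf
    rw [e2]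
    calc C * (κ * ρ) * (A * ρ ^ m) * J.toReal = C * κ * A * ρ ^ m * (ρ * J.toReal) := by ring
      _ ≤ C * κ * A * (2 * s) ^ m * (2 * (m + 1) * I.toReal) := by gcongr
      _ = _ := by rw [hc]; ring
  have e3 : C * (κ * ρ) * (l / ρ) * (2 * s) ^ m ≤ c * l * (2 * s) ^ m := by
    have : C * (κ * ρ) * (l / ρ) = C * κ * 1 * l := by field_simp
    rw [this, hc]
    gcongr
    have : (0 : ℝ) ≤ m := by positivity
    linarith
  have h2s : 0 < (2 * s) ^ m := by positivity
  refine le_of_mul_le_mul_right (key.trans ((add_le_add e1 e3).trans (le_of_eq ?_))) h2s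
  ring
end

section
variable {n : ℕ}

/-- The sup norm on Euclidean space. -/
noncomputable def supNorm (x : EuclideanSpace ℝ (Fin n)) : ℝ := ‖WithLp.ofLp x‖

theorem continuous_supNorm : Continuous (supNorm : EuclideanSpace ℝ (Fin n) → ℝ) :=
  continuous_norm.comp (PiLp.continuous_ofLp 2 _)

theorem supNorm_le_norm (x : EuclideanSpace ℝ (Fin n)) : supNorm x ≤ ‖x‖ :=
  (pi_norm_le_iff_of_nonneg (norm_nonneg x)).2 fun i => PiLp.norm_apply_le x i

theorem norm_le_mul_supNorm (x : EuclideanSpace ℝ (Fin n)) : ‖x‖ ≤ n * supNorm x := by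
  have h1 : ‖x‖ ^ 2 ≤ (n * supNorm x) ^ 2 := by
    rw [EuclideanSpace.norm_sq_eq]
    calc ∑ i, ‖x i‖ ^ 2 ≤ ∑ _i : Fin n, supNorm x ^ 2 := by
          refine Finset.sum_le_sum fun i _ => ?_
          exact pow_le_pow_left₀ (norm_nonneg _) (norm_le_pi_norm (WithLp.ofLp x) i) 2
      _ = n * supNorm x ^ 2 := by simp
      _ ≤ n ^ 2 * supNorm x ^ 2 := by
          gcongr
          exact_mod_cast Nat.le_self_pow two_ne_zero n
      _ = _ := by ring
  exact le_of_sq_le_sq h1 (by unfold supNorm; positivity)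

theorem enorm_sub_le_segment {a b : EuclideanSpace ℝ (Fin n)} {W : EuclideanSpace ℝ (Fin n) → ℝ}
    {W' : EuclideanSpace ℝ (Fin n) → EuclideanSpace ℝ (Fin n)}
    {G : EuclideanSpace ℝ (Fin n) → ℝ} {S : Set (EuclideanSpace ℝ (Fin n))}
    (hseg : ∀ t ∈ Icc (0 : ℝ) 1, a + t • (b - a) ∈ S)
    (hW : ∀ x ∈ S, HasGradientAt W (W' x) x) (hc : ContinuousOn W' S)
    (hG : ∀ x ∈ S, ‖W' x‖ ≤ G x) {K : ℝ} (hK : ‖b - a‖ ≤ K) :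
    ENNReal.ofReal |W b - W a| ≤ ENNReal.ofReal K *
      ∫⁻ t in Ioo (0 : ℝ) 1, ENNReal.ofReal (G (a + t • (b - a))) := by
  have hK0 : 0 ≤ K := (norm_nonneg _).trans hK
  have hd : ∀ t ∈ uIcc (0 : ℝ) 1, HasDerivAt (fun t : ℝ => W (a + t • (b - a)))
      ⟪W' (a + t • (b - a)), b - a⟫_ℝ t := by
    intro t ht
    rw [uIcc_of_le zero_le_one] at ht
    have h1 := (hasGradientAt_iff_hasFDerivAt.1 (hW _ (hseg t ht)))
    have h2 : HasDerivAt (fun t : ℝ => a + t • (b - a)) (b - a) t := by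
      simpa using ((hasDerivAt_id t).smul_const (b - a)).const_add a
    simpa [Function.comp_def] using h1.comp_hasDerivAt t h2
  have hcont : ContinuousOn (fun t : ℝ => ⟪W' (a + t • (b - a)), b - a⟫_ℝ) (uIcc 0 1) := by
    rw [uIcc_of_le zero_le_one]
    refine ContinuousOn.inner (hc.comp (by fun_prop) hseg) continuousOn_const
  have hint := intervalIntegral.integral_eq_sub_of_hasDerivAt hd hcont.intervalIntegrable
  simp only [one_smul, zero_smul, add_zero, add_sub_cancel] at hint
  rw [← hint, ← Real.enorm_eq_ofReal_abs, intervalIntegral.integral_of_le zero_le_one,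
    integral_Ioc_eq_integral_Ioo]
  refine (enorm_integral_le_lintegral_enorm _).trans ?_
  rw [← lintegral_const_mul' _ _ ENNReal.ofReal_ne_top]
  refine setLIntegral_mono' measurableSet_Ioo fun t ht => ?_
  have hS := hseg t ⟨ht.1.le, ht.2.le⟩
  rw [← ENNReal.ofReal_mul hK0, Real.enorm_eq_ofReal_abs]
  refine ENNReal.ofReal_le_ofReal ?_
  calc _ ≤ ‖W' (a + t • (b - a))‖ * ‖b - a‖ := abs_real_inner_le_norm _ _
    _ ≤ G (a + t • (b - a)) * K := by
        have := hG _ hS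
        gcongr
        exact (norm_nonneg _).trans this
    _ = _ := mul_comm _ _

theorem exists_supNorm_sphere_osc_le (hn : 2 ≤ n) {q : ℝ} (hq : (n : ℝ) - 1 < q) :
    ∃ C : ℝ, 0 < C ∧ ∀ ρ l : ℝ, 0 < ρ → 0 < l → ∀ G : EuclideanSpace ℝ (Fin n) → ℝ,
      Measurable G → (∀ x, 0 ≤ G x) →
      IntegrableOn (fun x => G x ^ q) {x | ρ ≤ supNorm x ∧ supNorm x ≤ 2 * ρ} →
      ∃ s ∈ Ioo ρ (2 * ρ), ∀ (W : EuclideanSpace ℝ (Fin n) → ℝ)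
        (W' : EuclideanSpace ℝ (Fin n) → EuclideanSpace ℝ (Fin n)),
        (∀ x, supNorm x = s → HasGradientAt W (W' x) x) →
        ContinuousOn W' {x | supNorm x = s} →
        (∀ x, supNorm x = s → ‖W' x‖ ≤ G x) →
        ∀ p p', supNorm p = s → supNorm p' = s → |W p - W p'| ≤
          C * (l ^ (1 - q) * ρ ^ (q - n) *
            (∫ x in {x | ρ ≤ supNorm x ∧ supNorm x ≤ 2 * ρ}, G x ^ q) + l) := by
  obtain ⟨m, rfl⟩ : ∃ m, n = m + 1 := ⟨n - 1, by omega⟩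
  obtain ⟨C, hC, h⟩ := exists_sphere_osc_le (m := m) (by omega) (q := q)
    (by push_cast at hq; linarith) (show (0 : ℝ) < 4 * (m + 1) by positivity)
  refine ⟨C, hC, fun ρ l hρ hl G hGm hG0 hGi => ?_⟩
  have hgm : Measurable fun y : Fin (m + 1) → ℝ => ENNReal.ofReal (G (WithLp.toLp 2 y)) :=
    (hGm.comp (PiLp.volume_preserving_toLp (Fin (m + 1))).measurable).ennreal_ofReal
  obtain ⟨s, hs, key⟩ := h ρ l hρ hl _ hgm
  refine ⟨s, hs, fun W W' hW hW' hWG p p' hp hp' => ?_⟩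
  have hs0 : 0 < s := hρ.trans hs.1
  have := key (fun y => W (WithLp.toLp 2 y)) (fun i σ hσ y y' hy hy' hi hi' => by
    have hσs : |σ * s| = s := by rcases hσ with rfl | rfl <;> simp [abs_of_pos hs0]
    have hseg : ∀ t ∈ Icc (0 : ℝ) 1,
        WithLp.toLp 2 y' + t • (WithLp.toLp 2 y - WithLp.toLp 2 y') ∈
          {x : EuclideanSpace ℝ (Fin (m + 1)) | supNorm x = s} := by
      intro t ht
      change ‖y' + t • (y - y')‖ = s
      refine le_antisymm ?_ ?_
      · have hc := convex_closedBall (0 : Fin (m + 1) → ℝ) s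
        have := hc.add_smul_sub_mem (by simpa using hy'.le) (by simpa using hy.le) ht
        simpa using this
      · have := norm_le_pi_norm (y' + t • (y - y')) i
        simp only [Pi.add_apply, Pi.smul_apply, Pi.sub_apply, hi, hi', sub_self, smul_zero,
          add_zero, Real.norm_eq_abs, hσs] at this
        exact this
    refine enorm_sub_le_segment (G := G) hseg hW hW' hWG ?_
    calc ‖WithLp.toLp 2 y - WithLp.toLp 2 y'‖
        ≤ ((m + 1 : ℕ) : ℝ) * ‖y - y'‖ := norm_le_mul_supNorm _
      _ ≤ ((m + 1 : ℕ) : ℝ) * (s + s) := by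
          gcongr; exact (norm_sub_le _ _).trans (by rw [hy, hy'])
      _ ≤ _ := by
          push_cast
          have := hs.2
          have : ((m : ℝ) + 1) * (s + s) ≤ (m + 1) * (2 * (2 * ρ)) := by gcongr; linarith
          linarith) (WithLp.ofLp p) (WithLp.ofLp p') hp hp'
  have hint : ∫⁻ y in {y : Fin (m + 1) → ℝ | ρ ≤ ‖y‖ ∧ ‖y‖ ≤ 2 * ρ},
      ENNReal.ofReal (G (WithLp.toLp 2 y)) ^ q
      = ENNReal.ofReal (∫ x in {x : EuclideanSpace ℝ (Fin (m + 1)) |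
          ρ ≤ supNorm x ∧ supNorm x ≤ 2 * ρ}, G x ^ q) := by
    have hq0 : 0 ≤ q := by push_cast at hq; linarith [(Nat.cast_nonneg m : (0 : ℝ) ≤ m)]
    rw [ofReal_integral_eq_lintegral_ofReal hGi
      (Eventually.of_forall fun x => Real.rpow_nonneg (hG0 x) q)]
    have hmp := PiLp.volume_preserving_toLp (Fin (m + 1))
    rw [← hmp.setLIntegral_comp_preimage_emb
      (MeasurableEquiv.toLp 2 (Fin (m + 1) → ℝ)).measurableEmbedding]
    refine lintegral_congr fun y => ?_
    rw [ENNReal.ofReal_rpow_of_nonneg (hG0 _) hq0]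
  rw [hint, ← ENNReal.ofReal_mul (by positivity), ← ENNReal.ofReal_add ?_ hl.le,
    ← ENNReal.ofReal_mul hC.le, ENNReal.ofReal_le_ofReal_iff ?_] at this
  · push_cast
    exact this
  · have : 0 ≤ ∫ x in {x : EuclideanSpace ℝ (Fin (m + 1)) |
        ρ ≤ supNorm x ∧ supNorm x ≤ 2 * ρ}, G x ^ q :=
      integral_nonneg fun x => Real.rpow_nonneg (hG0 x) q
    positivity
  · have : 0 ≤ ∫ x in {x : EuclideanSpace ℝ (Fin (m + 1)) |
        ρ ≤ supNorm x ∧ supNorm x ≤ 2 * ρ}, G x ^ q :=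
      integral_nonneg fun x => Real.rpow_nonneg (hG0 x) q
    positivity
end

/-- Data extracted from two solutions `u`, `h` of `n`-Laplace equations, `n = m + 2`: `w = u - h`
extended by zero outside the ball, its gradient `Dw`, the gradient `Dh` of `h`, the difference `V`
of the fluxes, and the density `f`. -/
structure FluxComparison {m : ℕ} (r d : ℝ) (w f : EuclideanSpace ℝ (Fin (m + 2)) → ℝ)
    (Dh Dw V : EuclideanSpace ℝ (Fin (m + 2)) → EuclideanSpace ℝ (Fin (m + 2))) : Prop where
  r_pos : 0 < r
  d_pos : 0 < d
  f_nonneg : ∀ x, 0 ≤ f x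
  f_int : Integrable f
  w_meas : Measurable w
  w_cont : ContinuousOn w {0}ᶜ
  w_zero : ∀ x, r ≤ ‖x‖ → w x = 0
  w_contDiffAt : ∀ x, x ≠ 0 → ‖x‖ < r → ContDiffAt ℝ 1 w x
  w_grad : ∀ x, x ≠ 0 → ‖x‖ < r → HasGradientAt w (Dw x) x
  Dw_zero : ∀ x, ¬ (x ≠ 0 ∧ ‖x‖ < r) → Dw x = 0
  Dw_cont : ContinuousOn Dw {x | x ≠ 0 ∧ ‖x‖ < r}
  Dh_cont : ContinuousOn Dh {x | x ≠ 0 ∧ ‖x‖ < r}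
  V_cont : ContinuousOn V {x | x ≠ 0 ∧ ‖x‖ < r}
  Dw_meas : Measurable Dw
  V_int : Integrable V
  Dw_int : ∀ q : ℝ, 1 ≤ q → q < m + 2 → Integrable fun x => ‖Dw x‖ ^ q
  coercive : ∀ x, d * ‖Dw x‖ ^ (m + 2) ≤ ⟪V x, Dw x⟫_ℝ
  growth : ∀ x, ‖V x‖ ≤ (m + 1) * ((‖Dh x‖ + ‖Dw x‖) ^ m * ‖Dw x‖)
  weak : ∀ φ : EuclideanSpace ℝ (Fin (m + 2)) → ℝ, ContDiff ℝ 1 φ → HasCompactSupport φ →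
    tsupport φ ⊆ ball 0 r → ∫ x, ⟪V x, gradient φ x⟫_ℝ = ∫ x, f x * φ x
  Dh_bound : ∀ L : ℝ, 1 < L → ∃ C : ℝ, 0 ≤ C ∧ ∀ ρ : ℝ, 0 < ρ → 2 * L * ρ < r →
    ∫ x in {x | ρ ≤ ‖x‖ ∧ ‖x‖ ≤ L * ρ}, ‖Dh x‖ ^ (m + 2) ≤ C

theorem admissible_of_eventuallyEq {F : Type*} [NormedAddCommGroup F] [NormedSpace ℝ F]
    [ProperSpace F] {r : ℝ} {φ : F → ℝ} (h1 : ∀ x, ‖x‖ < r → ContDiffAt ℝ 1 φ x)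
    (h2 : ∀ x, r ≤ ‖x‖ → φ =ᶠ[𝓝 x] 0) :
    ContDiff ℝ 1 φ ∧ HasCompactSupport φ ∧ tsupport φ ⊆ ball 0 r := by
  have hts : tsupport φ ⊆ ball 0 r := by
    intro x hx
    rw [mem_ball_zero_iff]
    by_contra hlt
    exact notMem_tsupport_iff_eventuallyEq.2 (h2 x (not_lt.1 hlt)) hx
  refine ⟨contDiff_iff_contDiffAt.2 fun x => ?_, ?_, hts⟩
  · rcases lt_or_ge ‖x‖ r with h | h
    · exact h1 x h
    · exact (contDiffAt_const (c := (0 : ℝ))).congr_of_eventuallyEq (h2 x h)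
  · exact (isCompact_closedBall (0 : F) r).of_isClosed_subset (isClosed_tsupport φ)
      (hts.trans ball_subset_closedBall)

theorem gradient_eq_zero_of_eventuallyEq_const {F : Type*} [NormedAddCommGroup F]
    [InnerProductSpace ℝ F] [CompleteSpace F] {φ : F → ℝ} {c : ℝ} {x : F}
    (h : φ =ᶠ[𝓝 x] fun _ => c) : gradient φ x = 0 := by
  rw [gradient, h.fderiv_eq]; simp

theorem exists_norm_gradient_le {F : Type*} [NormedAddCommGroup F] [InnerProductSpace ℝ F]
    [CompleteSpace F] {φ : F → ℝ} (h1 : ContDiff ℝ 1 φ) (h2 : HasCompactSupport φ) :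
    ∃ C, ∀ x, ‖gradient φ x‖ ≤ C := by
  obtain ⟨C, hC⟩ := (h2.fderiv (𝕜 := ℝ)).exists_bound_of_continuous
    (h1.continuous_fderiv (by norm_num))
  exact ⟨C, fun x => by simpa [gradient] using hC x⟩

section
variable {F : Type*} [NormedAddCommGroup F] [InnerProductSpace ℝ F] [CompleteSpace F]
  [MeasurableSpace F] [BorelSpace F] [SecondCountableTopology F] {μ : Measure F}

theorem MeasureTheory.Integrable.inner_gradient {V : F → F} (hV : Integrable V μ) {φ : F → ℝ}
    (h1 : ContDiff ℝ 1 φ) (h2 : HasCompactSupport φ) :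
    Integrable (fun x => ⟪V x, gradient φ x⟫_ℝ) μ := by
  obtain ⟨C, hC⟩ := exists_norm_gradient_le h1 h2
  refine (hV.norm.mul_const C).mono' (hV.aestronglyMeasurable.inner
    h1.continuous_gradient.aestronglyMeasurable) (Eventually.of_forall fun x => ?_)
  exact (norm_inner_le_norm _ _).trans (mul_le_mul_of_nonneg_left (hC x) (norm_nonneg _))

end

namespace FluxComparison
variable {m : ℕ} {r d : ℝ} {w f : EuclideanSpace ℝ (Fin (m + 2)) → ℝ}
  {Dh Dw V : EuclideanSpace ℝ (Fin (m + 2)) → EuclideanSpace ℝ (Fin (m + 2))}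

theorem w_continuousAt (H : FluxComparison r d w f Dh Dw V) {x : EuclideanSpace ℝ (Fin (m + 2))}
    (hx : x ≠ 0) : ContinuousAt w x :=
  H.w_cont.continuousAt (isOpen_compl_singleton.mem_nhds hx)

theorem inner_nonneg (H : FluxComparison r d w f Dh Dw V) (x : EuclideanSpace ℝ (Fin (m + 2))) :
    0 ≤ ⟪V x, Dw x⟫_ℝ :=
  (mul_nonneg H.d_pos.le (by positivity)).trans (H.coercive x)

/-- Comparison principle outside a sup-norm cube. -/
theorem comparison (H : FluxComparison r d w f Dh Dw V) {G : ℝ → ℝ} (hG : ContDiff ℝ 1 G)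
    (hanti : Antitone G) (hG0 : ∀ t, 0 ≤ G t) {δ : ℝ} (hδ : 0 < δ) (hGz : ∀ t, -δ ≤ t → G t = 0)
    {c s : ℝ} (hc : 0 ≤ c) (hs : 0 < s) (hsr : ((m + 2 : ℕ) : ℝ) * s < r)
    (hcs : ∀ x, supNorm x = s → ∀ᶠ t in 𝓝 (w x), G t = c) :
    c = 0 ∧ ∀ x, s < supNorm x → G (w x) = 0 := by
  classical
  set φ : EuclideanSpace ℝ (Fin (m + 2)) → ℝ := fun x => if supNorm x ≤ s then c else G (w x)
    with hφ
  have hne : ∀ x : EuclideanSpace ℝ (Fin (m + 2)), s ≤ supNorm x → x ≠ 0 := by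
    rintro x hx rfl
    simp [supNorm] at hx; linarith
  have hin : ∀ x : EuclideanSpace ℝ (Fin (m + 2)), supNorm x ≤ s → ‖x‖ < r := fun x hx =>
    (norm_le_mul_supNorm x).trans_lt ((by gcongr : _ ≤ ((m + 2 : ℕ) : ℝ) * s).trans_lt hsr)
  have hinner : ∀ x : EuclideanSpace ℝ (Fin (m + 2)), supNorm x ≤ s → φ =ᶠ[𝓝 x] fun _ => c := by
    intro x hx
    rcases hx.lt_or_eq with hlt | heq
    · filter_upwards [continuous_supNorm.continuousAt.eventually_lt continuousAt_const hlt]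
        with y hy
      exact if_pos hy.le
    · filter_upwards [(H.w_continuousAt (hne x heq.ge)).eventually (hcs x heq)] with y hy
      simp only [hφ]; split_ifs <;> simp_all
  have houter : ∀ x : EuclideanSpace ℝ (Fin (m + 2)), s < supNorm x →
      φ =ᶠ[𝓝 x] fun y => G (w y) := by
    intro x hx
    filter_upwards [continuousAt_const.eventually_lt continuous_supNorm.continuousAt hx] with y hy
    exact if_neg (not_le.2 hy)
  obtain ⟨h1, h2, h3⟩ := admissible_of_eventuallyEq (r := r) (φ := φ)
    (fun x hx => by
      rcases le_or_gt (supNorm x) s with hle | hlt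
      · exact contDiffAt_const.congr_of_eventuallyEq (hinner x hle)
      · refine ContDiffAt.congr_of_eventuallyEq ?_ (houter x hlt)
        exact hG.contDiffAt.comp x (H.w_contDiffAt x (hne x hlt.le) hx))
    (fun x hx => by
      have hlt : s < supNorm x := by
        by_contra hle; exact absurd (hin x (not_lt.1 hle)) (not_lt.2 hx)
      refine (houter x hlt).trans ?_
      have hwx : -δ < w x := by rw [H.w_zero x hx]; linarith
      filter_upwards [continuousAt_const.eventually_lt (H.w_continuousAt (hne x hlt.le)) hwx]
        with y hy
      exact hGz _ hy.le)
  have hφ0 : ∀ x, 0 ≤ φ x := fun x => by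
    simp only [hφ]; split_ifs; exacts [hc, hG0 _]
  have hgrad : ∀ x, ∃ g : ℝ, g ≤ 0 ∧ gradient φ x = g • Dw x := by
    intro x
    rcases le_or_gt (supNorm x) s with hle | hlt
    · exact ⟨0, le_rfl, by rw [gradient_eq_zero_of_eventuallyEq_const (hinner x hle), zero_smul]⟩
    · rcases lt_or_ge ‖x‖ r with hr | hr
      · refine ⟨deriv G (w x), hanti.deriv_nonpos, ?_⟩
        have hd := ((hG.differentiable (by norm_num)) (w x)).hasDerivAt
        exact ((hd.comp_hasGradientAt (H.w_grad x (hne x hlt.le) hr)).congr_of_eventuallyEq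
          (houter x hlt)).gradient
      · refine ⟨0, le_rfl, ?_⟩
        rw [zero_smul]
        refine image_eq_zero_of_notMem_tsupport (f := gradient φ) fun hx => ?_
        have hsub : tsupport (gradient φ) ⊆ tsupport φ := by
          refine closure_minimal (fun y hy => ?_) (isClosed_tsupport φ)
          by_contra hyn
          exact hy (gradient_eq_zero_of_eventuallyEq_const (c := 0)
            (notMem_tsupport_iff_eventuallyEq.1 hyn))
        exact absurd (mem_ball_zero_iff.1 (h3 (hsub hx))) (not_lt.2 hr)
  have hle0 : ∀ x, ⟪V x, gradient φ x⟫_ℝ ≤ 0 := fun x => by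
    obtain ⟨g, hg, e⟩ := hgrad x
    rw [e, real_inner_smul_right]
    exact mul_nonpos_of_nonpos_of_nonneg hg (H.inner_nonneg x)
  have hzero : ∫ x, -⟪V x, gradient φ x⟫_ℝ = 0 := by
    refine le_antisymm ?_ (integral_nonneg fun x => neg_nonneg.2 (hle0 x))
    rw [integral_neg, H.weak φ h1 h2 h3]
    exact neg_nonpos.2 (integral_nonneg fun x => mul_nonneg (H.f_nonneg x) (hφ0 x))
  have hae : gradient φ =ᵐ[volume] fun _ => (0 : EuclideanSpace ℝ (Fin (m + 2))) := by
    have := (integral_eq_zero_iff_of_nonneg (fun x => neg_nonneg.2 (hle0 x))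
      (H.V_int.inner_gradient h1 h2).neg).1 hzero
    filter_upwards [this] with x hx
    obtain ⟨g, hg, e⟩ := hgrad x
    rw [e, real_inner_smul_right] at hx
    simp only [Pi.zero_apply, neg_eq_zero, mul_eq_zero] at hx
    rw [e]
    rcases hx with hx | hx
    · rw [hx, zero_smul]
    · have hc := H.coercive x
      rw [hx] at hc
      have hd := H.d_pos
      have h0 : ‖Dw x‖ ^ (m + 2) = 0 := by
        refine le_antisymm ?_ (by positivity)
        by_contra hpos
        rw [not_le] at hpos
        exact absurd hc (not_le.2 (mul_pos hd hpos))
      rw [norm_eq_zero.1 (eq_zero_of_pow_eq_zero h0), smul_zero]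
  have hall : gradient φ = fun _ => 0 :=
    (Continuous.ae_eq_iff_eq volume h1.continuous_gradient continuous_const).1 hae
  have hfd : ∀ x, fderiv ℝ φ x = 0 := fun x => by
    have := congrFun hall x
    simpa [gradient] using this
  have hconst : ∀ x y, φ x = φ y :=
    is_const_of_fderiv_eq_zero (h1.differentiable (by norm_num)) hfd
  have hfar : ∀ x, φ x = 0 := by
    intro x
    have : ∃ y, φ y = 0 := by
      by_contra! hcon
      have hbd : Bornology.IsBounded (univ : Set (EuclideanSpace ℝ (Fin (m + 2)))) := by
        refine h2.isBounded.subset fun y _ => subset_tsupport φ (hcon y)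
      exact NormedSpace.unbounded_univ ℝ (EuclideanSpace ℝ (Fin (m + 2))) hbd
    obtain ⟨y, hy⟩ := this
    rw [hconst x y, hy]
  refine ⟨?_, fun x hx => ?_⟩
  · have := hfar 0
    simpa [hφ, supNorm, hs.le] using this
  · have := hfar x
    rwa [show φ x = G (w x) from if_neg (not_le.2 hx)] at this

theorem exists_neg_lt (H : FluxComparison r d w f Dh Dw V) {k s : ℝ} (hk : 0 < k) (hs : 0 < s)
    (hsr : ((m + 2 : ℕ) : ℝ) * s < r) : ∃ x, supNorm x = s ∧ -k < w x := by
  by_contra! hcon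
  have hk8 : 0 < k / 8 := by positivity
  have hk4 : 0 ≤ k / 4 := by positivity
  have := (H.comparison (G := fun t => softTrunc (k / 8) (k / 4) (k / 4) (-t))
    ((contDiff_softTrunc _ _ _).comp contDiff_neg) (fun a b hab => by
      have hmono : Monotone (softTrunc (k / 8) (k / 4) (k / 4)) :=
        monotone_of_deriv_nonneg ((contDiff_softTrunc _ _ _).differentiable (by norm_num))
          fun t => by rw [(hasDerivAt_softTrunc _ _ _ _).deriv]; exact softTruncDeriv_nonneg hk8 hk4
      exact hmono (neg_le_neg hab)) (fun t => softTrunc_nonneg hk8 hk4) hk8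
    (fun t ht => softTrunc_of_le hk8 hk4 (by linarith)) hk4 hs hsr (fun x hx => by
      have := hcon x hx
      filter_upwards [eventually_lt_nhds (show w x < -(k / 2) by linarith)] with t ht
      exact softTrunc_of_ge hk8 hk4 (by linarith))).1
  linarith

theorem le_of_le_on_supNorm_sphere (H : FluxComparison r d w f Dh Dw V) {κ s : ℝ} (hκ : κ < 0)
    (hs : 0 < s) (hsr : ((m + 2 : ℕ) : ℝ) * s < r) (hle : ∀ x, supNorm x = s → κ ≤ w x)
    {x : EuclideanSpace ℝ (Fin (m + 2))} (hx : s < supNorm x) : κ ≤ w x := by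
  refine le_of_forall_pos_sub_le fun ε hε => ?_
  have := (H.comparison (G := fun t => softPos ε (κ - 2 * ε - t))
    ((contDiff_softPos ε).comp (contDiff_const.sub contDiff_id))
    (fun a b hab => softPos_monotone hε (by linarith)) (fun t => softPos_nonneg hε)
    (neg_pos.2 hκ) (fun t ht => softPos_of_le hε (by linarith)) le_rfl hs hsr
    (fun x hx => by
      filter_upwards [eventually_gt_nhds (show κ - ε < w x by linarith [hle x hx])] with t ht
      exact softPos_of_le hε (by linarith))).2 x hx
  by_contra hlt
  rw [not_le] at hlt
  have hp := softPos_pos (s := κ - 2 * ε - w x) hε (by linarith)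
  exact absurd this hp.ne'

end FluxComparison

theorem softPos_le_add {ε s : ℝ} (hε : 0 < ε) (hs : -ε ≤ s) : softPos ε s ≤ s + ε := by
  have := softPos_sub_le hε hs
  rw [softPos_of_le hε le_rfl] at this
  linarith

section
variable {F : Type*} [NormedAddCommGroup F]

/-- The closed spherical shell centred at the origin. -/
def shell (a b : ℝ) : Set F := {x | a ≤ ‖x‖ ∧ ‖x‖ ≤ b}

theorem isClosed_shell (a b : ℝ) : IsClosed (shell a b : Set F) :=
  (isClosed_le continuous_const continuous_norm).inter
    (isClosed_le continuous_norm continuous_const)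

theorem measurableSet_shell [MeasurableSpace F] [BorelSpace F] (a b : ℝ) :
    MeasurableSet (shell a b : Set F) := (isClosed_shell a b).measurableSet

theorem isCompact_shell [ProperSpace F] (a b : ℝ) : IsCompact (shell a b : Set F) :=
  (isCompact_closedBall (0 : F) b).of_isClosed_subset (isClosed_shell a b)
    fun _ hx => mem_closedBall_zero_iff.2 hx.2

theorem shell_subset {a b r : ℝ} (ha : 0 < a) (hb : b < r) :
    (shell a b : Set F) ⊆ {x | x ≠ 0 ∧ ‖x‖ < r} := fun _ hx =>
  ⟨norm_pos_iff.1 (ha.trans_le hx.1), hx.2.trans_lt hb⟩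

theorem shell_mono {a a' b b' : ℝ} (ha : a' ≤ a) (hb : b ≤ b') :
    (shell a b : Set F) ⊆ shell a' b' := fun _ hx => ⟨ha.trans hx.1, hx.2.trans hb⟩

theorem ContinuousOn.integrableOn_shell [MeasurableSpace F] [BorelSpace F] [ProperSpace F]
    {μ : Measure F} [IsFiniteMeasureOnCompacts μ] {r a b : ℝ} {g : F → ℝ}
    (hg : ContinuousOn g {x | x ≠ 0 ∧ ‖x‖ < r}) (ha : 0 < a) (hb : b < r) :
    IntegrableOn g (shell a b) μ :=
  (hg.mono (shell_subset ha hb)).integrableOn_compact (isCompact_shell a b)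

theorem ContinuousOn.integrableOn_of_eq_zero [MeasurableSpace F] [BorelSpace F] [ProperSpace F]
    {μ : Measure F} [IsFiniteMeasureOnCompacts μ] {r a b : ℝ} {g : F → ℝ}
    (hg : ContinuousOn g {x | x ≠ 0 ∧ ‖x‖ < r}) (ha : 0 < a) (hb : b < r) {S : Set F}
    (hS : MeasurableSet S) (h0 : ∀ x ∈ S, x ∉ shell a b → g x = 0) : IntegrableOn g S μ :=
  (hg.integrableOn_shell ha hb).of_forall_sdiff_eq_zero hS fun x hx => h0 x hx.1 hx.2

end

namespace FluxComparison
variable {m : ℕ} {r d : ℝ} {w f : EuclideanSpace ℝ (Fin (m + 2)) → ℝ}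
  {Dh Dw V : EuclideanSpace ℝ (Fin (m + 2)) → EuclideanSpace ℝ (Fin (m + 2))}

theorem measurableSet_lt (H : FluxComparison r d w f Dh Dw V) (κ : ℝ) :
    MeasurableSet {x | w x < κ} := H.w_meas measurableSet_Iio

theorem w_continuousOn (H : FluxComparison r d w f Dh Dw V) :
    ContinuousOn w {x | x ≠ 0 ∧ ‖x‖ < r} := H.w_cont.mono fun _ hx => hx.1

theorem V_zero (H : FluxComparison r d w f Dh Dw V) {x : EuclideanSpace ℝ (Fin (m + 2))}
    (hx : ¬ (x ≠ 0 ∧ ‖x‖ < r)) : V x = 0 := by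
  have := H.growth x
  rw [H.Dw_zero x hx, norm_zero, mul_zero, mul_zero] at this
  exact norm_le_zero_iff.1 this

theorem continuousOn_norm_Dw_rpow (H : FluxComparison r d w f Dh Dw V) {q : ℝ} (hq : 0 ≤ q) :
    ContinuousOn (fun x => ‖Dw x‖ ^ q) {x | x ≠ 0 ∧ ‖x‖ < r} :=
  H.Dw_cont.norm.rpow_const fun _ _ => Or.inr hq

theorem hasGradientAt_softPos_sub (H : FluxComparison r d w f Dh Dw V) (ε κ : ℝ)
    {x : EuclideanSpace ℝ (Fin (m + 2))} (hx : x ≠ 0 ∧ ‖x‖ < r) :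
    HasGradientAt (fun y => softPos ε (κ - w y)) (softStep ε (κ - w x) • (-Dw x)) x := by
  have hg := H.w_grad x hx.1 hx.2
  have h1 : HasGradientAt (fun y => κ - w y) (-Dw x) x := by
    rw [hasGradientAt_iff_hasFDerivAt] at hg ⊢
    rw [map_neg]
    exact hg.const_sub κ
  exact HasDerivAt.comp_hasGradientAt (f := fun y => κ - w y) (hasDerivAt_softPos ε (κ - w x)) h1

theorem sub_le_of_shell (H : FluxComparison r d w f Dh Dw V) {q : ℝ} (hq : (m : ℝ) + 1 < q) :
    ∃ C : ℝ, 0 < C ∧ ∀ κ l ρ : ℝ, κ < 0 → 0 < l → 0 < ρ → 2 * (m + 2) * ρ < r → ∀ x,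
      2 * (m + 2) * ρ < ‖x‖ → κ - w x ≤ C * (l ^ (1 - q) * ρ ^ (q - (m + 2)) *
        (∫ x in shell ρ (2 * (m + 2) * ρ) ∩ {x | w x < κ}, ‖Dw x‖ ^ q) + l) := by
  have hm0 : (0 : ℝ) ≤ m := Nat.cast_nonneg m
  have hq0 : 0 < q := by linarith
  obtain ⟨C, hC, h⟩ := exists_supNorm_sphere_osc_le (n := m + 2) (by omega) (q := q)
    (by push_cast; linarith)
  refine ⟨C, hC, fun κ l ρ hκ hl hρ hρr x hx => ?_⟩
  set G : EuclideanSpace ℝ (Fin (m + 2)) → ℝ := {x | w x < κ}.indicator fun x => ‖Dw x‖ with hG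
  set R : Set (EuclideanSpace ℝ (Fin (m + 2))) := {x | ρ ≤ supNorm x ∧ supNorm x ≤ 2 * ρ} with hR
  have hRm : MeasurableSet R :=
    ((isClosed_le continuous_const continuous_supNorm).inter
      (isClosed_le continuous_supNorm continuous_const)).measurableSet
  have hsup : ∀ x : EuclideanSpace ℝ (Fin (m + 2)), ‖x‖ ≤ (m + 2) * supNorm x := fun x => by
    simpa using norm_le_mul_supNorm x
  have hRS : R ⊆ shell ρ (2 * (m + 2) * ρ) := by
    intro y hy
    refine ⟨hy.1.trans (supNorm_le_norm y), (hsup y).trans ?_⟩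
    calc ((m : ℝ) + 2) * supNorm y ≤ (m + 2) * (2 * ρ) := by gcongr; exact hy.2
      _ = _ := by ring
  have hGm : Measurable G := H.Dw_meas.norm.indicator (H.measurableSet_lt κ)
  have hGq : ∀ x, G x ^ q = {x | w x < κ}.indicator (fun x => ‖Dw x‖ ^ q) x := by
    intro x
    by_cases hx : w x < κ
    · simp [hG, indicator, hx]
    · simp [hG, indicator, hx, Real.zero_rpow hq0.ne']
  have hint : IntegrableOn (fun x => ‖Dw x‖ ^ q) (shell ρ (2 * (m + 2) * ρ)) :=
    (H.continuousOn_norm_Dw_rpow hq0.le).integrableOn_shell hρ hρr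
  have hGi : IntegrableOn (fun x => G x ^ q) R := by
    simp only [hGq]
    exact (hint.mono_set hRS).indicator (H.measurableSet_lt κ)
  obtain ⟨s, hs, hosc⟩ := h ρ l hρ hl G hGm
    (fun x => indicator_nonneg (fun _ _ => norm_nonneg _) x) hGi
  have hs0 : 0 < s := hρ.trans hs.1
  have hle : ∫ x in R, G x ^ q ≤ ∫ x in shell ρ (2 * (m + 2) * ρ) ∩ {x | w x < κ}, ‖Dw x‖ ^ q := by
    simp only [hGq]
    rw [setIntegral_indicator (H.measurableSet_lt κ)]
    refine setIntegral_mono_set (hint.mono_set inter_subset_left)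
      (Eventually.of_forall fun x => by positivity)
      (inter_subset_inter_left _ hRS).eventuallyLE
  set J := ∫ x in shell ρ (2 * (m + 2) * ρ) ∩ {x | w x < κ}, ‖Dw x‖ ^ q
  have hJ0 : 0 ≤ J := integral_nonneg fun x => by positivity
  clear_value J
  obtain ⟨M, hM⟩ : ∃ M, M = C * (l ^ (1 - q) * ρ ^ (q - (m + 2)) * J + l) := ⟨_, rfl⟩
  have hM0 : 0 ≤ M := hM ▸ by positivity
  rw [← hM]
  have hsr : ((m + 2 : ℕ) : ℝ) * s < r := by
    push_cast
    calc ((m : ℝ) + 2) * s ≤ (m + 2) * (2 * ρ) := by gcongr; exact hs.2.le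
      _ = 2 * (m + 2) * ρ := by ring
      _ < r := hρr
  have hU : ∀ x : EuclideanSpace ℝ (Fin (m + 2)), supNorm x = s → x ≠ 0 ∧ ‖x‖ < r := fun x hx =>
    shell_subset hρ hρr (hRS ⟨hx ▸ hs.1.le, hx ▸ hs.2.le⟩)
  have hsphere : ∀ p, supNorm p = s → κ - M ≤ w p := by
    intro p hp
    refine le_of_forall_pos_sub_le fun ε hε => ?_
    have ho := hosc (fun x => softPos ε (κ - ε - w x))
      (fun x => softStep ε (κ - ε - w x) • (-Dw x))
      (fun x hx => H.hasGradientAt_softPos_sub ε (κ - ε) (hU x hx))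
      (by
        have hsub : {x : EuclideanSpace ℝ (Fin (m + 2)) | supNorm x = s} ⊆
            {x | x ≠ 0 ∧ ‖x‖ < r} := hU
        have h1 : ContinuousOn (fun x => softStep ε (κ - ε - w x)) {x | supNorm x = s} :=
          (continuous_softStep ε).comp_continuousOn
            (continuousOn_const.sub (H.w_continuousOn.mono hsub))
        exact h1.smul (H.Dw_cont.mono hsub).neg)
      (fun x hx => by
        rw [norm_smul, norm_neg, norm_of_nonneg (softStep_nonneg hε)]
        by_cases hwx : w x < κ
        · rw [hG, indicator_of_mem (show x ∈ {x | w x < κ} from hwx)]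
          exact mul_le_of_le_one_left (norm_nonneg _) (softStep_le_one hε)
        · rw [softStep_of_le hε (by linarith), zero_mul]
          exact indicator_nonneg (fun _ _ => norm_nonneg _) x)
    obtain ⟨x0, hx0, hwx0⟩ := H.exists_neg_lt (neg_pos.2 hκ) hs0 hsr
    have h2 := ho p x0 hp hx0
    rw [softPos_of_le hε (by linarith : κ - ε - w x0 ≤ -ε), sub_zero] at h2
    have h3 : C * (l ^ (1 - q) * ρ ^ (q - ((m + 2 : ℕ) : ℝ)) * (∫ x in R, G x ^ q) + l) ≤ M := by
      rw [hM]; push_cast; gcongr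
    have h4 := (le_softPos (ε := ε) (s := κ - ε - w p) hε).trans
      ((le_abs_self _).trans (h2.trans h3))
    linarith
  have hxs : s < supNorm x := by
    have h1 := hx.trans_le (hsup x)
    have h2 : 2 * ρ < supNorm x := by
      refine lt_of_mul_lt_mul_left (a := (m : ℝ) + 2) ?_ (by positivity)
      linarith
    exact hs.2.trans h2
  have := H.le_of_le_on_supNorm_sphere (by linarith : κ - M < 0) hs0 hsr hsphere hxs
  linarith

theorem exists_radius_lt (H : FluxComparison r d w f Dh Dw V) {κ : ℝ} (hκ : κ < 0) :
    ∃ b, b < r ∧ ∀ x, b < ‖x‖ → κ < w x := by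
  have hr := H.r_pos
  set K : Set (EuclideanSpace ℝ (Fin (m + 2))) := shell (r / 2) r ∩ w ⁻¹' Iic κ
  have hK : IsCompact K := by
    refine (isCompact_shell _ _).of_isClosed_subset ?_ inter_subset_left
    refine ContinuousOn.preimage_isClosed_of_isClosed (H.w_cont.mono ?_) (isClosed_shell _ _)
      isClosed_Iic
    rintro x hx rfl
    have := hx.1
    rw [norm_zero] at this
    linarith
  have hlt : ∀ x ∈ K, ‖x‖ < r := by
    intro x hx
    by_contra hge
    have := H.w_zero x (not_lt.1 hge)
    have h2 : w x ≤ κ := hx.2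
    linarith
  obtain ⟨b, hb, hbK⟩ : ∃ b < r, ∀ x ∈ K, ‖x‖ ≤ b := by
    rcases K.eq_empty_or_nonempty with he | hne
    · exact ⟨0, hr, by simp [he]⟩
    · obtain ⟨x0, hx0, hmax⟩ := hK.exists_isMaxOn hne continuous_norm.continuousOn
      exact ⟨‖x0‖, hlt x0 hx0, fun x hx => hmax hx⟩
  refine ⟨max b (r / 2), max_lt hb (by linarith), fun x hx => ?_⟩
  by_contra hle
  rcases le_or_gt ‖x‖ r with hxr | hxr
  · have := hbK x ⟨⟨((le_max_right _ _).trans_lt hx).le, hxr⟩, not_lt.1 hle⟩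
    exact absurd ((le_max_left _ _).trans_lt hx) (not_lt.2 this)
  · have := H.w_zero x hxr.le
    rw [this] at hle
    exact hle hκ

/-- Energy inequality on sublevel sets. -/
theorem setIntegral_sublevel_le (H : FluxComparison r d w f Dh Dw V) {κ a b : ℝ} (ha : 0 < a)
    (hb : b < r) {η : EuclideanSpace ℝ (Fin (m + 2)) → ℝ} (hη : ContDiff ℝ 1 η)
    (hη0 : ∀ x, 0 ≤ η x) (hηa : ∀ x, ‖x‖ ≤ a → η x = 0)
    (hηb : ∀ x, b < ‖x‖ → w x < κ → η x = 0) :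
    ∫ x in {x | w x < κ}, η x * ⟪V x, Dw x⟫_ℝ
      ≤ ∫ x in {x | w x < κ}, (κ - w x) * (‖V x‖ * ‖gradient η x‖) := by
  set S := {x | w x < κ} with hSdef
  have hS : MeasurableSet S := H.measurableSet_lt κ
  have hgη : Continuous (gradient η) := hη.continuous_gradient
  have hga : ∀ x, ‖x‖ < a → gradient η x = 0 := fun x hx => by
    refine gradient_eq_zero_of_eventuallyEq_const (c := 0) ?_
    filter_upwards [continuous_norm.continuousAt.eventually_lt continuousAt_const hx] with y hy
    exact hηa y hy.le
  have hηS : ∀ x ∈ S, x ∉ shell a b → η x = 0 := fun x hx hxs => by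
    rcases le_or_gt ‖x‖ a with h | h
    · exact hηa x h
    · exact hηb x (by by_contra hle; exact hxs ⟨h.le, not_lt.1 hle⟩) hx
  have hgS : ∀ x ∈ S, x ∉ shell a b → gradient η x = 0 := fun x hx hxs => by
    rcases lt_or_ge ‖x‖ a with h | h
    · exact hga x h
    · have hbx : b < ‖x‖ := by by_contra hle; exact hxs ⟨h, not_lt.1 hle⟩
      refine gradient_eq_zero_of_eventuallyEq_const (c := 0) ?_
      filter_upwards [continuousAt_const.eventually_lt continuous_norm.continuousAt hbx,
        (H.w_continuousAt (norm_pos_iff.1 (ha.trans_le h))).eventually_lt continuousAt_const hx]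
        with y hy1 hy2
      exact hηb y hy1 hy2
  have hcE : ContinuousOn (fun x => η x * ⟪V x, Dw x⟫_ℝ) {x | x ≠ 0 ∧ ‖x‖ < r} :=
    hη.continuous.continuousOn.mul (H.V_cont.inner H.Dw_cont)
  have hIE : IntegrableOn (fun x => η x * ⟪V x, Dw x⟫_ℝ) S :=
    hcE.integrableOn_of_eq_zero ha hb hS fun x hx hxs => by simp [hηS x hx hxs]
  have hIR : IntegrableOn (fun x => (κ - w x) * (‖V x‖ * ‖gradient η x‖)) S := by
    refine ContinuousOn.integrableOn_of_eq_zero (r := r) ?_ ha hb hS fun x hx hxs => by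
      simp [hgS x hx hxs]
    exact (continuousOn_const.sub H.w_continuousOn).mul
      (H.V_cont.norm.mul hgη.norm.continuousOn)
  have key : ∀ ε : ℝ, 0 < ε → ∫ x in S, softStep ε (κ - ε - w x) * (η x * ⟪V x, Dw x⟫_ℝ)
      ≤ ∫ x in S, (κ - w x) * (‖V x‖ * ‖gradient η x‖) := by
    intro ε hε
    have hcw : ContinuousOn (fun x => κ - ε - w x) {x | x ≠ 0 ∧ ‖x‖ < r} :=
      continuousOn_const.sub H.w_continuousOn
    set φ : EuclideanSpace ℝ (Fin (m + 2)) → ℝ := fun x => softPos ε (κ - ε - w x) * η x with hφ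
    have hφz : ∀ x, b < ‖x‖ → φ x = 0 := fun x hx => by
      by_cases hwx : w x < κ
      · simp [hφ, hηb x hx hwx]
      · simp [hφ, softPos_of_le hε (by linarith : κ - ε - w x ≤ -ε)]
    have hφa : ∀ x, ‖x‖ < a → φ =ᶠ[𝓝 x] fun _ => (0 : ℝ) := fun x hx => by
      filter_upwards [continuous_norm.continuousAt.eventually_lt continuousAt_const hx] with y hy
      simp [hφ, hηa y hy.le]
    have hφb : ∀ x, r ≤ ‖x‖ → φ =ᶠ[𝓝 x] 0 := fun x hx => by
      filter_upwards [continuousAt_const.eventually_lt continuous_norm.continuousAt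
        (hb.trans_le hx)] with y hy
      exact hφz y hy
    obtain ⟨h1, h2, h3⟩ := admissible_of_eventuallyEq (r := r) (φ := φ) (fun x hx => by
      rcases lt_or_ge ‖x‖ a with h | h
      · exact contDiffAt_const.congr_of_eventuallyEq (hφa x h)
      · have hx0 := norm_pos_iff.1 (ha.trans_le h)
        refine ContDiffAt.mul ?_ hη.contDiffAt
        exact (contDiff_softPos ε).contDiffAt.comp x
          (contDiffAt_const.sub (H.w_contDiffAt x hx0 hx))) hφb
    have hgrad : ∀ x, ⟪V x, gradient φ x⟫_ℝ = softPos ε (κ - ε - w x) * ⟪V x, gradient η x⟫_ℝ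
        - softStep ε (κ - ε - w x) * (η x * ⟪V x, Dw x⟫_ℝ) := by
      intro x
      by_cases hU : x ≠ 0 ∧ ‖x‖ < r
      · have h2 := (H.hasGradientAt_softPos_sub ε (κ - ε) hU).fun_mul
          ((hη.differentiable (by norm_num)) x).hasGradientAt
        rw [h2.gradient, inner_add_right, real_inner_smul_right, real_inner_smul_right,
          real_inner_smul_right, inner_neg_right]
        ring
      · simp [H.V_zero hU]
    have hnn : 0 ≤ ∫ x, ⟪V x, gradient φ x⟫_ℝ := by
      rw [H.weak φ h1 h2 h3]
      exact integral_nonneg fun x => mul_nonneg (H.f_nonneg x)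
        (mul_nonneg (softPos_nonneg hε) (hη0 x))
    rw [← setIntegral_eq_integral_of_forall_compl_eq_zero (s := S) (fun x hx => by
      have hwx : κ ≤ w x := not_lt.1 hx
      rw [hgrad, softPos_of_le hε (by linarith), softStep_of_le hε (by linarith)]
      ring)] at hnn
    simp only [hgrad] at hnn
    have hI1 : IntegrableOn (fun x => softPos ε (κ - ε - w x) * ⟪V x, gradient η x⟫_ℝ) S := by
      refine ContinuousOn.integrableOn_of_eq_zero (r := r) ?_ ha hb hS fun x hx hxs => by
        simp [hgS x hx hxs]
      exact ((contDiff_softPos ε).continuous.comp_continuousOn hcw).mul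
        (H.V_cont.inner hgη.continuousOn)
    have hI2 : IntegrableOn (fun x => softStep ε (κ - ε - w x) * (η x * ⟪V x, Dw x⟫_ℝ)) S := by
      refine ContinuousOn.integrableOn_of_eq_zero (r := r) ?_ ha hb hS fun x hx hxs => by
        simp [hηS x hx hxs]
      exact ((continuous_softStep ε).comp_continuousOn hcw).mul hcE
    rw [integral_sub hI1 hI2, sub_nonneg] at hnn
    refine hnn.trans (setIntegral_mono_on hI1 hIR hS fun x hx => ?_)
    have hwx : w x < κ := hx
    have h4 : softPos ε (κ - ε - w x) ≤ κ - w x :=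
      (softPos_le_add hε (by linarith)).trans (by linarith)
    rcases le_or_gt 0 ⟪V x, gradient η x⟫_ℝ with h0 | h0
    · exact mul_le_mul h4 (real_inner_le_norm _ _) h0 (by linarith)
    · exact (mul_nonpos_of_nonneg_of_nonpos (softPos_nonneg hε) h0.le).trans
        (mul_nonneg (by linarith) (by positivity))
  have hlim : Tendsto (fun j : ℕ => ∫ x in S, softStep (1 / ((j : ℝ) + 1))
      (κ - 1 / ((j : ℝ) + 1) - w x) * (η x * ⟪V x, Dw x⟫_ℝ)) atTop
      (𝓝 (∫ x in S, η x * ⟪V x, Dw x⟫_ℝ)) := by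
    have hε : ∀ j : ℕ, 0 < 1 / ((j : ℝ) + 1) := fun j => by positivity
    refine tendsto_integral_of_dominated_convergence (fun x => η x * ⟪V x, Dw x⟫_ℝ)
      (fun j => ?_) hIE (fun j => Eventually.of_forall fun x => ?_) ?_
    · refine AEStronglyMeasurable.mul ?_ hIE.aestronglyMeasurable
      exact ((continuous_softStep _).measurable.comp
        (measurable_const.sub H.w_meas)).aestronglyMeasurable
    · have h0 : 0 ≤ η x * ⟪V x, Dw x⟫_ℝ := mul_nonneg (hη0 x) (H.inner_nonneg x)
      rw [norm_of_nonneg (mul_nonneg (softStep_nonneg (hε j)) h0)]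
      exact mul_le_of_le_one_left h0 (softStep_le_one (hε j))
    · filter_upwards [ae_restrict_mem hS] with x hx
      have hwx : w x < κ := hx
      refine tendsto_const_nhds.congr' ?_
      filter_upwards [(tendsto_one_div_add_atTop_nhds_zero_nat (𝕜 := ℝ)).eventually_lt_const
        (sub_pos.2 hwx)] with j hj
      rw [softStep_of_nonneg (hε j) (by linarith), one_mul]
  exact le_of_tendsto' hlim fun j => key _ (by positivity)

end FluxComparison

theorem mul_pow_succ_le_rpow {b x q : ℝ} {m : ℕ} (hb : 0 < b) (hx : 0 ≤ x) (hq : (m : ℝ) + 1 < q) :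
    b * x ^ (m + 1) ≤ b ^ ((m : ℝ) + 2 - q) * x ^ q + b ^ (m + 2) := by
  rcases le_or_gt x b with h | h
  · have : b * x ^ (m + 1) ≤ b * b ^ (m + 1) := by gcongr
    have h2 : 0 ≤ b ^ ((m : ℝ) + 2 - q) * x ^ q := by positivity
    calc b * x ^ (m + 1) ≤ b * b ^ (m + 1) := this
      _ = b ^ (m + 2) := by ring
      _ ≤ _ := by linarith
  · have hx0 := hb.trans h
    have h1 : b * x ^ (m + 1) = b ^ ((m : ℝ) + 2 - q) * (b ^ (q - (m + 1)) * x ^ (m + 1)) := by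
      rw [← mul_assoc, ← Real.rpow_add hb]
      norm_num
    have h2 : b ^ (q - (m + 1)) * x ^ (m + 1) ≤ x ^ q := by
      calc b ^ (q - (m + 1)) * x ^ (m + 1) ≤ x ^ (q - (m + 1)) * x ^ (m + 1) := by
            gcongr
        _ = x ^ q := by
            rw [← Real.rpow_natCast x (m + 1), ← Real.rpow_add hx0]
            push_cast; congr 1; ring
    rw [h1]
    have h3 : 0 ≤ b ^ (m + 2) := by positivity
    have := mul_le_mul_of_nonneg_left h2 (by positivity : 0 ≤ b ^ ((m : ℝ) + 2 - q))
    linarith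

/-- The volume of a shell scales like the `n`-th power of the radius. -/
theorem volume_shell_le {n : ℕ} {L : ℝ} (hL : 0 ≤ L) : ∃ v : ℝ, 0 ≤ v ∧ ∀ ρ : ℝ, 0 < ρ →
    ∀ T ⊆ (shell ρ (L * ρ) : Set (EuclideanSpace ℝ (Fin n))),
      (4 / ρ) ^ n * volume.real T ≤ v := by
  refine ⟨4 ^ n * L ^ n * volume.real (ball (0 : EuclideanSpace ℝ (Fin n)) 1), by positivity,
    fun ρ hρ T hT => ?_⟩
  have h1 : volume.real T ≤ volume.real (closedBall (0 : EuclideanSpace ℝ (Fin n)) (L * ρ)) :=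
    measureReal_mono (fun x hx => mem_closedBall_zero_iff.2 (hT hx).2)
      (isCompact_closedBall _ _).measure_lt_top.ne
  rw [Measure.addHaar_real_closedBall _ _ (by positivity), finrank_euclideanSpace_fin] at h1
  calc (4 / ρ) ^ n * volume.real T
      ≤ (4 / ρ) ^ n * ((L * ρ) ^ n * volume.real (ball (0 : EuclideanSpace ℝ (Fin n)) 1)) := by
        gcongr
    _ = _ := by
        rw [div_pow, mul_pow]
        field_simp

namespace FluxComparison
variable {m : ℕ} {r d : ℝ} {w f : EuclideanSpace ℝ (Fin (m + 2)) → ℝ}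
  {Dh Dw V : EuclideanSpace ℝ (Fin (m + 2)) → EuclideanSpace ℝ (Fin (m + 2))}

theorem setIntegral_norm_flux_le (H : FluxComparison r d w f Dh Dw V) {L : ℝ} (hL : 1 < L) :
    ∃ B : ℝ, 0 < B ∧ ∀ (ρ l : ℝ) (T : Set (EuclideanSpace ℝ (Fin (m + 2)))), 0 < ρ →
      2 * L * ρ < r → 0 < l → MeasurableSet T → T ⊆ shell ρ (L * ρ) →
      ∫ x in T, 4 / ρ * ‖V x‖ ≤ B * ((l⁻¹ ^ (m + 1) + l⁻¹) * (∫ x in T, ‖Dw x‖ ^ (m + 2))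
        + (l + l ^ (m + 1))) := by
  obtain ⟨C, hC, hDh⟩ := H.Dh_bound L hL
  obtain ⟨v, hv, hvol⟩ := volume_shell_le (n := m + 2) (L := L) (by linarith)
  refine ⟨(m + 1) * 2 ^ m * (1 + C + v), by positivity, fun ρ l T hρ hρr hl hT hTs => ?_⟩
  have hρr' : L * ρ < r := by nlinarith
  have hIw : IntegrableOn (fun x => ‖Dw x‖ ^ (m + 2)) T :=
    (ContinuousOn.integrableOn_shell (H.Dw_cont.norm.pow _) hρ hρr').mono_set hTs
  have hIh0 : IntegrableOn (fun x => ‖Dh x‖ ^ (m + 2)) (shell ρ (L * ρ)) :=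
    ContinuousOn.integrableOn_shell (H.Dh_cont.norm.pow _) hρ hρr'
  have hIh := hIh0.mono_set hTs
  have hIV : IntegrableOn (fun x => 4 / ρ * ‖V x‖) T := (H.V_int.norm.const_mul _).integrableOn
  have hTfin : volume T ≠ ⊤ := ((measure_mono hTs).trans_lt (isCompact_shell _ _).measure_lt_top).ne
  have hIc : IntegrableOn (fun _ => (4 / ρ) ^ (m + 2)) T := integrableOn_const hTfin
  have hpt : ∀ x, 4 / ρ * ‖V x‖ ≤ (m + 1) * 2 ^ m * ((l⁻¹ ^ (m + 1) + l⁻¹) * ‖Dw x‖ ^ (m + 2)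
      + (l + l ^ (m + 1)) * (‖Dh x‖ ^ (m + 2) + (4 / ρ) ^ (m + 2))) := fun x => by
    have h1 := young_flux m (norm_nonneg (Dw x)) (norm_nonneg (Dh x))
      (by positivity : 0 ≤ 4 / ρ) hl
    calc 4 / ρ * ‖V x‖ ≤ 4 / ρ * ((m + 1) * ((‖Dh x‖ + ‖Dw x‖) ^ m * ‖Dw x‖)) := by
          gcongr; exact H.growth x
      _ = (m + 1) * (4 / ρ * ((‖Dh x‖ + ‖Dw x‖) ^ m * ‖Dw x‖)) := by ring
      _ ≤ (m + 1) * _ := mul_le_mul_of_nonneg_left h1 (by positivity)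
      _ = _ := by ring
  have hIs : IntegrableOn (fun x => ‖Dh x‖ ^ (m + 2) + (4 / ρ) ^ (m + 2)) T := hIh.add hIc
  refine (setIntegral_mono hIV (((hIw.const_mul _).add (hIs.const_mul _)).const_mul _) hpt).trans ?_
  rw [integral_const_mul, integral_add' (hIw.const_mul _) (hIs.const_mul _),
    integral_const_mul, integral_const_mul, integral_add hIh hIc, setIntegral_const, smul_eq_mul]
  have h2 : ∫ x in T, ‖Dh x‖ ^ (m + 2) ≤ C := le_trans (setIntegral_mono_set hIh0
    (Eventually.of_forall fun x => by positivity) hTs.eventuallyLE) (hDh ρ hρ hρr)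
  have h3 := hvol ρ hρ T hTs
  have hY : 0 ≤ ∫ x in T, ‖Dw x‖ ^ (m + 2) := integral_nonneg fun x => by positivity
  generalize ∫ x in T, ‖Dw x‖ ^ (m + 2) = Y at hY
  generalize ∫ x in T, ‖Dh x‖ ^ (m + 2) = Z at h2
  have h4 : Z + volume.real T * (4 / ρ) ^ (m + 2) ≤ 1 + C + v := by linarith
  rw [mul_assoc _ (1 + C + v)]
  refine mul_le_mul_of_nonneg_left ?_ (by positivity)
  rw [mul_add (1 + C + v)]
  refine add_le_add (le_mul_of_one_le_left (by positivity) (by linarith)) ?_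
  rw [mul_comm (1 + C + v)]
  exact mul_le_mul_of_nonneg_left h4 (by positivity)

theorem setIntegral_norm_flux_le_rpow (H : FluxComparison r d w f Dh Dw V) {L q : ℝ} (hL : 1 < L)
    (hq : (m : ℝ) + 1 < q) (hqN : q < m + 2) :
    ∃ B : ℝ, 0 < B ∧ ∀ (ρ : ℝ) (T : Set (EuclideanSpace ℝ (Fin (m + 2)))), 0 < ρ → ρ ≤ 1 →
      2 * L * ρ < r → MeasurableSet T → T ⊆ shell ρ (L * ρ) →
      ∫ x in T, 4 / ρ * ‖V x‖ ≤ B * ρ ^ (q - (m + 2)) := by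
  obtain ⟨C, hC, hDh⟩ := H.Dh_bound L hL
  obtain ⟨v, hv, hvol⟩ := volume_shell_le (n := m + 2) (L := L) (by linarith)
  have hm0 : (0 : ℝ) ≤ m := Nat.cast_nonneg m
  have hI := H.Dw_int q (by linarith) hqN
  obtain ⟨I, hIdef⟩ : ∃ I, I = ∫ x, ‖Dw x‖ ^ q := ⟨_, rfl⟩
  have hI0 : 0 ≤ I := hIdef ▸ integral_nonneg fun x => by positivity
  refine ⟨(m + 1) * 2 ^ m * (1 + C + 2 * v + 4 ^ ((m : ℝ) + 2 - q) * I), by positivity,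
    fun ρ T hρ hρ1 hρr hT hTs => ?_⟩
  have hρr' : L * ρ < r := by nlinarith
  have hIh0 : IntegrableOn (fun x => ‖Dh x‖ ^ (m + 2)) (shell ρ (L * ρ)) :=
    ContinuousOn.integrableOn_shell (H.Dh_cont.norm.pow _) hρ hρr'
  have hIh := hIh0.mono_set hTs
  have hIV : IntegrableOn (fun x => 4 / ρ * ‖V x‖) T := (H.V_int.norm.const_mul _).integrableOn
  have hTfin : volume T ≠ ⊤ := ((measure_mono hTs).trans_lt (isCompact_shell _ _).measure_lt_top).ne
  have hIc : IntegrableOn (fun _ => 2 * (4 / ρ) ^ (m + 2)) T := integrableOn_const hTfin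
  have hpt : ∀ x, 4 / ρ * ‖V x‖ ≤ (m + 1) * 2 ^ m * ((4 / ρ) ^ ((m : ℝ) + 2 - q) * ‖Dw x‖ ^ q
      + (‖Dh x‖ ^ (m + 2) + 2 * (4 / ρ) ^ (m + 2))) := fun x => by
    obtain ⟨b, hb, hb0⟩ : ∃ b, b = 4 / ρ ∧ 0 < b := ⟨_, rfl, by positivity⟩
    rw [← hb]
    have h1 := mul_pow_succ_le_rpow hb0 (norm_nonneg (Dw x)) hq
    have h2 : b * ‖Dh x‖ ^ (m + 1) ≤ ‖Dh x‖ ^ (m + 2) + b ^ (m + 2) := by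
      rcases le_total ‖Dh x‖ b with h | h
      · calc b * ‖Dh x‖ ^ (m + 1) ≤ b * b ^ (m + 1) := by gcongr
          _ = b ^ (m + 2) := by ring
          _ ≤ _ := le_add_of_nonneg_left (by positivity)
      · calc b * ‖Dh x‖ ^ (m + 1) ≤ ‖Dh x‖ * ‖Dh x‖ ^ (m + 1) := by gcongr
          _ = ‖Dh x‖ ^ (m + 2) := by ring
          _ ≤ _ := le_add_of_nonneg_right (by positivity)
    have h3 : (‖Dh x‖ + ‖Dw x‖) ^ m * ‖Dw x‖ ≤ 2 ^ m * (‖Dh x‖ ^ (m + 1) + ‖Dw x‖ ^ (m + 1)) :=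
      calc (‖Dh x‖ + ‖Dw x‖) ^ m * ‖Dw x‖ ≤ (‖Dh x‖ + ‖Dw x‖) ^ m * (‖Dh x‖ + ‖Dw x‖) := by
            gcongr; exact le_add_of_nonneg_left (norm_nonneg _)
        _ = (‖Dh x‖ + ‖Dw x‖) ^ (m + 1) := by ring
        _ ≤ _ := by simpa using add_pow_le (norm_nonneg (Dh x)) (norm_nonneg (Dw x)) (m + 1)
    calc b * ‖V x‖ ≤ b * ((m + 1) * (2 ^ m * (‖Dh x‖ ^ (m + 1) + ‖Dw x‖ ^ (m + 1)))) := by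
          gcongr
          exact (H.growth x).trans (mul_le_mul_of_nonneg_left h3 (by positivity))
      _ = (m + 1) * 2 ^ m * (b * ‖Dw x‖ ^ (m + 1) + b * ‖Dh x‖ ^ (m + 1)) := by ring
      _ ≤ _ := mul_le_mul_of_nonneg_left (by linarith) (by positivity)
  have hIs : IntegrableOn (fun x => ‖Dh x‖ ^ (m + 2) + 2 * (4 / ρ) ^ (m + 2)) T := hIh.add hIc
  refine (setIntegral_mono hIV (((hI.integrableOn.const_mul _).add hIs).const_mul _) hpt).trans ?_
  rw [integral_const_mul, integral_add' (hI.integrableOn.const_mul _) hIs,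
    integral_const_mul, integral_add hIh hIc, setIntegral_const, smul_eq_mul]
  have h2 : ∫ x in T, ‖Dh x‖ ^ (m + 2) ≤ C := le_trans (setIntegral_mono_set hIh0
    (Eventually.of_forall fun x => by positivity) hTs.eventuallyLE) (hDh ρ hρ hρr)
  have h3 := hvol ρ hρ T hTs
  have h4 : ∫ x in T, ‖Dw x‖ ^ q ≤ I := hIdef ▸ setIntegral_le_integral hI
    (Eventually.of_forall fun x => by positivity)
  have h5 : (4 / ρ) ^ ((m : ℝ) + 2 - q) = 4 ^ ((m : ℝ) + 2 - q) * ρ ^ (q - (m + 2)) := by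
    rw [Real.div_rpow (by norm_num) hρ.le, div_eq_mul_inv, ← Real.rpow_neg hρ.le, neg_sub]
  have h6 : 1 ≤ ρ ^ (q - (m + 2)) := Real.one_le_rpow_of_pos_of_le_one_of_nonpos hρ hρ1
    (by linarith)
  rw [h5, mul_assoc _ (1 + C + 2 * v + 4 ^ ((m : ℝ) + 2 - q) * I)]
  refine mul_le_mul_of_nonneg_left ?_ (by positivity)
  have h7 : 4 ^ ((m : ℝ) + 2 - q) * ρ ^ (q - (m + 2)) * (∫ x in T, ‖Dw x‖ ^ q)
      ≤ 4 ^ ((m : ℝ) + 2 - q) * ρ ^ (q - (m + 2)) * I := by gcongr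
  have h8 : C + 2 * v ≤ (1 + C + 2 * v) * ρ ^ (q - (m + 2)) := by nlinarith
  linarith

end FluxComparison

/-- The energy of the part of the sublevel set `{w < κ}` lying outside the ball of radius `ρ`. -/
noncomputable def sublevelEnergy {m : ℕ} (w : EuclideanSpace ℝ (Fin (m + 2)) → ℝ)
    (Dw V : EuclideanSpace ℝ (Fin (m + 2)) → EuclideanSpace ℝ (Fin (m + 2))) (κ ρ : ℝ) : ℝ :=
  ∫ x in {x | ρ ≤ ‖x‖ ∧ w x < κ}, ⟪V x, Dw x⟫_ℝ

namespace FluxComparison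
variable {m : ℕ} {r d : ℝ} {w f : EuclideanSpace ℝ (Fin (m + 2)) → ℝ}
  {Dh Dw V : EuclideanSpace ℝ (Fin (m + 2)) → EuclideanSpace ℝ (Fin (m + 2))}

theorem measurableSet_outer (H : FluxComparison r d w f Dh Dw V) (κ ρ : ℝ) :
    MeasurableSet {x | ρ ≤ ‖x‖ ∧ w x < κ} :=
  (measurableSet_le measurable_const measurable_norm).inter (H.measurableSet_lt κ)

theorem integrableOn_sublevel (H : FluxComparison r d w f Dh Dw V) {κ ρ : ℝ} (hκ : κ < 0)
    (hρ : 0 < ρ) : IntegrableOn (fun x => ⟪V x, Dw x⟫_ℝ) {x | ρ ≤ ‖x‖ ∧ w x < κ} := by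
  obtain ⟨b, hb, hbw⟩ := H.exists_radius_lt hκ
  refine (H.V_cont.inner H.Dw_cont).integrableOn_of_eq_zero hρ hb (H.measurableSet_outer κ ρ)
    fun x hx hxs => absurd ⟨hx.1, ?_⟩ hxs
  by_contra hlt
  exact lt_asymm hx.2 (hbw x (not_le.1 hlt))

theorem sublevelEnergy_nonneg (H : FluxComparison r d w f Dh Dw V) (κ ρ : ℝ) :
    0 ≤ sublevelEnergy w Dw V κ ρ := integral_nonneg fun x => H.inner_nonneg x

theorem sublevelEnergy_shell_add_le (H : FluxComparison r d w f Dh Dw V) {κ ρ σ τ : ℝ}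
    (hκ : κ < 0) (hρ : 0 < ρ) (hρσ : ρ ≤ σ) (hστ : σ < τ) :
    d * (∫ x in shell ρ σ ∩ {x | w x < κ}, ‖Dw x‖ ^ (m + 2)) + sublevelEnergy w Dw V κ τ
      ≤ sublevelEnergy w Dw V κ ρ := by
  have hI := H.integrableOn_sublevel hκ hρ
  have hs1 : shell ρ σ ∩ {x | w x < κ} ⊆ {x | ρ ≤ ‖x‖ ∧ w x < κ} := fun x hx => ⟨hx.1.1, hx.2⟩
  have hs2 : {x | τ ≤ ‖x‖ ∧ w x < κ} ⊆ {x | ρ ≤ ‖x‖ ∧ w x < κ} :=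
    fun x hx => ⟨(hρσ.trans hστ.le).trans hx.1, hx.2⟩
  have hI1 := hI.mono_set hs1
  have hm1 : MeasurableSet (shell ρ σ ∩ {x | w x < κ}) :=
    (measurableSet_shell _ _).inter (H.measurableSet_lt κ)
  have h1 : d * (∫ x in shell ρ σ ∩ {x | w x < κ}, ‖Dw x‖ ^ (m + 2))
      ≤ ∫ x in shell ρ σ ∩ {x | w x < κ}, ⟪V x, Dw x⟫_ℝ := by
    rw [← integral_const_mul]
    refine integral_mono_of_nonneg (Eventually.of_forall fun x => ?_) hI1
      (Eventually.of_forall H.coercive)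
    have := H.d_pos
    positivity
  have hd : Disjoint (shell ρ σ ∩ {x | w x < κ}) {x | τ ≤ ‖x‖ ∧ w x < κ} := by
    refine Set.disjoint_left.2 fun x hx hx' => ?_
    linarith [hx.1.2, hx'.1]
  calc _ ≤ (∫ x in shell ρ σ ∩ {x | w x < κ}, ⟪V x, Dw x⟫_ℝ) + sublevelEnergy w Dw V κ τ := by
        gcongr
    _ = ∫ x in (shell ρ σ ∩ {x | w x < κ}) ∪ {x | τ ≤ ‖x‖ ∧ w x < κ}, ⟪V x, Dw x⟫_ℝ :=
        (setIntegral_union hd (H.measurableSet_outer κ τ) hI1 (hI.mono_set hs2)).symm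
    _ ≤ _ := setIntegral_mono_set hI (Eventually.of_forall fun x => H.inner_nonneg x)
        (union_subset hs1 hs2).eventuallyLE

/-- The energy beyond radius `2 ρ` is controlled by the flux across the shell of radius `ρ`. -/
theorem sublevelEnergy_le_flux (H : FluxComparison r d w f Dh Dw V) {κ ρ M : ℝ}
    (hκ : κ < 0) (hρ : 0 < ρ) (hM0 : 0 ≤ M) (hM : ∀ x, ρ < ‖x‖ → κ - w x ≤ M) :
    sublevelEnergy w Dw V κ (2 * ρ)
      ≤ M * ∫ x in shell ρ (2 * ρ) ∩ {x | w x < κ}, 4 / ρ * ‖V x‖ := by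
  obtain ⟨b, hb, hbw⟩ := H.exists_radius_lt hκ
  have hS := H.measurableSet_lt κ
  have hηc : ContDiff ℝ 1 (cutoff ρ : EuclideanSpace ℝ (Fin (m + 2)) → ℝ) := contDiff_cutoff ρ
  have hE := H.setIntegral_sublevel_le (κ := κ) hρ hb hηc
    (fun x => cutoff_nonneg) (fun x hx => cutoff_of_le hρ hx)
    (fun x hx hwx => absurd hwx (lt_asymm (hbw x hx)))
  have hIe := H.integrableOn_sublevel hκ hρ
  have hsub : {x | 2 * ρ ≤ ‖x‖ ∧ w x < κ} ⊆ {x | w x < κ} := fun x hx => hx.2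
  have hIη : IntegrableOn (fun x => cutoff ρ x * ⟪V x, Dw x⟫_ℝ) {x | w x < κ} := by
    refine (hηc.continuous.continuousOn.mul (H.V_cont.inner H.Dw_cont)).integrableOn_of_eq_zero
      hρ hb hS fun x hx hxs => ?_
    refine mul_eq_zero_of_left (cutoff_of_le hρ ?_) _
    by_contra hlt
    refine hxs ⟨(not_le.1 hlt).le, ?_⟩
    by_contra hlt
    exact lt_asymm hx (hbw x (not_le.1 hlt))
  have h1 : sublevelEnergy w Dw V κ (2 * ρ) ≤ ∫ x in {x | w x < κ}, cutoff ρ x * ⟪V x, Dw x⟫_ℝ := by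
    calc sublevelEnergy w Dw V κ (2 * ρ)
        = ∫ x in {x | 2 * ρ ≤ ‖x‖ ∧ w x < κ}, cutoff ρ x * ⟪V x, Dw x⟫_ℝ := by
          refine setIntegral_congr_fun (H.measurableSet_outer κ _) fun x hx => ?_
          rw [cutoff_of_ge hρ hx.1, one_mul]
      _ ≤ _ := setIntegral_mono_set hIη (Eventually.of_forall fun x =>
          mul_nonneg cutoff_nonneg (H.inner_nonneg x)) hsub.eventuallyLE
  refine h1.trans (hE.trans ?_)
  rw [← integral_const_mul]
  have hT : MeasurableSet (shell ρ (2 * ρ) ∩ {x | w x < κ}) := (measurableSet_shell _ _).inter hS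
  have hz : ∀ x : EuclideanSpace ℝ (Fin (m + 2)), x ∉ shell ρ (2 * ρ) →
      gradient (cutoff ρ) x = 0 := fun x hx => by
    rcases le_or_gt ‖x‖ ρ with h | h
    · exact gradient_cutoff_of_le hρ h
    · exact gradient_cutoff_of_ge hρ (by by_contra hlt; exact hx ⟨h.le, (not_le.1 hlt).le⟩)
  rw [setIntegral_eq_of_subset_of_forall_sdiff_eq_zero hS
    (inter_subset_right (s := shell ρ (2 * ρ))) (fun x hx => by
      rw [hz x fun hxs => hx.2 ⟨hxs, hx.1⟩]
      simp)]
  have hIV : IntegrableOn (fun x => M * (4 / ρ * ‖V x‖)) (shell ρ (2 * ρ) ∩ {x | w x < κ}) :=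
    ((H.V_int.norm.const_mul _).const_mul _).integrableOn
  refine integral_mono_of_nonneg ?_ hIV ?_
  · filter_upwards [ae_restrict_mem hT] with x hx
    have : w x < κ := hx.2
    exact mul_nonneg (by linarith) (by positivity)
  · filter_upwards [ae_restrict_mem hT] with x hx
    have hwx : w x < κ := hx.2
    rcases hx.1.1.eq_or_lt with h | h
    · rw [gradient_cutoff_of_le hρ h.ge, norm_zero, mul_zero, mul_zero]
      positivity
    · calc (κ - w x) * (‖V x‖ * ‖gradient (cutoff ρ) x‖) ≤ M * (‖V x‖ * (4 / ρ)) := by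
            refine mul_le_mul (hM x h) ?_ (by positivity) hM0
            gcongr
            exact norm_gradient_cutoff_le hρ
        _ = _ := by ring

end FluxComparison

namespace FluxComparison
variable {m : ℕ} {r d : ℝ} {w f : EuclideanSpace ℝ (Fin (m + 2)) → ℝ}
  {Dh Dw V : EuclideanSpace ℝ (Fin (m + 2)) → EuclideanSpace ℝ (Fin (m + 2))}

theorem sublevelEnergy_anti (H : FluxComparison r d w f Dh Dw V) {κ ρ τ : ℝ}
    (hκ : κ < 0) (hρ : 0 < ρ) (hρτ : ρ < τ) :
    sublevelEnergy w Dw V κ τ ≤ sublevelEnergy w Dw V κ ρ := by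
  have h := H.sublevelEnergy_shell_add_le hκ hρ le_rfl hρτ
  have h2 : 0 ≤ d * (∫ x in shell ρ ρ ∩ {x | w x < κ}, ‖Dw x‖ ^ (m + 2)) :=
    mul_nonneg H.d_pos.le (integral_nonneg fun x => by positivity)
  linarith

theorem exists_sublevelEnergy_growth (H : FluxComparison r d w f Dh Dw V) {κ E₀ : ℝ}
    (hκ : κ < 0) (hE₀ : 0 < E₀) :
    ∃ c : ℝ, 0 < c ∧ ∀ ρ : ℝ, 0 < ρ → 8 * (m + 2) * ρ < r →
      E₀ ≤ sublevelEnergy w Dw V κ (8 * (m + 2) * ρ) →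
      (1 + c) * sublevelEnergy w Dw V κ (8 * (m + 2) * ρ) ≤ sublevelEnergy w Dw V κ ρ := by
  have hm0 : (0 : ℝ) ≤ m := Nat.cast_nonneg m
  have hd := H.d_pos
  obtain ⟨C, hC, hMB⟩ := H.sub_le_of_shell (q := ((m + 2 : ℕ) : ℝ)) (by push_cast; linarith)
  obtain ⟨B, hB, hfl⟩ := H.setIntegral_norm_flux_le (L := 2) (by norm_num)
  obtain ⟨K, hKdef⟩ : ∃ K, K = C * B := ⟨_, rfl⟩
  have hK : 0 < K := hKdef ▸ by positivity
  obtain ⟨t₀, ht₀, ht₀1, ht₀E⟩ : ∃ t : ℝ, 0 < t ∧ t ≤ 1 ∧ 8 * K * t < E₀ := by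
    refine ⟨min 1 (E₀ / (16 * K)), by positivity, min_le_left _ _, ?_⟩
    calc 8 * K * min 1 (E₀ / (16 * K)) ≤ 8 * K * (E₀ / (16 * K)) := by
          gcongr; exact min_le_right _ _
      _ = E₀ / 2 := by field_simp; norm_num
      _ < E₀ := by linarith
  have hKK : 0 < 4 * K * (1 + (t₀ ^ m)⁻¹) := by positivity
  refine ⟨d / (4 * K * (1 + (t₀ ^ m)⁻¹)), by positivity, fun ρ hρ hρr hE => ?_⟩
  obtain ⟨Y, hY⟩ : ∃ Y, Y = ∫ x in shell ρ (4 * (m + 2) * ρ) ∩ {x | w x < κ},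
    ‖Dw x‖ ^ (m + 2) := ⟨_, rfl⟩
  have hρ' : 0 < 2 * (m + 2) * ρ := by positivity
  have hIY : IntegrableOn (fun x => ‖Dw x‖ ^ (m + 2))
      (shell ρ (4 * (m + 2) * ρ) ∩ {x | w x < κ}) :=
    (ContinuousOn.integrableOn_shell (H.Dw_cont.norm.pow _) hρ (by nlinarith)).mono_set
      inter_subset_left
  have hYle : ∀ a b : ℝ, ρ ≤ a → b ≤ 4 * (m + 2) * ρ →
      ∫ x in shell a b ∩ {x | w x < κ}, ‖Dw x‖ ^ (m + 2) ≤ Y := fun a b ha hb => by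
    rw [hY]
    exact setIntegral_mono_set hIY (Eventually.of_forall fun x => by positivity)
      (inter_subset_inter_left _ (shell_mono ha hb)).eventuallyLE
  have key : ∀ t : ℝ, 0 < t → Y ≤ t ^ (m + 2) →
      sublevelEnergy w Dw V κ (8 * (m + 2) * ρ) ≤ 4 * K * (t * (t + t ^ (m + 1))) := by
    intro t ht hYt
    have h1 : ∀ x, 2 * (m + 2) * ρ < ‖x‖ → κ - w x ≤ C * (2 * t) := fun x hx => by
      refine (hMB κ t ρ hκ ht hρ (by nlinarith) x hx).trans ?_
      refine mul_le_mul_of_nonneg_left ?_ hC.le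
      have h2 : t ^ (1 - ((m + 2 : ℕ) : ℝ)) * t ^ (m + 2) = t := by
        rw [← Real.rpow_natCast t (m + 2), ← Real.rpow_add ht]; simp
      have h3 : ρ ^ (((m + 2 : ℕ) : ℝ) - (m + 2)) = 1 := by push_cast; simp
      simp only [Real.rpow_natCast]
      have h4 : ∫ x in shell ρ (2 * (m + 2) * ρ) ∩ {x | w x < κ}, ‖Dw x‖ ^ (m + 2)
          ≤ t ^ (m + 2) := (hYle ρ _ le_rfl (by nlinarith)).trans hYt
      rw [h3, mul_one]
      have h5 := mul_le_mul_of_nonneg_left h4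
        (Real.rpow_nonneg ht.le (1 - ((m + 2 : ℕ) : ℝ)))
      rw [h2] at h5
      linarith
    have h2 := H.sublevelEnergy_le_flux hκ hρ' (by positivity) h1
    have h3 := hfl (2 * (m + 2) * ρ) t (shell (2 * (m + 2) * ρ) (2 * (2 * (m + 2) * ρ))
      ∩ {x | w x < κ}) hρ' (by linarith) ht
      ((measurableSet_shell _ _).inter (H.measurableSet_lt κ)) inter_subset_left
    have h4 := (hYle (2 * (m + 2) * ρ) (2 * (2 * (m + 2) * ρ)) (by nlinarith)
      (by linarith)).trans hYt
    have h5 : (t⁻¹ ^ (m + 1) + t⁻¹) * t ^ (m + 2) = t + t ^ (m + 1) := by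
      rw [inv_pow]; field_simp; ring
    calc sublevelEnergy w Dw V κ (8 * (m + 2) * ρ)
        ≤ sublevelEnergy w Dw V κ (2 * (2 * (m + 2) * ρ)) :=
          H.sublevelEnergy_anti hκ (by positivity) (by nlinarith)
      _ ≤ C * (2 * t) * (B * ((t⁻¹ ^ (m + 1) + t⁻¹) * t ^ (m + 2) + (t + t ^ (m + 1)))) := by
          refine h2.trans (mul_le_mul_of_nonneg_left (h3.trans ?_) (by positivity))
          gcongr
      _ = 4 * K * (t * (t + t ^ (m + 1))) := by rw [h5, hKdef]; ring
  have hYt₀ : t₀ ^ (m + 2) < Y := by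
    by_contra hle
    have h1 := key t₀ ht₀ (not_lt.1 hle)
    have h2 : t₀ ^ (m + 1) ≤ 1 := pow_le_one₀ ht₀.le ht₀1
    have h3 : 4 * K * (t₀ * (t₀ + t₀ ^ (m + 1))) ≤ 4 * K * (t₀ * (1 + 1)) := by gcongr
    linarith
  have hY0 : 0 < Y := (by positivity : 0 < t₀ ^ (m + 2)).trans hYt₀
  obtain ⟨t, ht, htY⟩ : ∃ t : ℝ, 0 < t ∧ t ^ (m + 2) = Y :=
    ⟨Y ^ ((m + 2 : ℕ) : ℝ)⁻¹, by positivity, Real.rpow_inv_natCast_pow hY0.le (by omega)⟩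
  have htt₀ : t₀ ≤ t := (lt_of_pow_lt_pow_left₀ (m + 2) ht.le (htY ▸ hYt₀)).le
  have hkey := key t ht htY.ge
  have h1 : t * (t + t ^ (m + 1)) ≤ (1 + (t₀ ^ m)⁻¹) * Y := by
    have h2 : t ^ 2 ≤ (t₀ ^ m)⁻¹ * t ^ (m + 2) := by
      rw [← div_eq_inv_mul, le_div_iff₀ (by positivity)]
      calc t ^ 2 * t₀ ^ m ≤ t ^ 2 * t ^ m := by gcongr
        _ = t ^ (m + 2) := by ring
    rw [← htY]
    calc t * (t + t ^ (m + 1)) = t ^ 2 + t ^ (m + 2) := by ring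
      _ ≤ _ := by linarith
  have h2 := H.sublevelEnergy_shell_add_le hκ hρ (σ := 4 * (m + 2) * ρ)
    (τ := 8 * (m + 2) * ρ) (by nlinarith) (by nlinarith)
  rw [← hY] at h2
  have h3 : d / (4 * K * (1 + (t₀ ^ m)⁻¹)) * sublevelEnergy w Dw V κ (8 * (m + 2) * ρ) ≤ d * Y := by
    rw [div_mul_eq_mul_div, div_le_iff₀ hKK]
    calc d * sublevelEnergy w Dw V κ (8 * (m + 2) * ρ)
        ≤ d * (4 * K * ((1 + (t₀ ^ m)⁻¹) * Y)) := by
          refine mul_le_mul_of_nonneg_left (hkey.trans ?_) hd.le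
          gcongr
      _ = _ := by ring
  linarith

theorem exists_sublevelEnergy_le_rpow (H : FluxComparison r d w f Dh Dw V) {κ q : ℝ} (hκ : κ < 0)
    (hq : (m : ℝ) + 1 < q) (hqN : q < m + 2) :
    ∃ C : ℝ, ∀ ρ : ℝ, 0 < ρ → 8 * (m + 2) * ρ < r → 8 * (m + 2) * ρ ≤ 1 →
      sublevelEnergy w Dw V κ (8 * (m + 2) * ρ) ≤ C * (ρ ^ (q - (m + 2))) ^ 2 := by
  have hm0 : (0 : ℝ) ≤ m := Nat.cast_nonneg m
  obtain ⟨C, hC, hMB⟩ := H.sub_le_of_shell hq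
  obtain ⟨B, hB, hfl⟩ := H.setIntegral_norm_flux_le_rpow (L := 2) (by norm_num) hq hqN
  have hI := H.Dw_int q (by linarith) hqN
  obtain ⟨I, hIdef⟩ : ∃ I, I = ∫ x, ‖Dw x‖ ^ q := ⟨_, rfl⟩
  have hI0 : 0 ≤ I := hIdef ▸ integral_nonneg fun x => by positivity
  refine ⟨C * (I + 1) * B, fun ρ hρ hρr hρ1 => ?_⟩
  have hρ' : 0 < 2 * (m + 2) * ρ := by positivity
  have hρ1' : ρ ≤ 1 := by nlinarith
  obtain ⟨s, hs⟩ : ∃ s, s = ρ ^ (q - (m + 2)) := ⟨_, rfl⟩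
  have hs1 : 1 ≤ s := hs ▸ Real.one_le_rpow_of_pos_of_le_one_of_nonpos hρ hρ1' (by linarith)
  have h1 : ∀ x, 2 * (m + 2) * ρ < ‖x‖ → κ - w x ≤ C * (I + 1) * s := fun x hx => by
    refine (hMB κ 1 ρ hκ one_pos hρ (by nlinarith) x hx).trans ?_
    rw [mul_assoc C]
    refine mul_le_mul_of_nonneg_left ?_ hC.le
    have h4 : ∫ x in shell ρ (2 * (m + 2) * ρ) ∩ {x | w x < κ}, ‖Dw x‖ ^ q ≤ I :=
      hIdef ▸ setIntegral_le_integral hI (Eventually.of_forall fun x => by positivity)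
    rw [Real.one_rpow, one_mul, ← hs]
    nlinarith
  have h2 := H.sublevelEnergy_le_flux hκ hρ' (by positivity) h1
  have h3 := hfl (2 * (m + 2) * ρ) (shell (2 * (m + 2) * ρ) (2 * (2 * (m + 2) * ρ))
    ∩ {x | w x < κ}) hρ' (by linarith) (by linarith)
    ((measurableSet_shell _ _).inter (H.measurableSet_lt κ)) inter_subset_left
  have h4 : (2 * (m + 2) * ρ) ^ (q - (m + 2)) ≤ s := by
    rw [hs]
    exact Real.rpow_le_rpow_of_nonpos hρ (by nlinarith) (by linarith)
  rw [← hs]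
  calc sublevelEnergy w Dw V κ (8 * (m + 2) * ρ)
      ≤ sublevelEnergy w Dw V κ (2 * (2 * (m + 2) * ρ)) :=
        H.sublevelEnergy_anti hκ (by positivity) (by nlinarith)
    _ ≤ C * (I + 1) * s * (B * s) := by
        refine h2.trans (mul_le_mul_of_nonneg_left (h3.trans ?_) (by positivity))
        gcongr
    _ = _ := by ring

theorem sublevelEnergy_pos (H : FluxComparison r d w f Dh Dw V) {κ ρ : ℝ} (hκ : κ < 0)
    (hρ : 0 < ρ) (hρr : 2 * (m + 2) * ρ < r) {x₀ : EuclideanSpace ℝ (Fin (m + 2))}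
    (hx₀ : 2 * (m + 2) * ρ < ‖x₀‖) (hw : w x₀ < κ) : 0 < sublevelEnergy w Dw V κ ρ := by
  have hm0 : (0 : ℝ) ≤ m := Nat.cast_nonneg m
  obtain ⟨C, hC, hMB⟩ := H.sub_le_of_shell (q := ((m + 2 : ℕ) : ℝ)) (by push_cast; linarith)
  refine (H.sublevelEnergy_nonneg κ ρ).lt_of_ne' fun h0 => ?_
  have h1 := H.sublevelEnergy_shell_add_le hκ hρ (σ := 2 * (m + 2) * ρ)
    (τ := 3 * (m + 2) * ρ) (by nlinarith) (by nlinarith)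
  rw [h0] at h1
  have h2 := H.sublevelEnergy_nonneg κ (3 * (m + 2) * ρ)
  have h3 : 0 ≤ ∫ x in shell ρ (2 * (m + 2) * ρ) ∩ {x | w x < κ}, ‖Dw x‖ ^ (m + 2) :=
    integral_nonneg fun x => by positivity
  have h4 : ∫ x in shell ρ (2 * (m + 2) * ρ) ∩ {x | w x < κ}, ‖Dw x‖ ^ (m + 2) = 0 := by
    nlinarith [H.d_pos]
  have h5 := hMB κ ((κ - w x₀) / (2 * C)) ρ hκ (div_pos (by linarith) (by positivity)) hρ hρr x₀ hx₀
  simp only [Real.rpow_natCast] at h5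
  rw [h4, mul_zero, zero_add] at h5
  have h6 : C * ((κ - w x₀) / (2 * C)) = (κ - w x₀) / 2 := by field_simp
  linarith

theorem w_nonneg (H : FluxComparison r d w f Dh Dw V) {x : EuclideanSpace ℝ (Fin (m + 2))}
    (hx : x ≠ 0) : 0 ≤ w x := by
  by_contra hneg
  rw [not_le] at hneg
  have hr := H.r_pos
  obtain ⟨κ, hκ, hwκ⟩ := exists_between hneg
  obtain ⟨Λ, hΛ⟩ : ∃ Λ : ℝ, Λ = 8 * (m + 2) := ⟨_, rfl⟩
  have hm0 : (0 : ℝ) ≤ m := Nat.cast_nonneg m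
  have hΛ1 : 1 < Λ := by rw [hΛ]; linarith
  have hΛ0 : 0 < Λ := by linarith
  have hx0 := norm_pos_iff.2 hx
  obtain ⟨ρ₀, hρ₀, hρ₀m⟩ : ∃ ρ : ℝ, 0 < ρ ∧ Λ * ρ < min (min ‖x‖ r) 1 := by
    refine ⟨min (min ‖x‖ r) 1 / (2 * Λ), by positivity, ?_⟩
    have : 0 < min (min ‖x‖ r) 1 := by positivity
    calc Λ * (min (min ‖x‖ r) 1 / (2 * Λ)) = min (min ‖x‖ r) 1 / 2 := by field_simp
      _ < _ := by linarith
  obtain ⟨⟨hρx, hρr⟩, hρ1⟩ : (Λ * ρ₀ < ‖x‖ ∧ Λ * ρ₀ < r) ∧ Λ * ρ₀ < 1 := by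
    simpa only [lt_min_iff] using hρ₀m
  have h2N : 2 * (m + 2) * ρ₀ ≤ Λ * ρ₀ := by rw [hΛ]; nlinarith
  obtain ⟨E₀, hE₀⟩ : ∃ E, E = sublevelEnergy w Dw V κ ρ₀ := ⟨_, rfl⟩
  have hE₀pos : 0 < E₀ := hE₀ ▸ H.sublevelEnergy_pos hwκ hρ₀ (h2N.trans_lt hρr)
    (h2N.trans_lt hρx) hκ
  obtain ⟨c, hc, hgrow⟩ := H.exists_sublevelEnergy_growth hwκ hE₀pos
  rw [← hΛ] at hgrow
  obtain ⟨δ, hδ, hδ1, hδΛ⟩ : ∃ δ : ℝ, 0 < δ ∧ δ < 1 ∧ (Λ ^ δ) ^ 2 < 1 + c := by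
    have ht : Tendsto (fun δ : ℝ => (Λ ^ δ) ^ 2) (𝓝[>] 0) (𝓝 1) := by
      have h1 : ContinuousAt (fun δ : ℝ => (Λ ^ δ) ^ 2) 0 :=
        (Real.continuousAt_const_rpow hΛ0.ne').pow 2
      have h2 := h1.tendsto
      simp only [Real.rpow_zero, one_pow] at h2
      exact h2.mono_left nhdsWithin_le_nhds
    obtain ⟨δ, h1, h2, h3⟩ := ((ht.eventually_lt_const (by linarith : (1 : ℝ) < 1 + c)).and
      (Ioo_mem_nhdsGT (zero_lt_one (α := ℝ)))).exists
    exact ⟨δ, h2, h3, h1⟩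
  obtain ⟨C, hup⟩ := H.exists_sublevelEnergy_le_rpow hwκ (q := m + 2 - δ) (by linarith)
    (by linarith)
  rw [← hΛ] at hup
  have hΛj : ∀ j : ℕ, Λ * (ρ₀ / Λ ^ (j + 1)) = ρ₀ / Λ ^ j := fun j => by
    rw [pow_succ]; field_simp
  have hρj : ∀ j : ℕ, ρ₀ / Λ ^ j ≤ ρ₀ := fun j => div_le_self hρ₀.le (one_le_pow₀ hΛ1.le)
  have hρΛ : ρ₀ ≤ Λ * ρ₀ := by nlinarith
  have hlow : ∀ j : ℕ, (1 + c) ^ j * E₀ ≤ sublevelEnergy w Dw V κ (ρ₀ / Λ ^ j) := by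
    intro j
    induction j with
    | zero => simp [hE₀]
    | succ j ih =>
      have h1 := hgrow (ρ₀ / Λ ^ (j + 1)) (by positivity)
        (by rw [hΛj]; exact ((hρj j).trans hρΛ).trans_lt hρr) (by
          rw [hΛj]
          refine le_trans ?_ ih
          exact le_mul_of_one_le_left hE₀pos.le (one_le_pow₀ (by linarith)))
      rw [hΛj] at h1
      calc (1 + c) ^ (j + 1) * E₀ = (1 + c) * ((1 + c) ^ j * E₀) := by ring
        _ ≤ (1 + c) * sublevelEnergy w Dw V κ (ρ₀ / Λ ^ j) := by gcongr
        _ ≤ _ := h1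
  obtain ⟨T, hT⟩ : ∃ T, T = (Λ ^ δ) ^ 2 := ⟨_, rfl⟩
  have hT0 : 0 < T := hT ▸ by positivity
  have hupj : ∀ j : ℕ, sublevelEnergy w Dw V κ (ρ₀ / Λ ^ j)
      ≤ C * (ρ₀ ^ (-δ)) ^ 2 * T * T ^ j := by
    intro j
    have h1 := hup (ρ₀ / Λ ^ (j + 1)) (by positivity)
        (by rw [hΛj]; exact ((hρj j).trans hρΛ).trans_lt hρr)
        (by rw [hΛj]; exact ((hρj j).trans hρΛ).trans hρ1.le)
    rw [hΛj] at h1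
    have h2 : (ρ₀ / Λ ^ (j + 1)) ^ ((m : ℝ) + 2 - δ - (m + 2)) = ρ₀ ^ (-δ) * (Λ ^ δ) ^ (j + 1) := by
      rw [show (m : ℝ) + 2 - δ - (m + 2) = -δ by ring, Real.div_rpow hρ₀.le (by positivity),
        ← Real.rpow_natCast Λ, ← Real.rpow_mul hΛ0.le, mul_comm, Real.rpow_mul hΛ0.le,
        Real.rpow_neg hΛ0.le, Real.rpow_natCast, inv_pow, div_inv_eq_mul]
    rw [h2] at h1
    calc _ ≤ _ := h1
      _ = _ := by rw [hT]; ring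
  rw [← hT] at hδΛ
  have hlt : 1 < (1 + c) / T := (one_lt_div hT0).2 hδΛ
  obtain ⟨j, hj⟩ := ((tendsto_pow_atTop_atTop_of_one_lt hlt).eventually_gt_atTop
    (C * (ρ₀ ^ (-δ)) ^ 2 * T / E₀)).exists
  have h1 := (hlow j).trans (hupj j)
  rw [div_pow, div_lt_div_iff₀ hE₀pos (by positivity)] at hj
  linarith

end FluxComparison

theorem HasGradientAt.fun_pow {F : Type*} [NormedAddCommGroup F] [InnerProductSpace ℝ F]
    [CompleteSpace F] {g : F → ℝ} {g' x : F} (hg : HasGradientAt g g' x) (n : ℕ) :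
    HasGradientAt (fun y => g y ^ n) ((n * g x ^ (n - 1)) • g') x :=
  HasDerivAt.comp_hasGradientAt (hasDerivAt_pow n (g x)) hg

theorem HasGradientAt.fun_const_sub {F : Type*} [NormedAddCommGroup F] [InnerProductSpace ℝ F]
    [CompleteSpace F] {g : F → ℝ} {g' x : F} (hg : HasGradientAt g g' x) (c : ℝ) :
    HasGradientAt (fun y => c - g y) (-g') x := by
  rw [hasGradientAt_iff_hasFDerivAt] at hg ⊢
  rw [map_neg]
  exact hg.const_sub c

namespace FluxComparison
variable {m : ℕ} {r d : ℝ} {w f : EuclideanSpace ℝ (Fin (m + 2)) → ℝ}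
  {Dh Dw V : EuclideanSpace ℝ (Fin (m + 2)) → EuclideanSpace ℝ (Fin (m + 2))}

/-- The energy of `w` on `{w < K}` stays bounded near the origin. -/
theorem exists_setIntegral_shell_le (H : FluxComparison r d w f Dh Dw V) {K : ℝ} (hK : 0 < K) :
    ∃ C : ℝ, ∀ ρ : ℝ, 0 < ρ → 8 * ρ < r →
      ∫ x in shell (2 * ρ) (r / 4) ∩ {x | w x < K}, ‖Dw x‖ ^ (m + 2) ≤ C := by
  have hr := H.r_pos
  have hd := H.d_pos
  obtain ⟨C, hC, hDh⟩ := H.Dh_bound 2 (by norm_num)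
  obtain ⟨v, hv, hvol⟩ := volume_shell_le (n := m + 2) (L := 2) (by norm_num)
  obtain ⟨P, hP, hP0⟩ : ∃ P : ℝ, P = K * (m + 2) * ((m + 1) * 2 ^ m) ∧ 0 < P :=
    ⟨_, rfl, by positivity⟩
  obtain ⟨l, hl1, hlP⟩ : ∃ l : ℝ, 1 ≤ l ∧ P * (l⁻¹ ^ (m + 1) + l⁻¹) ≤ d / 2 := by
    refine ⟨1 + 4 * P / d, le_add_of_nonneg_right (by positivity), ?_⟩
    obtain ⟨l, hl⟩ : ∃ l, l = 1 + 4 * P / d := ⟨_, rfl⟩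
    have h1 : 1 ≤ l := hl ▸ le_add_of_nonneg_right (by positivity)
    have h2 : 4 * P / d ≤ l := by rw [hl]; linarith
    rw [← hl]
    have h3 : l⁻¹ ^ (m + 1) ≤ l⁻¹ :=
      pow_le_of_le_one (by positivity) (inv_le_one_of_one_le₀ h1) (by omega)
    rw [div_le_iff₀ hd] at h2
    calc P * (l⁻¹ ^ (m + 1) + l⁻¹) ≤ P * (l⁻¹ + l⁻¹) := by gcongr
      _ = 2 * P / l := by field_simp; ring
      _ ≤ d / 2 := by rw [div_le_iff₀ (by positivity)]; linarith
  have hl0 : 0 < l := by linarith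
  obtain ⟨I, hI⟩ : ∃ I, I = ∫ x, ‖V x‖ := ⟨_, rfl⟩
  refine ⟨2 / d * (K * (16 / r) * I + P * (l + l ^ (m + 1)) * (C + v)), fun ρ hρ hρr => ?_⟩
  obtain ⟨ζ, hζ⟩ : ∃ ζ : EuclideanSpace ℝ (Fin (m + 2)) → ℝ, ζ = cutoff ρ := ⟨_, rfl⟩
  obtain ⟨θ, hθ⟩ : ∃ θ : EuclideanSpace ℝ (Fin (m + 2)) → ℝ, θ = fun x => 1 - cutoff (r / 4) x :=
    ⟨_, rfl⟩
  have hr4 : 0 < r / 4 := by positivity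
  have hζ0 : ∀ x, 0 ≤ ζ x := fun x => hζ ▸ cutoff_nonneg
  have hζ1 : ∀ x, ζ x ≤ 1 := fun x => hζ ▸ cutoff_le_one
  have hθ0 : ∀ x, 0 ≤ θ x := fun x => by rw [hθ]; exact sub_nonneg.2 cutoff_le_one
  have hθ1 : ∀ x, θ x ≤ 1 := fun x => by rw [hθ]; exact sub_le_self _ cutoff_nonneg
  have hζc : ContDiff ℝ 1 ζ := hζ ▸ contDiff_cutoff ρ
  have hθc : ContDiff ℝ 1 θ := hθ ▸ contDiff_const.sub (contDiff_cutoff _)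
  set η : EuclideanSpace ℝ (Fin (m + 2)) → ℝ := fun x => ζ x ^ (m + 2) * θ x with hη
  have hη0 : ∀ x, 0 ≤ η x := fun x => mul_nonneg (pow_nonneg (hζ0 x) _) (hθ0 x)
  have hηc : ContDiff ℝ 1 η := (hζc.pow _).mul hθc
  have hηa : ∀ x, ‖x‖ ≤ ρ → η x = 0 := fun x hx => by
    simp [hη, hζ, cutoff_of_le hρ hx]
  have hηb : ∀ x, r / 2 < ‖x‖ → η x = 0 := fun x hx => by
    simp [hη, hθ, cutoff_of_ge hr4 (by linarith : 2 * (r / 4) ≤ ‖x‖)]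
  have hηg : ∀ x, ‖gradient η x‖ ≤ (m + 2) * (θ x * (ζ x ^ (m + 1) * ‖gradient ζ x‖)) + 16 / r := by
    intro x
    have h1 := ((hζc.differentiable (by norm_num)) x).hasGradientAt.fun_pow (m + 2)
    have h2 : HasGradientAt θ (-gradient (cutoff (r / 4)) x) x := by
      rw [hθ]
      exact (((contDiff_cutoff _).differentiable (by norm_num)) x).hasGradientAt.fun_const_sub 1
    rw [hη, (h1.fun_mul h2).gradient]
    refine (norm_add_le _ _).trans ?_
    rw [norm_smul, norm_smul, norm_smul, norm_neg, norm_of_nonneg (pow_nonneg (hζ0 x) _),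
      norm_of_nonneg (hθ0 x), norm_of_nonneg (by have := hζ0 x; positivity), add_comm]
    refine add_le_add (le_of_eq ?_) ?_
    · push_cast
      ring
    · calc ζ x ^ (m + 2) * ‖gradient (cutoff (r / 4)) x‖ ≤ 1 * (4 / (r / 4)) := by
            gcongr
            · exact pow_le_one₀ (hζ0 x) (hζ1 x)
            · exact norm_gradient_cutoff_le hr4
        _ = 16 / r := by field_simp; norm_num
  have hEI := H.setIntegral_sublevel_le (κ := K) hρ (by linarith : r / 2 < r) hηc hη0 hηa
    (fun x hx _ => hηb x hx)
  set S := {x | w x < K} with hSdef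
  have hS : MeasurableSet S := H.measurableSet_lt K
  have hηS : ∀ x ∈ S, x ∉ shell ρ (r / 2) → η x = 0 := fun x _ hxs => by
    rcases le_or_gt ‖x‖ ρ with h | h
    · exact hηa x h
    · exact hηb x (by by_contra hle; exact hxs ⟨h.le, not_lt.1 hle⟩)
  have hr2 : r / 2 < r := by linarith
  have hIw : IntegrableOn (fun x => η x * ‖Dw x‖ ^ (m + 2)) S :=
    ContinuousOn.integrableOn_of_eq_zero (r := r)
      (hηc.continuous.continuousOn.mul (H.Dw_cont.norm.pow _)) hρ hr2 hS
      fun x hx hxs => by simp [hηS x hx hxs]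
  have hIE : IntegrableOn (fun x => η x * ⟪V x, Dw x⟫_ℝ) S :=
    ContinuousOn.integrableOn_of_eq_zero (r := r)
      (hηc.continuous.continuousOn.mul (H.V_cont.inner H.Dw_cont)) hρ hr2 hS
      fun x hx hxs => by simp [hηS x hx hxs]
  set T : Set (EuclideanSpace ℝ (Fin (m + 2))) := shell ρ (2 * ρ) with hT
  have hTm : MeasurableSet T := measurableSet_shell _ _
  have hIh : IntegrableOn (fun x => ‖Dh x‖ ^ (m + 2)) T :=
    ContinuousOn.integrableOn_shell (H.Dh_cont.norm.pow _) hρ (by linarith)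
  have hIs : IntegrableOn (fun x => ‖Dh x‖ ^ (m + 2) + (4 / ρ) ^ (m + 2)) T :=
    hIh.add (integrableOn_const (isCompact_shell _ _).measure_lt_top.ne)
  set g : EuclideanSpace ℝ (Fin (m + 2)) → ℝ :=
    T.indicator fun x => ‖Dh x‖ ^ (m + 2) + (4 / ρ) ^ (m + 2) with hg
  have hg0 : ∀ x, 0 ≤ g x := fun x => indicator_nonneg (fun x _ => by positivity) x
  have hgi : Integrable g := hIs.integrable_indicator hTm
  have hpt : ∀ x ∈ S, (K - w x) * (‖V x‖ * ‖gradient η x‖) ≤ d / 2 * (η x * ‖Dw x‖ ^ (m + 2))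
      + (K * (16 / r) * ‖V x‖ + P * (l + l ^ (m + 1)) * g x) := by
    intro x hx
    by_cases hU : x ≠ 0 ∧ ‖x‖ < r
    swap
    · rw [H.V_zero hU, norm_zero, zero_mul, mul_zero]
      have := hη0 x
      have := hg0 x
      positivity
    have hx : w x < K := hx
    have hw0 := H.w_nonneg hU.1
    have h1 : θ x * (ζ x ^ (m + 1) * ‖gradient ζ x‖) * ‖V x‖ ≤ (m + 1) * 2 ^ m *
        ((l⁻¹ ^ (m + 1) + l⁻¹) * (η x * ‖Dw x‖ ^ (m + 2)) + (l + l ^ (m + 1)) * g x) := by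
      by_cases hxT : x ∈ T
      · have hy := young_flux m (mul_nonneg (hζ0 x) (norm_nonneg (Dw x)))
          (mul_nonneg (hζ0 x) (norm_nonneg (Dh x))) (norm_nonneg (gradient ζ x)) hl0
        rw [hg, indicator_of_mem hxT]
        have h2 : ζ x ^ (m + 2) ≤ 1 := pow_le_one₀ (hζ0 x) (hζ1 x)
        have h3 : ‖gradient ζ x‖ ≤ 4 / ρ := hζ ▸ norm_gradient_cutoff_le hρ
        have hz := hζ0 x
        have ht := hθ0 x
        calc θ x * (ζ x ^ (m + 1) * ‖gradient ζ x‖) * ‖V x‖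
            ≤ θ x * (ζ x ^ (m + 1) * ‖gradient ζ x‖) *
              ((m + 1) * ((‖Dh x‖ + ‖Dw x‖) ^ m * ‖Dw x‖)) := by
              gcongr; exact H.growth x
          _ = (m + 1) * θ x * (‖gradient ζ x‖ * ((ζ x * ‖Dh x‖ + ζ x * ‖Dw x‖) ^ m *
              (ζ x * ‖Dw x‖))) := by rw [← mul_add, mul_pow]; ring
          _ ≤ (m + 1) * θ x * (2 ^ m * ((l⁻¹ ^ (m + 1) + l⁻¹) * (ζ x * ‖Dw x‖) ^ (m + 2) +
              (l + l ^ (m + 1)) * ((ζ x * ‖Dh x‖) ^ (m + 2) + ‖gradient ζ x‖ ^ (m + 2)))) :=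
              mul_le_mul_of_nonneg_left hy (by positivity)
          _ = (m + 1) * 2 ^ m * ((l⁻¹ ^ (m + 1) + l⁻¹) * (η x * ‖Dw x‖ ^ (m + 2)) +
              (l + l ^ (m + 1)) * (θ x * (ζ x ^ (m + 2) * ‖Dh x‖ ^ (m + 2)
                + ‖gradient ζ x‖ ^ (m + 2)))) := by
              rw [hη]; simp only [mul_pow]; ring
          _ ≤ _ := by
              gcongr
              calc θ x * (ζ x ^ (m + 2) * ‖Dh x‖ ^ (m + 2) + ‖gradient ζ x‖ ^ (m + 2))
                  ≤ 1 * (1 * ‖Dh x‖ ^ (m + 2) + (4 / ρ) ^ (m + 2)) := by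
                    gcongr; exact hθ1 x
                _ = _ := by ring
      · have h0 : gradient ζ x = 0 := by
          rw [hζ]
          rcases le_or_gt ‖x‖ ρ with h | h
          · exact gradient_cutoff_of_le hρ h
          · exact gradient_cutoff_of_ge hρ (by by_contra hle; exact hxT ⟨h.le, (not_le.1 hle).le⟩)
        rw [h0]
        have := hη0 x
        have := hg0 x
        simp only [norm_zero, mul_zero, zero_mul]
        positivity
    have hηD : 0 ≤ η x * ‖Dw x‖ ^ (m + 2) := mul_nonneg (hη0 x) (by positivity)
    calc (K - w x) * (‖V x‖ * ‖gradient η x‖)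
        ≤ K * (‖V x‖ * ((m + 2) * (θ x * (ζ x ^ (m + 1) * ‖gradient ζ x‖)) + 16 / r)) := by
          have h4 := hηg x
          have h5 : K - w x ≤ K := by linarith
          gcongr
      _ = K * (m + 2) * (θ x * (ζ x ^ (m + 1) * ‖gradient ζ x‖) * ‖V x‖)
          + K * (16 / r) * ‖V x‖ := by ring
      _ ≤ K * (m + 2) * ((m + 1) * 2 ^ m * ((l⁻¹ ^ (m + 1) + l⁻¹) * (η x * ‖Dw x‖ ^ (m + 2))
          + (l + l ^ (m + 1)) * g x)) + K * (16 / r) * ‖V x‖ := by gcongr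
      _ = P * (l⁻¹ ^ (m + 1) + l⁻¹) * (η x * ‖Dw x‖ ^ (m + 2))
          + (K * (16 / r) * ‖V x‖ + P * (l + l ^ (m + 1)) * g x) := by rw [hP]; ring
      _ ≤ _ := by gcongr
  have hIV' : Integrable (fun x => K * (16 / r) * ‖V x‖ + P * (l + l ^ (m + 1)) * g x) :=
    (H.V_int.norm.const_mul _).add (hgi.const_mul _)
  have hIV := hIV'.integrableOn (s := S)
  have hlow : d * ∫ x in S, η x * ‖Dw x‖ ^ (m + 2) ≤ ∫ x in S, η x * ⟪V x, Dw x⟫_ℝ := by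
    rw [← integral_const_mul]
    refine setIntegral_mono (hIw.const_mul d) hIE fun x => ?_
    have := mul_le_mul_of_nonneg_left (H.coercive x) (hη0 x)
    dsimp only
    linarith
  have hup : ∫ x in S, (K - w x) * (‖V x‖ * ‖gradient η x‖) ≤
      d / 2 * (∫ x in S, η x * ‖Dw x‖ ^ (m + 2)) +
        ∫ x in S, (K * (16 / r) * ‖V x‖ + P * (l + l ^ (m + 1)) * g x) := by
    rw [← integral_const_mul, ← integral_add (hIw.const_mul _) hIV]
    refine integral_mono_of_nonneg ?_ ((hIw.const_mul _).add hIV) ?_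
    · filter_upwards [ae_restrict_mem hS] with x hx
      exact mul_nonneg (sub_nonneg.2 (le_of_lt hx)) (by positivity)
    · filter_upwards [ae_restrict_mem hS] with x hx
      exact hpt x hx
  have hrest : ∫ x in S, (K * (16 / r) * ‖V x‖ + P * (l + l ^ (m + 1)) * g x) ≤
      K * (16 / r) * I + P * (l + l ^ (m + 1)) * (C + v) := by
    refine (setIntegral_le_integral hIV'
      (Eventually.of_forall fun x => ?_)).trans ?_
    · have := hg0 x
      simp only [Pi.zero_apply]
      positivity
    rw [integral_add (H.V_int.norm.const_mul _) (hgi.const_mul _), integral_const_mul,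
      integral_const_mul, ← hI, hg, integral_indicator hTm,
      integral_add hIh (integrableOn_const (isCompact_shell _ _).measure_lt_top.ne),
      setIntegral_const, smul_eq_mul]
    have h1 := hDh ρ hρ (by linarith)
    have h2 := hvol ρ hρ T subset_rfl
    rw [mul_comm] at h2
    exact add_le_add le_rfl (mul_le_mul_of_nonneg_left (add_le_add h1 h2) (by positivity))
  have hfin : ∫ x in shell (2 * ρ) (r / 4) ∩ S, ‖Dw x‖ ^ (m + 2)
      ≤ ∫ x in S, η x * ‖Dw x‖ ^ (m + 2) := by
    rw [setIntegral_congr_fun (g := fun x => η x * ‖Dw x‖ ^ (m + 2))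
      ((measurableSet_shell _ _).inter hS) (fun x hx => ?_)]
    · exact setIntegral_mono_set hIw (Eventually.of_forall fun x =>
        mul_nonneg (hη0 x) (by positivity)) inter_subset_right.eventuallyLE
    · simp [hη, hζ, hθ, cutoff_of_ge hρ hx.1.1, cutoff_of_le hr4 hx.1.2]
  refine hfin.trans ?_
  rw [div_mul_eq_mul_div, le_div_iff₀ hd]
  linarith

theorem integrableOn_energy (H : FluxComparison r d w f Dh Dw V) {K : ℝ} (hK : 0 < K) :
    IntegrableOn (fun x => ‖Dw x‖ ^ (m + 2)) ({x | ‖x‖ ≤ r / 4} ∩ {x | w x < K}) := by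
  have hr := H.r_pos
  obtain ⟨C, hC⟩ := H.exists_setIntegral_shell_le hK
  have hS : MeasurableSet {x | w x < K} := H.measurableSet_lt K
  obtain ⟨ρ, hρ⟩ : ∃ ρ : ℕ → ℝ, ρ = fun j : ℕ => r / 16 * (1 / ((j : ℝ) + 1)) := ⟨_, rfl⟩
  have hρ0 : ∀ j, 0 < ρ j := fun j => hρ ▸ by positivity
  have hρr : ∀ j, 8 * ρ j < r := fun j => by
    have h1 : 1 / ((j : ℝ) + 1) ≤ 1 := div_le_one_of_le₀ (by simp) (by positivity)
    have : ρ j ≤ r / 16 * 1 := by rw [hρ]; dsimp only; gcongr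
    linarith
  have hlim : Tendsto (fun j => 2 * ρ j) atTop (𝓝 0) := by
    have := ((tendsto_one_div_add_atTop_nhds_zero_nat (𝕜 := ℝ)).const_mul (r / 16)).const_mul 2
    rw [hρ]
    simpa using this
  have hcov : AECover (volume.restrict ({x | ‖x‖ ≤ r / 4} ∩ {x | w x < K})) atTop
      (fun j => shell (2 * ρ j) (r / 4)) := by
    refine ⟨?_, fun j => measurableSet_shell _ _⟩
    have hm : MeasurableSet ({x : EuclideanSpace ℝ (Fin (m + 2)) | ‖x‖ ≤ r / 4} ∩ {x | w x < K}) :=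
      (isClosed_le continuous_norm continuous_const).measurableSet.inter hS
    filter_upwards [ae_restrict_mem hm, ae_restrict_of_ae (compl_mem_ae_iff.2
      (measure_singleton (0 : EuclideanSpace ℝ (Fin (m + 2)))))] with x hx hx0
    filter_upwards [hlim.eventually_lt_const (norm_pos_iff.2 hx0)] with j hj
    exact ⟨hj.le, hx.1⟩
  refine hcov.integrable_of_integral_bounded_of_nonneg_ae C (fun j => ?_)
    (Eventually.of_forall fun x => by positivity) (Eventually.of_forall fun j => ?_)
  · have : IntegrableOn (fun x => ‖Dw x‖ ^ (m + 2)) (shell (2 * ρ j) (r / 4)) :=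
      ContinuousOn.integrableOn_shell (H.Dw_cont.norm.pow _) (mul_pos two_pos (hρ0 j))
        (by linarith)
    exact this.mono_measure Measure.restrict_le_self
  · have hsub : shell (2 * ρ j) (r / 4) ∩ ({x | ‖x‖ ≤ r / 4} ∩ {x | w x < K}) =
        shell (2 * ρ j) (r / 4) ∩ {x | w x < K} := by
      ext x; exact ⟨fun h => ⟨h.1, h.2.2⟩, fun h => ⟨h.1, h.1.2, h.2⟩⟩
    rw [Measure.restrict_restrict (measurableSet_shell _ _), hsub]
    exact hC (ρ j) (hρ0 j) (hρr j)

/-- The flux of `w` through shrinking shells, restricted to `{w < K}`, tends to zero. -/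
theorem tendsto_setIntegral_norm_flux (H : FluxComparison r d w f Dh Dw V) {K : ℝ} (hK : 0 < K) :
    Tendsto (fun ρ => ∫ x in shell ρ (2 * ρ) ∩ {x | w x < K}, 4 / ρ * ‖V x‖) (𝓝[>] 0) (𝓝 0) := by
  have hr := H.r_pos
  have hS : MeasurableSet {x | w x < K} := H.measurableSet_lt K
  have hI := H.integrableOn_energy hK
  obtain ⟨B, hB, hfl⟩ := H.setIntegral_norm_flux_le (L := 2) (by norm_num)
  have hmem : ∀ c : ℝ, 0 < c → ∀ᶠ ρ in 𝓝[>] (0 : ℝ), 0 < ρ ∧ ρ < c := fun c hc => Ioo_mem_nhdsGT hc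
  have hY : Tendsto (fun ρ => ∫ x in shell ρ (2 * ρ) ∩ {x | w x < K}, ‖Dw x‖ ^ (m + 2))
      (𝓝[>] 0) (𝓝 0) := by
    have h1 : Tendsto (fun ρ => ∫ x in {x | ‖x‖ ≤ r / 4} ∩ {x | w x < K},
        (shell ρ (2 * ρ)).indicator (fun x => ‖Dw x‖ ^ (m + 2)) x) (𝓝[>] 0) (𝓝 (∫ x in
          {x | ‖x‖ ≤ r / 4} ∩ {x | w x < K}, (0 : ℝ))) := by
      refine tendsto_integral_filter_of_dominated_convergence (fun x => ‖Dw x‖ ^ (m + 2))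
        (Eventually.of_forall fun ρ =>
          ((H.Dw_meas.norm.pow_const _).indicator (measurableSet_shell _ _)).aestronglyMeasurable)
        (Eventually.of_forall fun ρ => Eventually.of_forall fun x => ?_) hI
        (ae_restrict_of_ae ?_)
      · rw [norm_indicator_eq_indicator_norm]
        refine (indicator_le_self' (fun _ _ => norm_nonneg _) x).trans ?_
        rw [norm_of_nonneg (by positivity)]
      · filter_upwards [measure_singleton (0 : EuclideanSpace ℝ (Fin (m + 2)))
          |> compl_mem_ae_iff.2] with x hx
        refine tendsto_const_nhds.congr' ?_
        have hx0 : 0 < ‖x‖ := norm_pos_iff.2 hx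
        filter_upwards [hmem (‖x‖ / 2) (by positivity)] with ρ hρ
        rw [indicator_of_notMem]
        intro hxs
        have := hxs.2
        linarith [hρ.2]
    rw [integral_zero] at h1
    refine h1.congr' ?_
    filter_upwards [hmem (r / 8) (by positivity)] with ρ hρ
    rw [setIntegral_indicator (measurableSet_shell _ _)]
    congr 2
    ext x
    exact ⟨fun h => ⟨h.2, h.1.2⟩, fun h => ⟨⟨h.1.2.trans (by linarith [hρ.2]), h.2⟩, h.1⟩⟩
  refine Metric.tendsto_nhds.2 fun e he => ?_
  obtain ⟨l, hl, hle⟩ : ∃ l : ℝ, 0 < l ∧ B * (l + l ^ (m + 1)) < e / 2 := by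
    have hc : Tendsto (fun l : ℝ => B * (l + l ^ (m + 1))) (𝓝[>] 0) (𝓝 (B * (0 + 0 ^ (m + 1)))) :=
      (Continuous.tendsto (by fun_prop) 0).mono_left nhdsWithin_le_nhds
    have h2 := hc.eventually_lt_const (u := e / 2) (by simpa using he)
    obtain ⟨l, h3, h4⟩ := (h2.and (hmem 1 one_pos)).exists
    exact ⟨l, h4.1, h3⟩
  have h3 := (hY.const_mul (B * (l⁻¹ ^ (m + 1) + l⁻¹))).eventually_lt_const (u := e / 2)
    (by simpa using he)
  filter_upwards [h3, hmem (r / 4) (by positivity)] with ρ h4 hρ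
  have hρ0 := hρ.1
  have h5 := hfl ρ l (shell ρ (2 * ρ) ∩ {x | w x < K}) hρ.1 (by linarith [hρ.2]) hl
    ((measurableSet_shell _ _).inter hS) inter_subset_left
  have h6 : 0 ≤ ∫ x in shell ρ (2 * ρ) ∩ {x | w x < K}, 4 / ρ * ‖V x‖ :=
    integral_nonneg fun x => by positivity
  rw [Real.dist_eq, sub_zero, abs_of_nonneg h6]
  linarith

end FluxComparison

namespace FluxComparison
variable {m : ℕ} {r d : ℝ} {w f : EuclideanSpace ℝ (Fin (m + 2)) → ℝ}
  {Dh Dw V : EuclideanSpace ℝ (Fin (m + 2)) → EuclideanSpace ℝ (Fin (m + 2))}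

theorem setIntegral_band_le_add_flux (H : FluxComparison r d w f Dh Dw V) {k a ε ρ : ℝ} (ha : 0 < a)
    (hε : 0 < ε) (hεk : ε < k) (hρ : 0 < ρ) (hρr : 2 * ρ < r) :
    d * ∫ x in {x | k < w x ∧ w x < k + a} ∩ {x | 2 * ρ ≤ ‖x‖}, ‖Dw x‖ ^ (m + 2)
      ≤ (a + ε) * ((∫ x, f x) +
        ∫ x in shell ρ (2 * ρ) ∩ {x | w x < 2 * k + a}, 4 / ρ * ‖V x‖) := by
  obtain ⟨b, hb⟩ : ∃ b, b = a + ε := ⟨_, rfl⟩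
  have hb0 : 0 < b := by linarith
  have hd := H.d_pos
  rw [← hb]
  obtain ⟨η, hη⟩ : ∃ η : EuclideanSpace ℝ (Fin (m + 2)) → ℝ, η = cutoff ρ := ⟨_, rfl⟩
  have hη0 : ∀ x, 0 ≤ η x := fun x => hη ▸ cutoff_nonneg
  have hη1 : ∀ x, η x ≤ 1 := fun x => hη ▸ cutoff_le_one
  have hηc : ContDiff ℝ 1 η := hη ▸ contDiff_cutoff ρ
  have hηg : ∀ x, ‖gradient η x‖ ≤ 4 / ρ := fun x => hη ▸ norm_gradient_cutoff_le hρ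
  set G := softTrunc ε k b with hG
  have hG0 : ∀ t, 0 ≤ G t := fun t => softTrunc_nonneg hε hb0.le
  have hGb : ∀ t, G t ≤ b := fun t => softTrunc_le hε hb0.le
  have hGc : ContDiff ℝ 1 G := contDiff_softTrunc ε k b
  set φ : EuclideanSpace ℝ (Fin (m + 2)) → ℝ := fun x => b - η x * (b - G (w x)) with hφ
  have hin : ∀ x, ‖x‖ < ρ → φ =ᶠ[𝓝 x] fun _ => b := fun x hx => by
    filter_upwards [continuous_norm.continuousAt.eventually_lt continuousAt_const hx] with y hy
    simp [hφ, hη, cutoff_of_le hρ hy.le]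
  have hout : ∀ x, r ≤ ‖x‖ → φ =ᶠ[𝓝 x] 0 := fun x hx => by
    have hx0 : x ≠ 0 := norm_pos_iff.1 (H.r_pos.trans_le hx)
    filter_upwards [continuousAt_const.eventually_lt continuous_norm.continuousAt
      (hρr.trans_le hx), (H.w_continuousAt hx0).eventually_lt continuousAt_const
        (by rw [H.w_zero x hx]; linarith : w x < k - ε)] with y hy1 hy2
    simp [hφ, hη, hG, cutoff_of_ge hρ hy1.le, softTrunc_of_le hε hb0.le hy2.le]
  obtain ⟨h1, h2, h3⟩ := admissible_of_eventuallyEq (r := r) (φ := φ) (fun x hx => by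
    rcases lt_or_ge ‖x‖ ρ with h | h
    · exact contDiffAt_const.congr_of_eventuallyEq (hin x h)
    · have hx0 := norm_pos_iff.1 (hρ.trans_le h)
      exact contDiffAt_const.sub (hηc.contDiffAt.mul (contDiffAt_const.sub
        (hGc.contDiffAt.comp x (H.w_contDiffAt x hx0 hx))))) hout
  have hφ0 : ∀ x, 0 ≤ φ x := fun x => by
    have : η x * (b - G (w x)) ≤ 1 * (b - 0) :=
      mul_le_mul (hη1 x) (sub_le_sub_left (hG0 _) b) (sub_nonneg.2 (hGb _)) zero_le_one
    simp only [hφ]; linarith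
  have hφb : ∀ x, φ x ≤ b := fun x =>
    sub_le_self _ (mul_nonneg (hη0 x) (sub_nonneg.2 (hGb _)))
  have hgrad : ∀ x, ⟪V x, gradient φ x⟫_ℝ =
      η x * softTruncDeriv ε k b (w x) * ⟪V x, Dw x⟫_ℝ
        - (b - G (w x)) * ⟪V x, gradient η x⟫_ℝ := by
    intro x
    by_cases hU : x ≠ 0 ∧ ‖x‖ < r
    · have e1 := (HasDerivAt.comp_hasGradientAt (hasDerivAt_softTrunc ε k b (w x))
        (H.w_grad x hU.1 hU.2)).fun_const_sub b
      have e2 := (((hηc.differentiable (by norm_num)) x).hasGradientAt.fun_mul e1).fun_const_sub b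
      rw [e2.gradient, inner_neg_right, inner_add_right, real_inner_smul_right,
        real_inner_smul_right, inner_neg_right, real_inner_smul_right]
      ring
    · simp [H.V_zero hU]
  have hI1 := H.V_int.inner_gradient h1 h2
  have hI2 : Integrable fun x => (b - G (w x)) * ⟪V x, gradient η x⟫_ℝ := by
    refine (H.V_int.norm.const_mul (b * (4 / ρ))).mono' ?_ (Eventually.of_forall fun x => ?_)
    · exact ((measurable_const.sub (hGc.continuous.measurable.comp H.w_meas)
        ).aestronglyMeasurable).mul
        (H.V_int.aestronglyMeasurable.inner hηc.continuous_gradient.aestronglyMeasurable)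
    · rw [norm_mul, norm_of_nonneg (sub_nonneg.2 (hGb _))]
      calc (b - G (w x)) * ‖⟪V x, gradient η x⟫_ℝ‖ ≤ b * (‖V x‖ * (4 / ρ)) := by
            refine mul_le_mul (sub_le_self _ (hG0 _)) ((norm_inner_le_norm _ _).trans ?_)
              (norm_nonneg _) hb0.le
            exact mul_le_mul_of_nonneg_left (hηg x) (norm_nonneg _)
        _ = _ := by ring
  have hI3 : Integrable fun x => η x * softTruncDeriv ε k b (w x) * ⟪V x, Dw x⟫_ℝ := by
    refine (hI1.add hI2).congr (Eventually.of_forall fun x => ?_)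
    simp only [Pi.add_apply, hgrad]
    ring
  have hweak := H.weak φ h1 h2 h3
  simp only [hgrad] at hweak
  rw [integral_sub hI3 hI2] at hweak
  have hf : ∫ x, f x * φ x ≤ b * ∫ x, f x := by
    rw [← integral_const_mul]
    refine integral_mono_of_nonneg (Eventually.of_forall fun x =>
      mul_nonneg (H.f_nonneg x) (hφ0 x)) (H.f_int.const_mul b) (Eventually.of_forall fun x => ?_)
    have := mul_le_mul_of_nonneg_left (hφb x) (H.f_nonneg x)
    dsimp only
    linarith
  set T := shell ρ (2 * ρ) ∩ {x | w x < 2 * k + a} with hT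
  have hTm : MeasurableSet T := (measurableSet_shell _ _).inter (H.measurableSet_lt _)
  have hI4 : Integrable (T.indicator fun x => b * (4 / ρ * ‖V x‖)) :=
    ((H.V_int.norm.const_mul _).const_mul _).indicator hTm
  have hV : ∫ x, (b - G (w x)) * ⟪V x, gradient η x⟫_ℝ ≤ b * ∫ x in T, 4 / ρ * ‖V x‖ := by
    rw [← integral_const_mul, ← integral_indicator hTm]
    refine integral_mono hI2 hI4 fun x => ?_
    by_cases hx : x ∈ T
    · rw [indicator_of_mem hx]
      have h5 : ⟪V x, gradient η x⟫_ℝ ≤ 4 / ρ * ‖V x‖ :=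
        (real_inner_le_norm _ _).trans ((mul_le_mul_of_nonneg_left (hηg x) (norm_nonneg _)).trans
          (mul_comm _ _).le)
      exact (mul_le_mul_of_nonneg_left h5 (sub_nonneg.2 (hGb _))).trans
        (mul_le_mul_of_nonneg_right (sub_le_self _ (hG0 _)) (by positivity))
    · rw [indicator_of_notMem hx]
      by_cases hw : w x < 2 * k + a
      · have h0 : gradient η x = 0 := by
          rw [hη]
          rcases le_or_gt ‖x‖ ρ with h | h
          · exact gradient_cutoff_of_le hρ h
          · refine gradient_cutoff_of_ge hρ ?_
            by_contra hle
            exact hx ⟨⟨h.le, (not_le.1 hle).le⟩, hw⟩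
        simp [h0]
      · have : G (w x) = b := softTrunc_of_ge hε hb0.le (by linarith)
        simp [this]
  have hlow : d * ∫ x in {x | k < w x ∧ w x < k + a} ∩ {x | 2 * ρ ≤ ‖x‖}, ‖Dw x‖ ^ (m + 2) ≤
      ∫ x, η x * softTruncDeriv ε k b (w x) * ⟪V x, Dw x⟫_ℝ := by
    have hSm : MeasurableSet ({x | k < w x ∧ w x < k + a} ∩ {x | 2 * ρ ≤ ‖x‖}) :=
      (H.w_meas measurableSet_Ioo).inter
        (isClosed_le continuous_const continuous_norm).measurableSet
    rw [← integral_const_mul, ← integral_indicator hSm]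
    refine integral_mono_of_nonneg (Eventually.of_forall fun x =>
      indicator_nonneg (fun x _ => by positivity) x) hI3 (Eventually.of_forall fun x => ?_)
    by_cases hx : x ∈ {x | k < w x ∧ w x < k + a} ∩ {x | 2 * ρ ≤ ‖x‖}
    · dsimp only
      rw [indicator_of_mem hx, hη, cutoff_of_ge hρ hx.2,
        softTruncDeriv_of_mem hε hx.1.1.le (by linarith [hx.1.2]), one_mul, one_mul]
      exact H.coercive x
    · rw [indicator_of_notMem hx]
      exact mul_nonneg (mul_nonneg (hη0 x) (softTruncDeriv_nonneg hε hb0.le)) (H.inner_nonneg x)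
  rw [mul_add]
  linarith

/-- The entropy estimate. -/
theorem setIntegral_band_le (H : FluxComparison r d w f Dh Dw V) {k a : ℝ} (hk : 0 < k)
    (ha : 0 < a) : ∫ x in {x | k < w x ∧ w x < k + a}, ‖Dw x‖ ^ (m + 2) ≤ a / d * ∫ x, f x := by
  have hr := H.r_pos
  have hd := H.d_pos
  have hf : 0 ≤ ∫ x, f x := integral_nonneg H.f_nonneg
  by_cases hI : IntegrableOn (fun x => ‖Dw x‖ ^ (m + 2)) {x | k < w x ∧ w x < k + a}
  swap
  · rw [integral_undef hI]; positivity
  have hSm : MeasurableSet {x | k < w x ∧ w x < k + a} := H.w_meas measurableSet_Ioo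
  have hlim : Tendsto (fun ρ : ℝ => 2 * ρ) (𝓝[>] 0) (𝓝 0) := by
    have : Tendsto (fun ρ : ℝ => 2 * ρ) (𝓝 0) (𝓝 (2 * 0)) := tendsto_id.const_mul 2
    rw [mul_zero] at this
    exact this.mono_left nhdsWithin_le_nhds
  have hmeas : ∀ ρ : ℝ, MeasurableSet {x : EuclideanSpace ℝ (Fin (m + 2)) | 2 * ρ ≤ ‖x‖} :=
    fun ρ => (isClosed_le continuous_const continuous_norm).measurableSet
  have hcov : AECover (volume.restrict {x | k < w x ∧ w x < k + a}) (𝓝[>] (0 : ℝ))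
      (fun ρ => {x | 2 * ρ ≤ ‖x‖}) := by
    refine ⟨?_, hmeas⟩
    filter_upwards [ae_restrict_of_ae (compl_mem_ae_iff.2
      (measure_singleton (0 : EuclideanSpace ℝ (Fin (m + 2)))))] with x hx0
    filter_upwards [hlim.eventually_lt_const (norm_pos_iff.2 hx0)] with j hj
    exact hj.le
  have hJ := (hcov.integral_tendsto_of_countably_generated hI).const_mul d
  have hε : ∀ ε : ℝ, 0 < ε → ε < k →
      d * ∫ x in {x | k < w x ∧ w x < k + a}, ‖Dw x‖ ^ (m + 2) ≤ (a + ε) * ∫ x, f x := by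
    intro ε hε hεk
    have hR := ((H.tendsto_setIntegral_norm_flux (K := 2 * k + a) (by positivity)).const_add
      (∫ x, f x)).const_mul (a + ε)
    rw [add_zero] at hR
    refine le_of_tendsto_of_tendsto hJ hR ?_
    filter_upwards [self_mem_nhdsWithin, hlim.eventually_lt_const hr] with ρ hρ hρr
    have := H.setIntegral_band_le_add_flux ha hε hεk hρ hρr
    rwa [Measure.restrict_restrict (hmeas ρ), inter_comm]
  rw [div_mul_eq_mul_div, le_div_iff₀ hd, mul_comm]
  have hR : Tendsto (fun ε : ℝ => (a + ε) * ∫ x, f x) (𝓝[>] 0) (𝓝 ((a + 0) * ∫ x, f x)) :=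
    (Continuous.tendsto (by fun_prop) 0).mono_left nhdsWithin_le_nhds
  rw [add_zero] at hR
  refine ge_of_tendsto hR ?_
  filter_upwards [Ioo_mem_nhdsGT hk] with ε h
  exact hε ε h.1 h.2

end FluxComparison

section
variable {F : Type*} [NormedAddCommGroup F] [InnerProductSpace ℝ F] [CompleteSpace F]

theorem isOpen_puncturedBall {F : Type*} [NormedAddCommGroup F] (r : ℝ) :
    IsOpen {x : F | x ≠ 0 ∧ ‖x‖ < r} :=
  isOpen_ne.inter (isOpen_lt continuous_norm continuous_const)

theorem ContDiffOn.continuousOn_gradient {h : F → ℝ} {U : Set F} (hh : ContDiffOn ℝ 1 h U)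
    (hU : IsOpen U) : ContinuousOn (gradient h) U :=
  (InnerProductSpace.toDual ℝ F).symm.continuous.comp_continuousOn
    (hh.continuousOn_fderiv_of_isOpen hU le_rfl)

theorem measurable_gradient [MeasurableSpace F] [BorelSpace F] (h : F → ℝ) :
    Measurable (gradient h) :=
  (InnerProductSpace.toDual ℝ F).symm.continuous.measurable.comp (measurable_fderiv ℝ h)

end

theorem mul_pow_succ_le_half_add {b s : ℝ} (hb : 0 ≤ b) (hs : 0 ≤ s) (m : ℕ) :
    b * s ^ (m + 1) ≤ 1 / 2 * s ^ (m + 2) + (2 * b) ^ (m + 2) := by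
  rcases le_total s (2 * b) with h | h
  · calc b * s ^ (m + 1) ≤ 2 * b * (2 * b) ^ (m + 1) := by gcongr; linarith
      _ = (2 * b) ^ (m + 2) := by ring
      _ ≤ _ := le_add_of_nonneg_left (by positivity)
  · calc b * s ^ (m + 1) ≤ s / 2 * s ^ (m + 1) := by gcongr; linarith
      _ = 1 / 2 * s ^ (m + 2) := by ring
      _ ≤ _ := le_add_of_nonneg_right (by positivity)

/-- Caccioppoli estimate on dyadic shells for an `n`-harmonic function with a logarithmic
singularity. -/
theorem exists_setIntegral_shell_gradient_le {m : ℕ} {r c γ C L : ℝ}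
    {h : EuclideanSpace ℝ (Fin (m + 2)) → ℝ} (hh : ContDiffOn ℝ 1 h {x | x ≠ 0 ∧ ‖x‖ < r})
    (hlog : ∀ x, x ≠ 0 → ‖x‖ < r → |h x - c * Real.log ‖x‖| ≤ C)
    (hsol : ∀ φ : EuclideanSpace ℝ (Fin (m + 2)) → ℝ, ContDiff ℝ 1 φ → HasCompactSupport φ →
      tsupport φ ⊆ ball 0 r →
      ∫ x in ball 0 r, ‖gradient h x‖ ^ m * ⟪gradient h x, gradient φ x⟫_ℝ = -(γ * φ 0))
    (hL : 1 < L) :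
    ∃ D : ℝ, 0 ≤ D ∧ ∀ ρ : ℝ, 0 < ρ → 2 * L * ρ < r →
      ∫ x in shell ρ (L * ρ), ‖gradient h x‖ ^ (m + 2) ≤ D := by
  obtain ⟨v, hv, hvol⟩ := volume_shell_le (n := m + 2) (L := 4 * L) (by linarith)
  have hL0 : 0 < L := by linarith
  have hlogL : 0 ≤ Real.log (2 * L) := Real.log_nonneg (by linarith)
  obtain ⟨M, hM⟩ : ∃ M, M = |C| + |c| * Real.log (2 * L) := ⟨_, rfl⟩
  have hM0 : 0 ≤ M := hM ▸ by positivity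
  refine ⟨2 * ((4 * M * (m + 2)) ^ (m + 2) * v), by positivity, fun ρ hρ hρr => ?_⟩
  have hρ2 : 0 < ρ / 2 := by positivity
  have hLρ : 0 < L * ρ := by positivity
  have hρL : ρ < L * ρ := by nlinarith
  have hUo := isOpen_puncturedBall (F := EuclideanSpace ℝ (Fin (m + 2))) r
  set T : Set (EuclideanSpace ℝ (Fin (m + 2))) := shell (ρ / 2) (2 * L * ρ) with hT
  have hTU : T ⊆ {x | x ≠ 0 ∧ ‖x‖ < r} := shell_subset hρ2 hρr
  have hTm : MeasurableSet T := measurableSet_shell _ _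
  set ζ : EuclideanSpace ℝ (Fin (m + 2)) → ℝ := fun x => cutoff (ρ / 2) x * (1 - cutoff (L * ρ) x)
    with hζ
  have hc0 : ∀ x : EuclideanSpace ℝ (Fin (m + 2)), 0 ≤ 1 - cutoff (L * ρ) x := fun x =>
    sub_nonneg.2 cutoff_le_one
  have hc1 : ∀ x : EuclideanSpace ℝ (Fin (m + 2)), 1 - cutoff (L * ρ) x ≤ 1 := fun x =>
    sub_le_self _ cutoff_nonneg
  have hζ0 : ∀ x, 0 ≤ ζ x := fun x => mul_nonneg cutoff_nonneg (hc0 x)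
  have hζc : ContDiff ℝ 1 ζ := (contDiff_cutoff _).mul (contDiff_const.sub (contDiff_cutoff _))
  have hζa : ∀ x, ‖x‖ ≤ ρ / 2 → ζ x = 0 := fun x hx => by simp [hζ, cutoff_of_le hρ2 hx]
  have hζb : ∀ x, 2 * L * ρ ≤ ‖x‖ → ζ x = 0 := fun x hx => by
    simp [hζ, cutoff_of_ge hLρ (by linarith : 2 * (L * ρ) ≤ ‖x‖)]
  have hζg : ∀ x, ‖gradient ζ x‖ ≤ 2 * (4 / (ρ / 2)) := by
    intro x
    have h1 := (((contDiff_cutoff (ρ / 2)).differentiable (by norm_num)) x).hasGradientAt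
    have h2 := ((((contDiff_cutoff (L * ρ)).differentiable (by norm_num)) x).hasGradientAt
      ).fun_const_sub 1
    rw [hζ, (h1.fun_mul h2).gradient]
    refine (norm_add_le _ _).trans ?_
    rw [norm_smul, norm_smul, norm_neg, norm_of_nonneg cutoff_nonneg, norm_of_nonneg (hc0 x),
      two_mul]
    have h3 : 4 / (L * ρ) ≤ 4 / (ρ / 2) := by gcongr; linarith
    refine add_le_add ?_ ?_
    · exact (mul_le_of_le_one_left (norm_nonneg _) cutoff_le_one).trans
        ((norm_gradient_cutoff_le hLρ).trans h3)
    · exact (mul_le_of_le_one_left (norm_nonneg _) (hc1 x)).trans (norm_gradient_cutoff_le hρ2)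
  clear_value ζ
  set φ : EuclideanSpace ℝ (Fin (m + 2)) → ℝ := fun x => (h x - c * Real.log ρ) * ζ x ^ (m + 2)
    with hφ
  have hφa : ∀ x, ‖x‖ < ρ / 2 → φ =ᶠ[𝓝 x] fun _ => 0 := fun x hx => by
    filter_upwards [continuous_norm.continuousAt.eventually_lt continuousAt_const hx] with y hy
    simp [hφ, hζa y hy.le]
  have hφb : ∀ x, 2 * L * ρ < ‖x‖ → φ =ᶠ[𝓝 x] fun _ => 0 := fun x hx => by
    filter_upwards [continuousAt_const.eventually_lt continuous_norm.continuousAt hx] with y hy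
    simp [hφ, hζb y hy.le]
  have hhat : ∀ x, x ≠ 0 → ‖x‖ < r → ContDiffAt ℝ 1 h x := fun x hx hxr =>
    hh.contDiffAt (hUo.mem_nhds ⟨hx, hxr⟩)
  obtain ⟨h1, h2, h3⟩ := admissible_of_eventuallyEq (r := r) (φ := φ) (fun x hx => by
    rcases lt_or_ge ‖x‖ (ρ / 2) with h | h
    · exact contDiffAt_const.congr_of_eventuallyEq (hφa x h)
    · have hx0 := norm_pos_iff.1 (hρ2.trans_le h)
      exact ((hhat x hx0 hx).sub contDiffAt_const).mul (hζc.contDiffAt.pow _))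
    (fun x hx => hφb x (hρr.trans_le hx))
  have hg0 : ∀ x, x ∉ T → gradient φ x = 0 := fun x hx => by
    rcases lt_or_ge ‖x‖ (ρ / 2) with h | h
    · exact gradient_eq_zero_of_eventuallyEq_const (hφa x h)
    · exact gradient_eq_zero_of_eventuallyEq_const (hφb x (not_le.1 fun hle => hx ⟨h, hle⟩))
  have hsol' := hsol φ h1 h2 h3
  have hφ0 : φ 0 = 0 := by simp [hφ, hζa 0 (by simpa using hρ2.le)]
  rw [hφ0, mul_zero, neg_zero, setIntegral_eq_of_subset_of_forall_sdiff_eq_zero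
    measurableSet_ball (fun x hx => mem_ball_zero_iff.2 (hTU hx).2 : T ⊆ ball 0 r)
    (fun x hx => by rw [hg0 x hx.2, inner_zero_right, mul_zero])] at hsol'
  have hDc : ContinuousOn (gradient h) {x | x ≠ 0 ∧ ‖x‖ < r} := hh.continuousOn_gradient hUo
  have hIF : IntegrableOn (fun x => ‖gradient h x‖ ^ m * ⟪gradient h x, gradient φ x⟫_ℝ) T :=
    ContinuousOn.integrableOn_shell ((hDc.norm.pow _).mul
      (hDc.inner h1.continuous_gradient.continuousOn)) hρ2 hρr
  have hIA : IntegrableOn (fun x => 1 / 2 * (ζ x ^ (m + 2) * ‖gradient h x‖ ^ (m + 2))) T :=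
    ContinuousOn.integrableOn_shell (continuousOn_const.mul
      ((hζc.continuous.continuousOn.pow _).mul (hDc.norm.pow _))) hρ2 hρr
  have hIK : IntegrableOn (fun _ => (4 * M * (m + 2)) ^ (m + 2) * (4 / (ρ / 2)) ^ (m + 2)) T :=
    integrableOn_const (isCompact_shell _ _).measure_lt_top.ne
  have hpt : ∀ x ∈ T, 1 / 2 * (ζ x ^ (m + 2) * ‖gradient h x‖ ^ (m + 2)) ≤
      ‖gradient h x‖ ^ m * ⟪gradient h x, gradient φ x⟫_ℝ
        + (4 * M * (m + 2)) ^ (m + 2) * (4 / (ρ / 2)) ^ (m + 2) := by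
    intro x hx
    have hxU := hTU hx
    have hx0 : 0 < ‖x‖ := norm_pos_iff.2 hxU.1
    have hgM : |h x - c * Real.log ρ| ≤ M := by
      have e : h x - c * Real.log ρ = (h x - c * Real.log ‖x‖) + c * Real.log (‖x‖ / ρ) := by
        rw [Real.log_div hx0.ne' hρ.ne']; ring
      have h5 : |Real.log (‖x‖ / ρ)| ≤ Real.log (2 * L) := by
        rw [abs_le, ← Real.log_inv]
        constructor
        · refine Real.log_le_log (by positivity) ?_
          rw [le_div_iff₀ hρ]
          have h6 : (2 * L)⁻¹ ≤ 1 / 2 := by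
            rw [one_div]; exact inv_anti₀ two_pos (by linarith)
          have := hx.1
          nlinarith
        · refine Real.log_le_log (by positivity) ?_
          rw [div_le_iff₀ hρ]
          exact hx.2
      rw [e, hM]
      refine (abs_add_le _ _).trans (add_le_add ((hlog x hxU.1 hxU.2).trans (le_abs_self C)) ?_)
      rw [abs_mul]
      exact mul_le_mul_of_nonneg_left h5 (abs_nonneg c)
    have hgr : HasGradientAt h (gradient h x) x :=
      ((hhat x hxU.1 hxU.2).differentiableAt (by norm_num)).hasGradientAt
    have hgr' : HasGradientAt (fun y => h y - c * Real.log ρ) (gradient h x) x := by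
      rw [hasGradientAt_iff_hasFDerivAt] at hgr ⊢
      exact hgr.sub_const _
    have e2 := hgr'.fun_mul (((hζc.differentiable (by norm_num)) x).hasGradientAt.fun_pow (m + 2))
    have hB : |(h x - c * Real.log ρ) * ((m + 2) * ζ x ^ (m + 1)) *
        (‖gradient h x‖ ^ m * ⟪gradient h x, gradient ζ x⟫_ℝ)| ≤
        1 / 2 * (ζ x ^ (m + 2) * ‖gradient h x‖ ^ (m + 2))
          + (4 * M * (m + 2)) ^ (m + 2) * (4 / (ρ / 2)) ^ (m + 2) := by
      have hz := hζ0 x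
      have hy := mul_pow_succ_le_half_add (b := M * (m + 2) * (2 * (4 / (ρ / 2))))
        (by positivity) (mul_nonneg (hζ0 x) (norm_nonneg (gradient h x))) m
      rw [abs_mul, abs_mul, abs_of_nonneg (by positivity : 0 ≤ ((m : ℝ) + 2) * ζ x ^ (m + 1)),
        abs_mul (‖gradient h x‖ ^ m), abs_of_nonneg (by positivity : 0 ≤ ‖gradient h x‖ ^ m)]
      calc |h x - c * Real.log ρ| * ((m + 2) * ζ x ^ (m + 1)) *
            (‖gradient h x‖ ^ m * |⟪gradient h x, gradient ζ x⟫_ℝ|)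
          ≤ M * ((m + 2) * ζ x ^ (m + 1)) * (‖gradient h x‖ ^ m *
            (‖gradient h x‖ * (2 * (4 / (ρ / 2))))) := by
            gcongr
            exact (abs_real_inner_le_norm _ _).trans
              (mul_le_mul_of_nonneg_left (hζg x) (norm_nonneg _))
        _ = M * (m + 2) * (2 * (4 / (ρ / 2))) * (ζ x * ‖gradient h x‖) ^ (m + 1) := by
            rw [mul_pow]; ring
        _ ≤ _ := hy
        _ = _ := by rw [mul_pow (ζ x), ← mul_pow (4 * M * ((m : ℝ) + 2))]; congr 2; ring
    have e3 : ‖gradient h x‖ ^ m * ⟪gradient h x, gradient φ x⟫_ℝ =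
        ζ x ^ (m + 2) * ‖gradient h x‖ ^ (m + 2) + (h x - c * Real.log ρ) *
          ((m + 2) * ζ x ^ (m + 1)) * (‖gradient h x‖ ^ m * ⟪gradient h x, gradient ζ x⟫_ℝ) := by
      rw [hφ, e2.gradient, inner_add_right, real_inner_smul_right, real_inner_smul_right,
        real_inner_smul_right, real_inner_self_eq_norm_sq]
      push_cast
      ring
    rw [e3]
    have := (abs_le.1 hB).1
    linarith
  have hle := setIntegral_mono_on hIA (hIF.add hIK) hTm hpt
  rw [integral_add' hIF hIK, hsol', zero_add, setIntegral_const, smul_eq_mul,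
    integral_const_mul] at hle
  have hv' := hvol (ρ / 2) hρ2 T (shell_mono le_rfl (by linarith))
  have hsub : shell ρ (L * ρ) ⊆ T := shell_mono (by linarith) (by linarith)
  have hfin : ∫ x in shell ρ (L * ρ), ‖gradient h x‖ ^ (m + 2) ≤
      ∫ x in T, ζ x ^ (m + 2) * ‖gradient h x‖ ^ (m + 2) := by
    have hIA' : IntegrableOn (fun x => ζ x ^ (m + 2) * ‖gradient h x‖ ^ (m + 2)) T :=
      ContinuousOn.integrableOn_shell
        ((hζc.continuous.continuousOn.pow _).mul (hDc.norm.pow _)) hρ2 hρr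
    rw [setIntegral_congr_fun (g := fun x => ζ x ^ (m + 2) * ‖gradient h x‖ ^ (m + 2))
      (measurableSet_shell _ _) (fun x hx => ?_)]
    · exact setIntegral_mono_set hIA' (Eventually.of_forall fun x =>
        mul_nonneg (pow_nonneg (hζ0 x) _) (by positivity)) hsub.eventuallyLE
    · simp [hζ, cutoff_of_ge hρ2 (by linarith [hx.1] : 2 * (ρ / 2) ≤ ‖x‖), cutoff_of_le hLρ hx.2]
  have hA : 0 ≤ (4 * M * (m + 2)) ^ (m + 2) := by positivity
  have := mul_le_mul_of_nonneg_left hv' hA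
  linarith

theorem continuousOn_indicator_of_eqOn_sphere {F : Type*} [NormedAddCommGroup F] {r : ℝ}
    {v : F → ℝ} (hv : ContinuousOn v (closedBall 0 r \ {0})) (h0 : ∀ x ∈ sphere 0 r, v x = 0) :
    ContinuousOn ({x | x ≠ 0 ∧ ‖x‖ < r}.indicator v) {0}ᶜ := by
  have h1 : ∀ x ∈ closedBall 0 r \ {0}, {x | x ≠ 0 ∧ ‖x‖ < r}.indicator v x = v x := by
    intro x hx
    by_cases hxU : x ∈ {x : F | x ≠ 0 ∧ ‖x‖ < r}
    · exact indicator_of_mem hxU v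
    · rw [indicator_of_notMem hxU, h0 x]
      have h2 : ‖x‖ ≤ r := by simpa using hx.1
      have h3 : r ≤ ‖x‖ := not_lt.1 fun h => hxU ⟨hx.2, h⟩
      simpa using le_antisymm h2 h3
  have h2 : ∀ x ∈ {x : F | r ≤ ‖x‖}, {x | x ≠ 0 ∧ ‖x‖ < r}.indicator v x = 0 := fun x hx =>
    indicator_of_notMem (fun h => not_lt.2 hx h.2) v
  have hc : IsClosed {x : F | r ≤ ‖x‖} := isClosed_le continuous_const continuous_norm
  have hU : ({0}ᶜ : Set F) ⊆ (closedBall 0 r \ {0}) ∪ {x : F | r ≤ ‖x‖} := by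
    intro x hx
    rcases le_total ‖x‖ r with h | h
    · exact Or.inl ⟨by simpa using h, hx⟩
    · exact Or.inr h
  intro x hx
  refine ContinuousWithinAt.mono (ContinuousWithinAt.union ?_ ?_) hU
  · by_cases hxr : ‖x‖ ≤ r
    · have hxm : x ∈ closedBall 0 r \ {0} := ⟨by simpa using hxr, hx⟩
      exact (hv x hxm).congr h1 (h1 x hxm)
    · refine continuousWithinAt_of_notMem_closure fun h => hxr ?_
      simpa using closure_minimal sdiff_subset isClosed_closedBall h
  · by_cases hxr : r ≤ ‖x‖
    · exact continuousWithinAt_const.congr h2 (h2 x hxr)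
    · exact continuousWithinAt_of_notMem_closure fun h => hxr (hc.closure_subset h)

theorem integrableOn_pLaplace {F : Type*} [NormedAddCommGroup F] [NormedSpace ℝ F]
    [MeasurableSpace F] [BorelSpace F] [SecondCountableTopology F] {μ : Measure F} {s : Set F}
    {G : F → F} {m : ℕ} (hG : Measurable G)
    (hq : IntegrableOn (fun x => ‖G x‖ ^ ((m : ℝ) + 1)) s μ) :
    IntegrableOn (fun x => ‖G x‖ ^ m • G x) s μ := by
  refine Integrable.mono' hq ((hG.norm.pow_const m).smul hG).aestronglyMeasurable
    (Eventually.of_forall fun x => ?_)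
  rw [norm_smul, norm_pow, norm_norm, ← pow_succ]
  exact_mod_cast le_rfl

theorem integrableOn_norm_sub_rpow {F : Type*} [NormedAddCommGroup F]
    [MeasurableSpace F] [BorelSpace F] [SecondCountableTopology F] {μ : Measure F} {s : Set F}
    {G H : F → F} {q : ℝ} (h0 : 0 ≤ q) (hG : Measurable G) (hH : Measurable H)
    (hGq : IntegrableOn (fun x => ‖G x‖ ^ q) s μ) (hHq : IntegrableOn (fun x => ‖H x‖ ^ q) s μ) :
    IntegrableOn (fun x => ‖G x - H x‖ ^ q) s μ := by
  refine Integrable.mono' ((hGq.add hHq).const_mul (2 ^ q))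
    ((hG.sub hH).norm.pow_const q).aestronglyMeasurable (Eventually.of_forall fun x => ?_)
  have h1 : ‖G x - H x‖ ≤ 2 * max ‖G x‖ ‖H x‖ :=
    (norm_sub_le _ _).trans (by linarith [le_max_left ‖G x‖ ‖H x‖, le_max_right ‖G x‖ ‖H x‖])
  rw [norm_of_nonneg (by positivity)]
  refine (rpow_le_rpow (norm_nonneg _) h1 h0).trans ?_
  rw [mul_rpow (by norm_num) (by positivity), Pi.add_apply]
  refine mul_le_mul_of_nonneg_left ?_ (by positivity)
  rcases max_choice ‖G x‖ ‖H x‖ with h | h <;> rw [h]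
  · exact le_add_of_nonneg_right (by positivity)
  · exact le_add_of_nonneg_left (by positivity)

theorem puncturedBall_ae_eq_ball {n : ℕ} (r : ℝ) :
    ({x | x ≠ 0 ∧ ‖x‖ < r} : Set (EuclideanSpace ℝ (Fin (n + 2)))) =ᵐ[volume] ball 0 r := by
  have h : ({x | x ≠ 0 ∧ ‖x‖ < r} : Set (EuclideanSpace ℝ (Fin (n + 2)))) = ball 0 r \ {0} := by
    ext x; simp [and_comm]
  rw [h]
  exact sdiff_null_ae_eq_self (measure_singleton 0)

theorem FluxComparison.of_weakSolution {m : ℕ} {r d c γ C : ℝ}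
    {u h g : EuclideanSpace ℝ (Fin (m + 2)) → ℝ} (hr : 0 < r) (hd : 0 < d)
    (hdle : ∀ X Y : EuclideanSpace ℝ (Fin (m + 2)),
      d * ‖X - Y‖ ^ (m + 2) ≤ ⟪‖X‖ ^ m • X - ‖Y‖ ^ m • Y, X - Y⟫_ℝ)
    (hg : ∀ x, 0 ≤ g x) (hgint : IntegrableOn g (ball 0 r))
    (hu : ContDiffOn ℝ 1 u (closedBall 0 r \ {0})) (hh : ContDiffOn ℝ 1 h (closedBall 0 r \ {0}))
    (huq : ∀ q : ℝ, 1 ≤ q → q < m + 2 → IntegrableOn (fun x => ‖gradient u x‖ ^ q) (ball 0 r))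
    (hhq : ∀ q : ℝ, 1 ≤ q → q < m + 2 → IntegrableOn (fun x => ‖gradient h x‖ ^ q) (ball 0 r))
    (husol : ∀ φ : EuclideanSpace ℝ (Fin (m + 2)) → ℝ, ContDiff ℝ 1 φ → HasCompactSupport φ →
      tsupport φ ⊆ ball 0 r →
      ∫ x in ball 0 r, ‖gradient u x‖ ^ m * ⟪gradient u x, gradient φ x⟫_ℝ =
        (∫ x in ball 0 r, g x * φ x) - γ * φ 0)
    (hhsol : ∀ φ : EuclideanSpace ℝ (Fin (m + 2)) → ℝ, ContDiff ℝ 1 φ → HasCompactSupport φ →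
      tsupport φ ⊆ ball 0 r →
      ∫ x in ball 0 r, ‖gradient h x‖ ^ m * ⟪gradient h x, gradient φ x⟫_ℝ = -(γ * φ 0))
    (hbdry : ∀ x ∈ sphere (0 : EuclideanSpace ℝ (Fin (m + 2))) r, h x = u x)
    (hlog : ∀ x, x ≠ 0 → ‖x‖ < r → |h x - c * Real.log ‖x‖| ≤ C) :
    FluxComparison r d ({x | x ≠ 0 ∧ ‖x‖ < r}.indicator fun x => u x - h x)
      ((ball 0 r).indicator g) ({x | x ≠ 0 ∧ ‖x‖ < r}.indicator (gradient h))
      ({x | x ≠ 0 ∧ ‖x‖ < r}.indicator fun x => gradient u x - gradient h x)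
      ({x | x ≠ 0 ∧ ‖x‖ < r}.indicator fun x =>
        ‖gradient u x‖ ^ m • gradient u x - ‖gradient h x‖ ^ m • gradient h x) := by
  set U : Set (EuclideanSpace ℝ (Fin (m + 2))) := {x | x ≠ 0 ∧ ‖x‖ < r} with hU
  have hUo : IsOpen U := isOpen_puncturedBall r
  have hUm : MeasurableSet U := hUo.measurableSet
  have hUs : U ⊆ closedBall 0 r \ {0} := fun x hx => ⟨by simpa using hx.2.le, hx.1⟩
  have hUb : U =ᵐ[volume] ball 0 r := puncturedBall_ae_eq_ball r
  have hUball : U ⊆ ball 0 r := fun x hx => by simpa using hx.2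
  have hum := measurable_gradient u
  have hhm := measurable_gradient h
  have hugc : ContinuousOn (gradient u) U := (hu.mono hUs).continuousOn_gradient hUo
  have hhgc : ContinuousOn (gradient h) U := (hh.mono hUs).continuousOn_gradient hUo
  have huat : ∀ x ∈ U, ContDiffAt ℝ 1 u x := fun x hx =>
    (hu.mono hUs).contDiffAt (hUo.mem_nhds hx)
  have hhat : ∀ x ∈ U, ContDiffAt ℝ 1 h x := fun x hx =>
    (hh.mono hUs).contDiffAt (hUo.mem_nhds hx)
  have hev : ∀ x ∈ U, (U.indicator fun x => u x - h x) =ᶠ[𝓝 x] fun x => u x - h x := fun x hx => by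
    filter_upwards [hUo.mem_nhds hx] with y hy using indicator_of_mem hy _
  have huV := integrableOn_pLaplace (m := m) hum (huq _ (by linarith [m.cast_nonneg (α := ℝ)])
    (by linarith))
  have hhV := integrableOn_pLaplace (m := m) hhm (hhq _ (by linarith [m.cast_nonneg (α := ℝ)])
    (by linarith))
  have hv : ContinuousOn (fun x => u x - h x) (closedBall 0 r \ {0}) :=
    hu.continuousOn.sub hh.continuousOn
  refine ⟨hr, hd, fun x => indicator_nonneg (fun x _ => hg x) x,
    (integrable_indicator_iff measurableSet_ball).2 hgint, ?_, ?_, ?_, ?_, ?_, ?_, ?_, ?_, ?_, ?_,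
    ?_, ?_, ?_, ?_, ?_, ?_⟩
  · classical
    rw [← piecewise_eq_indicator]
    exact (hv.mono hUs).measurable_piecewise continuousOn_const hUm
  · exact continuousOn_indicator_of_eqOn_sphere hv fun x hx => by simp [hbdry x hx]
  · exact fun x hx => indicator_of_notMem (fun h => not_lt.2 hx h.2) _
  · exact fun x hx hxr => ((huat x ⟨hx, hxr⟩).sub (hhat x ⟨hx, hxr⟩)).congr_of_eventuallyEq
      (hev x ⟨hx, hxr⟩)
  · intro x hx hxr
    rw [indicator_of_mem (show x ∈ U from ⟨hx, hxr⟩)]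
    have h1 := ((huat x ⟨hx, hxr⟩).differentiableAt (by norm_num)).hasGradientAt
    have h2 := ((hhat x ⟨hx, hxr⟩).differentiableAt (by norm_num)).hasGradientAt
    rw [hasGradientAt_iff_hasFDerivAt] at h1 h2 ⊢
    rw [map_sub]
    exact (h1.sub h2).congr_of_eventuallyEq (hev x ⟨hx, hxr⟩)
  · exact fun x hx => indicator_of_notMem (s := U) hx _
  · exact (hugc.sub hhgc).congr fun x hx => indicator_of_mem hx _
  · exact hhgc.congr fun x hx => indicator_of_mem hx _
  · exact (((hugc.norm.pow m).smul hugc).sub ((hhgc.norm.pow m).smul hhgc)).congr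
      fun x hx => indicator_of_mem hx _
  · exact (hum.sub hhm).indicator hUm
  · exact (integrable_indicator_iff hUm).2 ((huV.sub hhV).mono_set hUball)
  · intro q hq1 hq2
    have h1 := integrableOn_norm_sub_rpow (by linarith) hum hhm (huq q hq1 hq2) (hhq q hq1 hq2)
    refine ((integrable_indicator_iff hUm).2 (h1.mono_set hUball)).congr
      (Eventually.of_forall fun x => ?_)
    by_cases hx : x ∈ U
    · simp [hx]
    · simp [hx, zero_rpow (by linarith : q ≠ 0)]
  · intro x
    by_cases hx : x ∈ U
    · simpa only [indicator_of_mem hx] using hdle (gradient u x) (gradient h x)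
    · simp [hx]
  · intro x
    by_cases hx : x ∈ U
    · simpa only [indicator_of_mem hx, mul_assoc] using
        norm_pLaplace_sub_le m (gradient u x) (gradient h x)
    · simp [hx]
  · intro φ h1 h2 h3
    have e1 : ∀ x, ⟪U.indicator (fun x => ‖gradient u x‖ ^ m • gradient u x -
        ‖gradient h x‖ ^ m • gradient h x) x, gradient φ x⟫_ℝ =
        U.indicator (fun x => ⟪‖gradient u x‖ ^ m • gradient u x, gradient φ x⟫_ℝ -
        ⟪‖gradient h x‖ ^ m • gradient h x, gradient φ x⟫_ℝ) x := by
      intro x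
      by_cases hx : x ∈ U
      · simp only [indicator_of_mem hx, inner_sub_left]
      · simp only [indicator_of_notMem hx, inner_zero_left]
    have e2 : ∀ x, (ball 0 r).indicator g x * φ x =
        (ball 0 r).indicator (fun x => g x * φ x) x := fun x => by
      rw [indicator_mul_left]
    simp_rw [e1, e2]
    rw [integral_indicator hUm, integral_indicator measurableSet_ball, setIntegral_congr_set hUb,
      integral_sub (Integrable.inner_gradient huV h1 h2) (Integrable.inner_gradient hhV h1 h2)]
    simp_rw [real_inner_smul_left]
    rw [husol φ h1 h2 h3, hhsol φ h1 h2 h3]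
    ring
  · intro L hL
    obtain ⟨D, hD0, hD⟩ := exists_setIntegral_shell_gradient_le (hh.mono hUs) hlog hhsol hL
    refine ⟨D, hD0, fun ρ hρ hρr => le_trans (le_of_eq ?_) (hD ρ hρ hρr)⟩
    refine setIntegral_congr_fun (measurableSet_shell _ _) fun x hx => ?_
    have hxU : x ∈ U := ⟨norm_pos_iff.1 (hρ.trans_le hx.1), hx.2.trans_lt (by nlinarith)⟩
    simp only [indicator_of_mem hxU]

theorem two_inv_pow_le_pLaplace_quotient {F : Type*} [NormedAddCommGroup F] [InnerProductSpace ℝ F]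
    (m : ℕ) {X Y : F} (h : X ≠ Y) :
    2⁻¹ ^ (m + 1) ≤ ⟪‖X‖ ^ m • X - ‖Y‖ ^ m • Y, X - Y⟫_ℝ / ‖X - Y‖ ^ (m + 2) :=
  (le_div_iff₀ (pow_pos (norm_pos_iff.2 (sub_ne_zero.2 h)) _)).2 (inner_pLaplace_sub_lower m X Y)

theorem dconst_pos (m : ℕ) : 0 < dconst (m + 2) := by
  refine lt_of_lt_of_le (by positivity : (0 : ℝ) < 2⁻¹ ^ (m + 1)) (le_csInf ?_ ?_)
  · obtain ⟨X, hX⟩ := exists_ne (0 : EuclideanSpace ℝ (Fin (m + 2)))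
    exact ⟨_, X, 0, hX, rfl⟩
  · rintro _ ⟨X, Y, hXY, rfl⟩
    exact two_inv_pow_le_pLaplace_quotient m hXY

theorem dconst_mul_norm_pow_le (m : ℕ) (X Y : EuclideanSpace ℝ (Fin (m + 2))) :
    dconst (m + 2) * ‖X - Y‖ ^ (m + 2) ≤ ⟪‖X‖ ^ m • X - ‖Y‖ ^ m • Y, X - Y⟫_ℝ := by
  rcases eq_or_ne X Y with rfl | h
  · simp
  · rw [← le_div_iff₀ (pow_pos (norm_pos_iff.2 (sub_ne_zero.2 h)) _)]
    refine csInf_le ⟨2⁻¹ ^ (m + 1), ?_⟩ ⟨X, Y, h, rfl⟩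
    rintro _ ⟨X, Y, hXY, rfl⟩
    exact two_inv_pow_le_pLaplace_quotient m hXY

theorem entropy_estimates
    (n : ℕ) (hn : 2 ≤ n) (α r γ : ℝ) (hr : 0 < r) (hr1 : r ≤ 1)
    (u h : EuclideanSpace ℝ (Fin n) → ℝ)
    (hu : ContDiffOn ℝ 1 u (closedBall (0 : EuclideanSpace ℝ (Fin n)) r \ {0}))
    (hint : IntegrableOn (fun x => ‖x‖ ^ ((n : ℝ) * α) * Real.exp (u x))
      (ball (0 : EuclideanSpace ℝ (Fin n)) r))
    (huq : ∀ q : ℝ, 1 ≤ q → q < n →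
      IntegrableOn (fun x => ‖gradient u x‖ ^ q) (ball (0 : EuclideanSpace ℝ (Fin n)) r))
    (husol : ∀ φ : EuclideanSpace ℝ (Fin n) → ℝ, ContDiff ℝ 1 φ → HasCompactSupport φ →
        tsupport φ ⊆ ball (0 : EuclideanSpace ℝ (Fin n)) r →
      ∫ x in ball (0 : EuclideanSpace ℝ (Fin n)) r,
          ‖gradient u x‖ ^ (n - 2) * ⟪gradient u x, gradient φ x⟫_ℝ
        = (∫ x in ball (0 : EuclideanSpace ℝ (Fin n)) r,
            ‖x‖ ^ ((n : ℝ) * α) * Real.exp (u x) * φ x) - γ * φ 0)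
    (hh : ContDiffOn ℝ 1 h (closedBall (0 : EuclideanSpace ℝ (Fin n)) r \ {0}))
    (hhq : ∀ q : ℝ, 1 ≤ q → q < n →
      IntegrableOn (fun x => ‖gradient h x‖ ^ q) (ball (0 : EuclideanSpace ℝ (Fin n)) r))
    (hbdry : ∀ x ∈ sphere (0 : EuclideanSpace ℝ (Fin n)) r, h x = u x)
    (hlog : ∃ C : ℝ, ∀ x ∈ ball (0 : EuclideanSpace ℝ (Fin n)) r, x ≠ 0 →
      |h x - cgamma n γ * Real.log ‖x‖| ≤ C)
    (hhsol : ∀ φ : EuclideanSpace ℝ (Fin n) → ℝ, ContDiff ℝ 1 φ → HasCompactSupport φ →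
        tsupport φ ⊆ ball (0 : EuclideanSpace ℝ (Fin n)) r →
      ∫ x in ball (0 : EuclideanSpace ℝ (Fin n)) r,
          ‖gradient h x‖ ^ (n - 2) * ⟪gradient h x, gradient φ x⟫_ℝ
        = -(γ * φ 0)) :
    (∀ x ∈ ball (0 : EuclideanSpace ℝ (Fin n)) r \ {0}, 0 ≤ u x - h x) ∧
    ∀ k a : ℝ, 0 < k → 0 < a →
      (∫ x in {x ∈ ball (0 : EuclideanSpace ℝ (Fin n)) r |
            k < u x - h x ∧ u x - h x < k + a},
          ‖gradient (fun y => u y - h y) x‖ ^ n)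
        ≤ (a / dconst n) * ∫ x in ball (0 : EuclideanSpace ℝ (Fin n)) r,
            ‖x‖ ^ ((n : ℝ) * α) * Real.exp (u x) := by
  obtain ⟨m, rfl⟩ : ∃ m, n = m + 2 := ⟨n - 2, by omega⟩
  obtain ⟨C, hC⟩ := hlog
  have hcast : ((m + 2 : ℕ) : ℝ) = m + 2 := by push_cast; ring
  have H := FluxComparison.of_weakSolution
    (g := fun x => ‖x‖ ^ (((m + 2 : ℕ) : ℝ) * α) * rexp (u x))
    hr (dconst_pos m) (dconst_mul_norm_pow_le m) (fun x => by positivity) hint hu hh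
    (fun q h1 h2 => huq q h1 (hcast ▸ h2)) (fun q h1 h2 => hhq q h1 (hcast ▸ h2)) husol hhsol hbdry
    (fun x hx hxr => hC x (by simpa using hxr) hx)
  refine ⟨fun x hx => ?_, fun k a hk ha => ?_⟩
  · have hxU : x ∈ {x : EuclideanSpace ℝ (Fin (m + 2)) | x ≠ 0 ∧ ‖x‖ < r} :=
      ⟨hx.2, by simpa using hx.1⟩
    have h1 := H.w_nonneg hx.2
    rwa [indicator_of_mem hxU] at h1
  · have h1 := H.setIntegral_band_le hk ha
    rw [integral_indicator measurableSet_ball] at h1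
    refine le_trans (le_of_eq ?_) h1
    have hset : {x ∈ ball (0 : EuclideanSpace ℝ (Fin (m + 2))) r |
        k < u x - h x ∧ u x - h x < k + a} =ᵐ[volume]
        {x | k < {x | x ≠ 0 ∧ ‖x‖ < r}.indicator (fun x => u x - h x) x ∧
          {x | x ≠ 0 ∧ ‖x‖ < r}.indicator (fun x => u x - h x) x < k + a} := by
      filter_upwards [compl_mem_ae_iff.2 (measure_singleton (μ := volume)
        (0 : EuclideanSpace ℝ (Fin (m + 2))))] with x hx
      refine propext ?_
      by_cases hxr : ‖x‖ < r
      · have hxU : x ∈ {x : EuclideanSpace ℝ (Fin (m + 2)) | x ≠ 0 ∧ ‖x‖ < r} := ⟨hx, hxr⟩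
        change (x ∈ ball 0 r ∧ k < u x - h x ∧ u x - h x < k + a) ↔
          (k < indicator _ _ x ∧ indicator _ _ x < k + a)
        rw [indicator_of_mem hxU, and_iff_right (by simpa using hxr)]
      · have hxU : x ∉ {x : EuclideanSpace ℝ (Fin (m + 2)) | x ≠ 0 ∧ ‖x‖ < r} := fun h => hxr h.2
        change (x ∈ ball 0 r ∧ k < u x - h x ∧ u x - h x < k + a) ↔
          (k < indicator _ _ x ∧ indicator _ _ x < k + a)
        rw [indicator_of_notMem hxU]
        exact ⟨fun h => absurd (by simpa using h.1) hxr, fun h => absurd h.1 hk.not_gt⟩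
    rw [setIntegral_congr_set hset]
    refine setIntegral_congr_fun ((measurableSet_lt measurable_const H.w_meas).inter
      (measurableSet_lt H.w_meas measurable_const)) fun x hx => ?_
    have hxU : x ∈ {x : EuclideanSpace ℝ (Fin (m + 2)) | x ≠ 0 ∧ ‖x‖ < r} := by
      by_contra hxU
      have := hx.1
      rw [indicator_of_notMem hxU] at this
      exact hk.not_gt this
    have h2 : (fun y => u y - h y) =ᶠ[𝓝 x]
        {x | x ≠ 0 ∧ ‖x‖ < r}.indicator (fun x => u x - h x) := by
      filter_upwards [(isOpen_puncturedBall r).mem_nhds hxU] with y hy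
        using (indicator_of_mem (s := {x | x ≠ 0 ∧ ‖x‖ < r}) hy fun x => u x - h x).symm
    have h3 := hasGradientAt_iff_hasFDerivAt.1 (H.w_grad x hxU.1 hxU.2)
    have h4 := (hasGradientAt_iff_hasFDerivAt.2 (h3.congr_of_eventuallyEq h2)).gradient
    simp only [h4]
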